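/- arXiv:1403.3042 — 2 statements merged into one kernel-verified Lean document; each statement's English description precedes it below -/
import Mathlib

section
/- Let M be a Cisinski model category, i.e., a combinatorial model category whose underlying category is a Grothendieck topos and whose cofibrations are the monomorphisms. Suppose M is κ-combinatorial for a regular cardinal κ and that there is a cylinder functor Cyl: M → M which preserves κ-presentable objects. Then the full subcategory W of M^→ spanned by the weak equivalences is κ-accessible: it is closed under κ-filtered colimits in M^→ and every weak equivalence is a κ-filtered colimit in M^→ of weak equivalences between κ-presentable objects. -/
open CategoryTheory CategoryTheory.Limits

universe w v u

namespace PaperAcc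

/-- A category `J` is `κ`-filtered if every diagram indexed by a category with fewer than `κ`
arrows admits a cocone. -/
def IsCardinalFiltered (J : Type v) [Category.{v} J] (κ : Cardinal.{v}) : Prop :=
  ∀ (A : Type v) [SmallCategory A], Cardinal.mk (Arrow A) < κ →
    ∀ F : A ⥤ J, Nonempty (Cocone F)

/-- A preorder `P` is `κ`-directed if every subset of cardinality `< κ` has an upper bound. -/
def IsCardinalDirected (P : Type v) [Preorder P] (κ : Cardinal.{v}) : Prop :=
  ∀ S : Set P, Cardinal.mk S < κ → ∃ p : P, ∀ s ∈ S, s ≤ p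

/-- An object `X` is `κ`-presentable if `Hom(X, -)` preserves `κ`-filtered colimits. -/
def IsPresentable {M : Type u} [Category.{v} M] (κ : Cardinal.{v}) (X : M) : Prop :=
  ∀ (J : Type v) [SmallCategory J], IsCardinalFiltered J κ →
    Nonempty (PreservesColimitsOfShape J (coyoneda.obj (Opposite.op X)))

/-- A presentation of `X` as a `κ`-filtered colimit of objects belonging to `P`. -/
structure FilteredColimitPresentation {M : Type u} [Category.{v} M] (κ : Cardinal.{v})
    (P : Set M) (X : M) where
  J : Type v
  [instJ : SmallCategory J]
  filtered : IsCardinalFiltered J κ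
  F : J ⥤ M
  mem : ∀ j, F.obj j ∈ P
  c : Cocone F
  isColimit : IsColimit c
  iso : c.pt ≅ X

/-- A presentation of `X` as a `κ`-directed colimit of objects belonging to `P`. -/
structure DirectedColimitPresentation {M : Type u} [Category.{v} M] (κ : Cardinal.{v})
    (P : Set M) (X : M) where
  J : Type v
  [instJ : Preorder J]
  directed : IsCardinalDirected J κ
  F : J ⥤ M
  mem : ∀ j, F.obj j ∈ P
  c : Cocone F
  isColimit : IsColimit c
  iso : c.pt ≅ X

/-- A class of arrows (viewed as a full subcategory of the arrow category) is closed under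
`κ`-filtered colimits. -/
def ClosedUnderFilteredColimits {M : Type u} [Category.{v} M] (κ : Cardinal.{v})
    (P : Set (Arrow M)) : Prop :=
  ∀ (J : Type v) [SmallCategory J], IsCardinalFiltered J κ →
    ∀ (F : J ⥤ Arrow M) (c : Cocone F), IsColimit c → (∀ j, F.obj j ∈ P) → c.pt ∈ P

/-- The morphisms having the right lifting property with respect to every member of the
family `f`. -/
def RlpOf {M : Type u} [Category.{v} M] {ι : Type w} {A B : ι → M}
    (f : ∀ i, A i ⟶ B i) : MorphismProperty M :=
  fun _ _ g => ∀ i, HasLiftingProperty (f i) g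

/-- The morphisms having the left lifting property with respect to every morphism in `P`. -/
def Llp {M : Type u} [Category.{v} M] (P : MorphismProperty M) : MorphismProperty M :=
  fun _ _ g => ∀ ⦃X Y : M⦄ (p : X ⟶ Y), P p → HasLiftingProperty g p

/-- The class `C` is cofibrantly generated by a set of morphisms between `κ`-presentable
objects: `C = llp(rlp(I))` for such a set `I`. -/
def CofibrantlyGeneratedByPresentables {M : Type u} [Category.{v} M] (κ : Cardinal.{v})
    (C : MorphismProperty M) : Prop :=
  ∃ (ι : Type v) (A B : ι → M) (f : ∀ i, A i ⟶ B i),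
    (∀ i, IsPresentable κ (A i)) ∧ (∀ i, IsPresentable κ (B i)) ∧
      C = Llp (RlpOf f)

/-- A category is locally `κ`-presentable: it is cocomplete and has a set of `κ`-presentable
objects such that every object is a `κ`-filtered colimit of objects from this set. -/
def IsLocallyPresentable (M : Type u) [Category.{v} M] (κ : Cardinal.{v}) : Prop :=
  HasColimits M ∧
    ∃ (ι : Type v) (G : ι → M), (∀ i, IsPresentable κ (G i)) ∧
      ∀ X : M, Nonempty (FilteredColimitPresentation κ (Set.range G) X)

/-- A class of morphisms is stable under retracts (in the arrow category). -/
def IsStableUnderRetracts {M : Type u} [Category.{v} M] (P : MorphismProperty M) : Prop :=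
  ∀ {X Y X' Y' : M} (f : X ⟶ Y) (g : X' ⟶ Y') (iX : X ⟶ X') (rX : X' ⟶ X)
    (iY : Y ⟶ Y') (rY : Y' ⟶ Y), iX ≫ rX = 𝟙 X → iY ≫ rY = 𝟙 Y →
    iX ≫ g = f ≫ iY → rX ≫ f = g ≫ rY → P g → P f

/-- A model structure on a category: classes of weak equivalences, cofibrations and fibrations
satisfying the axioms of a (closed) model category. -/
structure ModelStructure (M : Type u) [Category.{v} M] where
  W : MorphismProperty M
  Cof : MorphismProperty M
  Fib : MorphismProperty M
  W_id : ∀ X : M, W (𝟙 X)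
  W_comp : ∀ {X Y Z : M} (f : X ⟶ Y) (g : Y ⟶ Z), W f → W g → W (f ≫ g)
  W_of_comp_right : ∀ {X Y Z : M} (f : X ⟶ Y) (g : Y ⟶ Z), W g → W (f ≫ g) → W f
  W_of_comp_left : ∀ {X Y Z : M} (f : X ⟶ Y) (g : Y ⟶ Z), W f → W (f ≫ g) → W g
  W_retract : IsStableUnderRetracts W
  Cof_retract : IsStableUnderRetracts Cof
  Fib_retract : IsStableUnderRetracts Fib
  lift_trivCof_fib : ∀ {A B X Y : M} (i : A ⟶ B) (p : X ⟶ Y),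
    Cof i → W i → Fib p → HasLiftingProperty i p
  lift_cof_trivFib : ∀ {A B X Y : M} (i : A ⟶ B) (p : X ⟶ Y),
    Cof i → Fib p → W p → HasLiftingProperty i p
  fact_cof_trivFib : ∀ {X Y : M} (f : X ⟶ Y),
    ∃ (Z : M) (i : X ⟶ Z) (p : Z ⟶ Y), Cof i ∧ Fib p ∧ W p ∧ i ≫ p = f
  fact_trivCof_fib : ∀ {X Y : M} (f : X ⟶ Y),
    ∃ (Z : M) (i : X ⟶ Z) (p : Z ⟶ Y), Cof i ∧ W i ∧ Fib p ∧ i ≫ p = f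

/-- A model structure is `κ`-combinatorial if the underlying category is locally
`κ`-presentable and both cofibrations and trivial cofibrations are cofibrantly generated
by sets of morphisms between `κ`-presentable objects. -/
structure IsCombinatorial {M : Type u} [Category.{v} M] (S : ModelStructure M)
    (κ : Cardinal.{v}) : Prop where
  isRegular : κ.IsRegular
  locallyPresentable : IsLocallyPresentable M κ
  cofGenerated : CofibrantlyGeneratedByPresentables κ S.Cof
  trivCofGenerated : CofibrantlyGeneratedByPresentables κ (S.Cof ⊓ S.W)

/-- An object is cofibrant if the morphism from an(y) initial object to it is a cofibration. -/
def Cofibrant {M : Type u} [Category.{v} M] (S : ModelStructure M) (X : M) : Prop :=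
  ∀ ⦃O : M⦄, IsInitial O → ∀ f : O ⟶ X, S.Cof f

/-- A cylinder object for `X`: a factorization `X ⊔ X → C → X` of the codiagonal into
a cofibration followed by a weak equivalence. -/
structure CylinderObject {M : Type u} [Category.{v} M] (S : ModelStructure M) (X : M) where
  C : M
  i₀ : X ⟶ C
  i₁ : X ⟶ C
  p : C ⟶ X
  hi₀ : i₀ ≫ p = 𝟙 X
  hi₁ : i₁ ≫ p = 𝟙 X
  hp : S.W p
  hcof : ∀ (c : BinaryCofan X X) (hc : IsColimit c), S.Cof (hc.desc (BinaryCofan.mk i₀ i₁))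

/-- A commutative square on `(f, g, h, k)` (with `f : A ⟶ B`, `g : A ⟶ X`, `h : B ⟶ Y`,
`k : X ⟶ Y`) is a homotopy pushout: for some (equivalently, any) replacement of the span
`B ← A → X` by a span of cofibrations between cofibrant objects which is weakly equivalent
to it, the comparison morphism from the (strict) pushout of the replacement to `Y` is a
weak equivalence. -/
def IsHomotopyPushout {M : Type u} [Category.{v} M] (S : ModelStructure M)
    {A B X Y : M} (f : A ⟶ B) (g : A ⟶ X) (h : B ⟶ Y) (k : X ⟶ Y) : Prop :=
  ∃ (A' B' X' P : M) (wA : A' ⟶ A) (i : A' ⟶ B') (wB : B' ⟶ B)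
    (j : A' ⟶ X') (wX : X' ⟶ X) (pB : B' ⟶ P) (pX : X' ⟶ P) (m : P ⟶ Y),
      Cofibrant S A' ∧ S.W wA ∧ S.Cof i ∧ S.W wB ∧ S.Cof j ∧ S.W wX ∧
      i ≫ wB = wA ≫ f ∧ j ≫ wX = wA ≫ g ∧
      IsPushout i j pB pX ∧ pB ≫ m = wB ≫ h ∧ pX ≫ m = wX ≫ k ∧ S.W m

/-- A morphism `i : A ⟶ B` is a formal cofibration if every pushout square of `i` along a
morphism `f : A ⟶ X` with `X` cofibrant is a homotopy pushout. -/
def IsFormalCofibration {M : Type u} [Category.{v} M] (S : ModelStructure M)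
    {A B : M} (i : A ⟶ B) : Prop :=
  ∀ {X Y : M} (f : A ⟶ X) (g : B ⟶ Y) (k : X ⟶ Y),
    Cofibrant S X → IsPushout i f g k → IsHomotopyPushout S i f g k

/-- The set of arrows satisfying `P` whose domain and codomain are `κ`-presentable. -/
def PresentableArrowsIn {M : Type u} [Category.{v} M] (κ : Cardinal.{v})
    (P : Set (Arrow M)) : Set (Arrow M) :=
  {a | a ∈ P ∧ IsPresentable κ a.left ∧ IsPresentable κ a.right}

end PaperAcc

namespace PaperAcc

/-- A presentation of `E` as a Grothendieck topos: a small site whose category of sheaves of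
sets is equivalent to `E`. -/
structure GrothendieckToposPresentation (E : Type u) [Category.{v} E] where
  C : Type v
  [instC : SmallCategory C]
  J : GrothendieckTopology C
  equiv : Sheaf J (Type v) ≌ E

/-- A category is a Grothendieck topos if it is equivalent to the category of sheaves of sets
on a small site. -/
def IsGrothendieckTopos (E : Type u) [Category.{v} E] : Prop :=
  Nonempty (GrothendieckToposPresentation E)

/-- A cylinder functor for a model structure: a functor `Cyl` together with natural
transformations exhibiting, for each object `X`, a factorization `X ⊔ X ⟶ Cyl X ⟶ X` of the
codiagonal into a cofibration followed by a weak equivalence. -/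
structure CylinderFunctor {M : Type u} [Category.{v} M] (S : ModelStructure M) where
  Cyl : M ⥤ M
  i₀ : 𝟭 M ⟶ Cyl
  i₁ : 𝟭 M ⟶ Cyl
  p : Cyl ⟶ 𝟭 M
  hi₀ : ∀ X : M, i₀.app X ≫ p.app X = 𝟙 X
  hi₁ : ∀ X : M, i₁.app X ≫ p.app X = 𝟙 X
  hp : ∀ X : M, S.W (p.app X)
  hcof : ∀ (X : M) (c : BinaryCofan X X) (hc : IsColimit c),
    S.Cof (hc.desc (BinaryCofan.mk (i₀.app X) (i₁.app X)))

open Opposite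

section Topos

variable {M : Type u} [Category.{v} M]

/-- Filtered colimits are exact in a Grothendieck topos. -/
lemma IsGrothendieckTopos.hasExactColimitsOfShape (h : IsGrothendieckTopos M) [HasColimits M]
    [HasFiniteLimits M] (J : Type v) [SmallCategory J] [IsFiltered J] :
    HasExactColimitsOfShape J M := by
  obtain ⟨⟨C, T, e⟩⟩ := h
  have : HasExactColimitsOfShape J (Type v) := AB5OfSize.ofShape J
  exact HasExactColimitsOfShape.of_codomain_equivalence J e

lemma IsGrothendieckTopos.hasLimits (h : IsGrothendieckTopos M) : HasLimits M := by
  obtain ⟨⟨C, T, e⟩⟩ := h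
  exact Adjunction.has_limits_of_equivalence e.inverse

lemma IsGrothendieckTopos.mono_of_isInitial (h : IsGrothendieckTopos M) {O X : M}
    (hO : IsInitial O) (f : O ⟶ X) : Mono f := by
  obtain ⟨⟨C, T, e⟩⟩ := h
  have hO' : IsInitial (e.inverse.obj O) :=
    IsInitial.ofUniqueHom (fun Y => (e.symm.toAdjunction.homEquiv O Y).symm (hO.to _))
      (fun Y m => (e.symm.toAdjunction.homEquiv O Y).injective (hO.hom_ext _ _))
  have : Mono (hO'.to (e.inverse.obj X)) :=
    @initial_mono _ _ _ _ _ hO' (instMonoidalClosedSheafOfHasSheafifyOfFunctorOpposite T (Type v))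
  rw [hO'.hom_ext (hO'.to _) (e.inverse.map f)] at this
  exact e.inverse.mono_of_mono_map this

/-- In a Grothendieck topos, a filtered colimit of subobjects is a subobject. -/
lemma IsGrothendieckTopos.mono_desc (h : IsGrothendieckTopos M) [HasColimits M]
    {J : Type v} [SmallCategory J] [IsFiltered J] {F : J ⥤ M} {c : Cocone F} (hc : IsColimit c)
    (s : Cocone F) [∀ j, Mono (s.ι.app j)] : Mono (hc.desc s) := by
  have := h.hasLimits
  have := h.hasExactColimitsOfShape J
  have := NatTrans.mono_of_mono_app s.ι
  have : IsConnected J := IsFiltered.isConnected J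
  exact colim.map_mono' s.ι hc (isColimitConstCocone J s.pt) (hc.desc s)
    (fun j => (hc.fac s j).trans (Category.comp_id _).symm)

end Topos

section Bridges

variable {κ : Cardinal.{v}} [Fact κ.IsRegular]

lemma isCardinalFiltered_iff {J : Type v} [SmallCategory J] :
    IsCardinalFiltered J κ ↔ CategoryTheory.IsCardinalFiltered J κ := by
  refine ⟨fun h => ⟨fun {A} _ F hA => h A ?_ F⟩, fun h A _ hA F => ⟨?_⟩⟩
  · rwa [hasCardinalLT_iff_cardinal_mk_lt] at hA
  · exact CategoryTheory.IsCardinalFiltered.cocone F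
      ((hasCardinalLT_iff_cardinal_mk_lt _ _).2 hA)

variable {M : Type u} [Category.{v} M]

lemma isPresentable_iff {X : M} : IsPresentable κ X ↔ IsCardinalPresentable X κ := by
  refine ⟨fun h => ⟨fun J _ _ => (h J (isCardinalFiltered_iff.2 inferInstance)).some⟩,
    fun h J _ hJ => ?_⟩
  have := isCardinalFiltered_iff.1 hJ
  exact ⟨preservesColimitsOfShape_of_isCardinalPresentable X κ J⟩

lemma IsLocallyPresentable.isCardinalLocallyPresentable (h : IsLocallyPresentable M κ) :
    IsCardinalLocallyPresentable M κ := by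
  obtain ⟨h₁, ι, G, hG, h⟩ := h
  have : HasCardinalFilteredGenerator M κ :=
    ⟨.ofObj G, inferInstance,
      { le_isCardinalPresentable := by
          rintro _ ⟨i⟩
          exact isPresentable_iff.1 (hG i)
        exists_colimitsOfShape X := by
          obtain ⟨p⟩ := h X
          let := p.instJ
          refine ⟨p.J, p.instJ, isCardinalFiltered_iff.1 p.filtered, ⟨?_⟩⟩
          exact { diag := p.F
                  ι := p.c.ι ≫ (Functor.const _).map p.iso.hom
                  isColimit := p.isColimit.ofIsoColimit (Cocone.ext p.iso)
                  prop_diag_obj j := by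
                    obtain ⟨i, hi⟩ := p.mem j
                    rw [← hi]
                    exact ⟨i⟩ } }⟩
  exact { }

end Bridges

section Generators

variable {M : Type u} [Category.{v} M] (S : ModelStructure M)

lemma llp_rlpOf_eq {ι : Type v} {A B : ι → M} (f : ∀ i, A i ⟶ B i) :
    Llp (RlpOf f) = (MorphismProperty.ofHoms f).rlp.llp := by
  ext X Y g
  refine ⟨fun h Z W p hp => h p fun i => hp _ ⟨i⟩, fun h Z W p hp => h p ?_⟩
  rintro _ _ _ ⟨i⟩
  exact hp i

namespace ModelStructure

variable {S} {I : MorphismProperty M}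

lemma fib_of_rlp (hI : S.Cof ⊓ S.W = I.rlp.llp) {X Y : M} {p : X ⟶ Y} (hp : I.rlp p) :
    S.Fib p := by
  obtain ⟨Z, i, q, hi, hi', hq, fac⟩ := S.fact_trivCof_fib p
  have hi'' : I.rlp.llp i := by rw [← hI]; exact ⟨hi, hi'⟩
  have := hi'' p hp
  have sq : CommSq (𝟙 X) i p q := ⟨by simp [fac]⟩
  exact S.Fib_retract p q i sq.lift (𝟙 Y) (𝟙 Y) (by simp) (by simp) (by simp [fac]) (by simp) hq

lemma trivFib_of_rlp (hI : S.Cof = I.rlp.llp) {X Y : M} {p : X ⟶ Y} (hp : I.rlp p) :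
    S.Fib p ∧ S.W p := by
  obtain ⟨Z, i, q, hi, hq, hq', fac⟩ := S.fact_cof_trivFib p
  have hi'' : I.rlp.llp i := by rw [← hI]; exact hi
  have := hi'' p hp
  have sq : CommSq (𝟙 X) i p q := ⟨by simp [fac]⟩
  exact ⟨S.Fib_retract p q i sq.lift (𝟙 Y) (𝟙 Y) (by simp) (by simp) (by simp [fac]) (by simp) hq,
    S.W_retract p q i sq.lift (𝟙 Y) (𝟙 Y) (by simp) (by simp) (by simp [fac]) (by simp) hq'⟩

lemma rlp_of_trivFib (hI : S.Cof = I.rlp.llp) {X Y : M} {p : X ⟶ Y} (hp : S.Fib p)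
    (hp' : S.W p) : I.rlp p := by
  intro A B i hi
  refine S.lift_cof_trivFib i p ?_ hp hp'
  rw [hI]
  exact I.le_llp_rlp _ hi

end ModelStructure

end Generators

section SmallObject

variable {κ : Cardinal.{v}} [Fact κ.IsRegular]

lemma nonempty_ord_toType (κ : Cardinal.{v}) [Fact κ.IsRegular] : Nonempty κ.ord.ToType := by
  simpa using (Fact.out : κ.IsRegular).ne_zero

lemma isCardinalForSmallObjectArgument_ofHoms {N : Type u} [Category.{v} N] [HasColimits N]
    {ι : Type v} {A B : ι → N} (f : ∀ i, A i ⟶ B i) [∀ i, IsCardinalPresentable (A i) κ]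
    [OrderBot κ.ord.ToType] :
    (MorphismProperty.ofHoms f).IsCardinalForSmallObjectArgument κ where
  preservesColimit := by
    rintro _ _ _ _ _ ⟨i⟩ g hg
    have := preservesColimitsOfShape_of_isCardinalPresentable (A i) κ κ.ord.ToType
    infer_instance

variable {M : Type u} [Category.{v} M]

lemma rlp_pi_lift [HasProducts.{v} M] {I : MorphismProperty M} {X Y : M} {q : X ⟶ Y}
    (hq : I.rlp q) (T : Type v) :
    I.rlp (Pi.lift fun t : T => Pi.π (fun _ => X) t ≫ q) := by
  intro A B i hi
  have := hq i hi
  refine ⟨fun {a b} sq => ⟨⟨?_⟩⟩⟩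
  have sq' (t : T) : CommSq (a ≫ Pi.π _ t) i q (b ≫ Pi.π _ t) :=
    ⟨by simpa using sq.w =≫ Pi.π _ t⟩
  exact
    { l := Pi.lift fun t => (sq' t).lift
      fac_left := by ext t; simp
      fac_right := by ext t; simp }

/-- Morphisms with the right lifting property against a set of morphisms between `κ`-presentable
objects are stable under `κ`-filtered colimits. -/
lemma rlp_of_isColimit {ι : Type v} {A B : ι → M} (f : ∀ i, A i ⟶ B i)
    [∀ i, IsCardinalPresentable (A i) κ] [∀ i, IsCardinalPresentable (B i) κ]
    {K : Type v} [SmallCategory K] [CategoryTheory.IsCardinalFiltered K κ] {F G : K ⥤ M}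
    (φ : F ⟶ G) (hφ : ∀ k, (MorphismProperty.ofHoms f).rlp (φ.app k))
    {c : Cocone F} (hc : IsColimit c) {d : Cocone G} (hd : IsColimit d) (ψ : c.pt ⟶ d.pt)
    (hψ : ∀ k, c.ι.app k ≫ ψ = φ.app k ≫ d.ι.app k) :
    (MorphismProperty.ofHoms f).rlp ψ := by
  rintro _ _ _ ⟨i⟩
  have := isFiltered_of_isCardinalFiltered K κ
  have := preservesColimitsOfShape_of_isCardinalPresentable (A i) κ K
  have := preservesColimitsOfShape_of_isCardinalPresentable (B i) κ K
  refine ⟨fun {a b} sq => ?_⟩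
  obtain ⟨k₁, a', ha⟩ := Limits.exists_hom_of_preservesColimit_coyoneda hc a
  obtain ⟨k₂, b', hb⟩ := Limits.exists_hom_of_preservesColimit_coyoneda hd b
  obtain ⟨k, u, w, h⟩ := Limits.exists_eq_of_preservesColimit_coyoneda hd
    (a' ≫ φ.app k₁) (f i ≫ b') (by simp [← hψ, reassoc_of% ha, hb, sq.w])
  have := hφ k (f i) ⟨i⟩
  have sq' : CommSq (a' ≫ F.map u) (f i) (φ.app k) (b' ≫ G.map w) := ⟨by simpa using h⟩
  exact ⟨⟨
    { l := sq'.lift ≫ c.ι.app k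
      fac_left := by simp [ha]
      fac_right := by
        rw [Category.assoc, hψ, sq'.fac_right_assoc]
        simp [hb] }⟩⟩

variable [HasColimits M] [HasLimits M]

/-- Given a set of morphisms with `κ`-presentable sources, any morphism of diagrams factors as a
pointwise and colimit-wise relative cell complex (up to retracts) followed by a pointwise
fibration. -/
lemma exists_diagram_factorization {ι : Type v} {A B : ι → M} (f : ∀ i, A i ⟶ B i)
    [∀ i, IsCardinalPresentable (A i) κ] {K : Type v} [SmallCategory K] {F G : K ⥤ M}
    (φ : F ⟶ G) :
    ∃ (H : K ⥤ M) (α : F ⟶ H) (β : H ⟶ G), α ≫ β = φ ∧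
      (∀ k, (MorphismProperty.ofHoms f).rlp (β.app k)) ∧
      (∀ k, (MorphismProperty.ofHoms f).rlp.llp (α.app k)) ∧
      (MorphismProperty.ofHoms f).rlp.llp (colim.map α) := by
  have : Nonempty κ.ord.ToType := nonempty_ord_toType κ
  have := WellFoundedLT.toOrderBot κ.ord.ToType
  let E : MorphismProperty (K ⥤ M) :=
    MorphismProperty.ofHoms (fun x : ι × K => (evaluationLeftAdjoint M x.2).map (f x.1))
  have (x : ι × K) : IsCardinalPresentable ((evaluationLeftAdjoint M x.2).obj (A x.1)) κ := by
    have : ((evaluation K M).obj x.2).IsCardinalAccessible κ :=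
      ⟨fun J _ _ => inferInstance⟩
    exact (evaluationAdjunctionRight M x.2).isCardinalPresentable_leftAdjoint_obj κ (A x.1)
  have : E.IsCardinalForSmallObjectArgument κ := isCardinalForSmallObjectArgument_ofHoms _
  have hE {H H' : K ⥤ M} (β : H ⟶ H') :
      E.rlp β ↔ ∀ k, (MorphismProperty.ofHoms f).rlp (β.app k) := by
    constructor
    · rintro h k _ _ _ ⟨i⟩
      exact ((evaluationAdjunctionRight M k).hasLiftingProperty_iff (f i) β).1 (h _ ⟨(i, k)⟩)
    · rintro h _ _ _ ⟨⟨i, k⟩⟩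
      exact ((evaluationAdjunctionRight M k).hasLiftingProperty_iff (f i) β).2 (h k _ ⟨i⟩)
  refine ⟨SmallObject.obj E κ φ, SmallObject.ιObj E κ φ, SmallObject.πObj E κ φ, by simp,
    (hE _).1 (SmallObject.rlp_πObj E κ φ), fun k X Y q hq => ?_, fun X Y q hq => ?_⟩
  · refine ((evaluationAdjunctionLeft M k).hasLiftingProperty_iff
      (SmallObject.ιObj E κ φ) q).2 (SmallObject.llp_rlp_ιObj E κ φ _ ((hE _).2 fun k' => ?_))
    exact rlp_pi_lift hq (k' ⟶ k)
  · refine (colimConstAdj.hasLiftingProperty_iff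
      (SmallObject.ιObj E κ φ) q).2 (SmallObject.llp_rlp_ιObj E κ φ _ ((hE _).2 fun k' => ?_))
    exact hq

end SmallObject

section Closure

variable {κ : Cardinal.{v}} [Fact κ.IsRegular] {M : Type u} [Category.{v} M]

variable [HasColimits M] [HasLimits M]

lemma exists_colimit_factorization {ι : Type v} {A B : ι → M} (f : ∀ i, A i ⟶ B i)
    [∀ i, IsCardinalPresentable (A i) κ] {K : Type v} [SmallCategory K] {F G : K ⥤ M}
    (φ : F ⟶ G) {c : Cocone F} (hc : IsColimit c) {d : Cocone G} (ψ : c.pt ⟶ d.pt)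
    (hψ : ∀ k, c.ι.app k ≫ ψ = φ.app k ≫ d.ι.app k) :
    ∃ (H : K ⥤ M) (α : F ⟶ H) (β : H ⟶ G) (e : Cocone H) (_ : IsColimit e)
      (a : c.pt ⟶ e.pt) (b : e.pt ⟶ d.pt), α ≫ β = φ ∧ a ≫ b = ψ ∧
      (∀ k, c.ι.app k ≫ a = α.app k ≫ e.ι.app k) ∧
      (∀ k, e.ι.app k ≫ b = β.app k ≫ d.ι.app k) ∧
      (∀ k, (MorphismProperty.ofHoms f).rlp (β.app k)) ∧
      (∀ k, (MorphismProperty.ofHoms f).rlp.llp (α.app k)) ∧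
      (MorphismProperty.ofHoms f).rlp.llp a := by
  obtain ⟨H, α, β, fac, hβ, hα, hα_llp⟩ := exists_diagram_factorization (κ := κ) f φ
  refine ⟨H, α, β, colimit.cocone H, colimit.isColimit H,
    (hc.coconePointUniqueUpToIso (colimit.isColimit F)).hom ≫ colim.map α,
    colimit.desc H ⟨d.pt, β ≫ d.ι⟩, fac, hc.hom_ext fun k => ?_, fun k => ?_, fun k => ?_,
    hβ, hα, ?_⟩
  · rw [hψ, ← fac]
    simp
  · simp
  · simp
  · exact (MorphismProperty.cancel_left_of_respectsIso _ _ _).2 hα_llp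

/-- In a model category whose (trivial) cofibrations are generated by morphisms between
`κ`-presentable objects, weak equivalences are closed under `κ`-filtered colimits. -/
lemma IsCombinatorial.closedUnderFilteredColimits {S : ModelStructure M}
    (hS : IsCombinatorial S κ) :
    ClosedUnderFilteredColimits κ {a : Arrow M | S.W a.hom} := by
  obtain ⟨ι, A, B, f, hA, hB, hI⟩ := hS.cofGenerated
  obtain ⟨ι', A', B', g, hA', hB', hJ⟩ := hS.trivCofGenerated
  rw [llp_rlpOf_eq] at hI hJ
  simp only [isPresentable_iff] at hA hB hA' hB'
  intro K _ hK F c hc hF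
  have := isCardinalFiltered_iff.1 hK
  let φ : F ⋙ Arrow.leftFunc ⟶ F ⋙ Arrow.rightFunc := Functor.whiskerLeft F Arrow.leftToRight
  have hcl := isColimitOfPreserves Arrow.leftFunc hc
  have hcr := isColimitOfPreserves Arrow.rightFunc hc
  obtain ⟨H, α, β, e, he, a, b, fac, fac', ha, hb, hβ, hα, ha'⟩ :=
    exists_colimit_factorization (κ := κ) g φ hcl (d := Arrow.rightFunc.mapCocone c) c.pt.hom
      (fun k => (c.ι.app k).w)
  rw [← hJ] at hα ha'
  have hb' : S.W b := by
    refine (S.trivFib_of_rlp hI (rlp_of_isColimit (κ := κ) f β (fun k => ?_) he hcr b hb)).2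
    refine S.rlp_of_trivFib hI (S.fib_of_rlp hJ (hβ k)) ?_
    refine S.W_of_comp_left (α.app k) (β.app k) (hα k).2 ?_
    rw [← NatTrans.comp_app, fac]
    exact hF k
  have := S.W_comp a b ha'.2 hb'
  rwa [fac'] at this

end Closure

lemma isDetecting_of_isStrongGenerator {M : Type u} [Category.{v} M] {P : ObjectProperty M}
    (hP : P.IsStrongGenerator) : P.IsDetecting := by
  intro X Y f hf
  have : Mono f := ⟨fun a b hab => hP.isSeparating _ _ fun G hG h =>
    (hf G hG (h ≫ a ≫ f)).unique (by simp) (by simp [hab])⟩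
  exact (ObjectProperty.isStrongGenerator_iff.1 hP).2 f fun G hG h => (hf G hG h).exists

lemma wellPowered_of_isCardinalLocallyPresentable (M : Type u) [Category.{v} M] (κ : Cardinal.{v})
    [Fact κ.IsRegular] [IsCardinalLocallyPresentable M κ] [HasPullbacks M] :
    WellPowered.{v} M := by
  have := (inferInstance : IsCardinalLocallyPresentable M κ).toHasColimitsOfSize
  obtain ⟨P, _, hP, _⟩ :=
    (IsCardinalLocallyPresentable.iff_exists_isStrongGenerator M κ).1 inferInstance
  exact wellPowered_of_isDetecting (isDetecting_of_isStrongGenerator hP)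

lemma sInf_factors {M : Type u} [Category.{v} M] [WellPowered.{v} M] [HasLimits M] {D Z : M}
    (s : Set (Subobject Z)) (h : D ⟶ Z) (hs : ∀ P ∈ s, P.Factors h) :
    (Subobject.sInf.{v} s).Factors h := by
  refine (Subobject.mk_factors_iff (Subobject.widePullbackι.{v} s) h).2
    ⟨limit.lift (Subobject.wideCospan.{v} s) (WidePullbackShape.mkCone h
      (fun j => Subobject.factorThru _ h (hs ((equivShrink.{v} (Subobject Z)).symm j.1) ?_)) ?_),
    ?_⟩
  · obtain ⟨_, g, hg, rfl⟩ := j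
    simpa using hg
  · intro j
    exact Subobject.factorThru_arrow _ _ _
  · exact limit.lift_π _ _

/-- The smallest subobject of `Z` through which `f` and all the morphisms `e γ`, `γ ∈ S`, factor. -/
noncomputable def generatedSubobject {M : Type u} [Category.{v} M] [WellPowered.{v} M] [HasLimits M]
    {X Z : M} (f : X ⟶ Z) {ι : Type w} {B : ι → M} (e : ∀ γ, B γ ⟶ Z) (S : Set ι) : Subobject Z :=
  Subobject.sInf.{v} {P | P.Factors f ∧ ∀ γ ∈ S, P.Factors (e γ)}

section

variable {M : Type u} [Category.{v} M] [WellPowered.{v} M] [HasLimits M]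
    {X Z : M} (f : X ⟶ Z) {ι : Type w} {B : ι → M} (e : ∀ γ, B γ ⟶ Z)

lemma generatedSubobject_factors (S : Set ι) : (generatedSubobject f e S).Factors f :=
  sInf_factors _ _ fun _ h => h.1

lemma generatedSubobject_factors_of_mem {S : Set ι} {γ : ι} (hγ : γ ∈ S) :
    (generatedSubobject f e S).Factors (e γ) :=
  sInf_factors _ _ fun _ h => h.2 γ hγ

variable {f e}

lemma generatedSubobject_le {S : Set ι} {P : Subobject Z} (hf : P.Factors f)
    (he : ∀ γ ∈ S, P.Factors (e γ)) : generatedSubobject f e S ≤ P :=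
  Subobject.sInf_le _ _ ⟨hf, he⟩

variable (f e)

lemma generatedSubobject_mono : Monotone (generatedSubobject f e) := fun _ _ h =>
  generatedSubobject_le (generatedSubobject_factors f e _)
    fun _ hγ => generatedSubobject_factors_of_mem f e (h hγ)

variable [HasColimits M]

/-- If `S` is the union of a filtered family of sets `S k`, the subobject generated by `S` is the
colimit of the subobjects generated by the `S k`. -/
lemma IsGrothendieckTopos.nonempty_isColimit_of_generatedSubobject (htopos : IsGrothendieckTopos M)
    {K : Type v} [SmallCategory K] [IsFiltered K] {F : K ⥤ M} (c : Cocone F) (φ : c.pt ⟶ Z)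
    [Mono φ] [∀ k, Mono (c.ι.app k ≫ φ)] (s : K → Set ι)
    (hφ : Subobject.mk φ = generatedSubobject f e (⋃ k, s k))
    (hc : ∀ k, Subobject.mk (c.ι.app k ≫ φ) = generatedSubobject f e (s k)) :
    Nonempty (IsColimit c) := by
  let d : Cocone F := c.extend φ
  have : ∀ k, Mono (d.ι.app k) := fun k => by dsimp [d]; infer_instance
  have := htopos.mono_desc (colimit.isColimit F) d
  let m := (colimit.isColimit F).desc d
  have hm : ∀ k, colimit.ι F k ≫ m = c.ι.app k ≫ φ := (colimit.isColimit F).fac d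
  have hle : generatedSubobject f e (⋃ k, s k) ≤ Subobject.mk m := by
    have h : ∀ k, generatedSubobject f e (s k) ≤ Subobject.mk m := fun k => by
      rw [← hc]
      exact Subobject.mk_le_mk_of_comm _ (hm k)
    refine generatedSubobject_le ?_ fun γ hγ => ?_
    · obtain ⟨k⟩ := IsFiltered.nonempty (C := K)
      exact Subobject.factors_of_le _ (h k) (generatedSubobject_factors f e _)
    · rw [Set.mem_iUnion] at hγ
      obtain ⟨k, hk⟩ := hγ
      exact Subobject.factors_of_le _ (h k) (generatedSubobject_factors_of_mem f e hk)
  rw [← hφ] at hle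
  have hcol : (colimit.isColimit F).desc c ≫ φ = m := colimit.hom_ext fun k => by
    rw [colimit.isColimit_desc, colimit.ι_desc_assoc, hm]
  have : IsIso ((colimit.isColimit F).desc c) := by
    refine ⟨Subobject.ofMkLEMk _ _ hle, ?_, ?_⟩
    · rw [← cancel_mono m, Category.assoc, Subobject.ofMkLEMk_comp, Category.id_comp, hcol]
    · rw [← cancel_mono φ, Category.assoc, hcol, Subobject.ofMkLEMk_comp, Category.id_comp]
  exact ⟨IsColimit.ofPointIso (colimit.isColimit F) (t := c)⟩

end

section

open HomotopicalAlgebra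

variable {M : Type u} [Category.{v} M]

lemma factors_of_comp_arrow_eq {D Z : M} {P : Subobject Z} {h : D ⟶ Z} (l : D ⟶ (P : M))
    (hl : l ≫ P.arrow = h) : P.Factors h :=
  hl ▸ Subobject.factors_comp_arrow l

lemma factors_of_isColimit {K : Type w} [Category K] {F : K ⥤ M} {c : Cocone F} (hc : IsColimit c)
    {Z : M} {P : Subobject Z} (h : c.pt ⟶ Z) (hP : ∀ k, P.Factors (c.ι.app k ≫ h)) :
    P.Factors h := by
  let d : Cocone F := ⟨(P : M), { app k := P.factorThru _ (hP k)
                                  naturality i j u := by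
                                    rw [← cancel_mono P.arrow]
                                    simp }⟩
  refine factors_of_comp_arrow_eq (hc.desc d) (hc.hom_ext fun k => ?_)
  rw [hc.fac_assoc]
  exact Subobject.factorThru_arrow _ _ (hP k)

lemma factors_of_isPushout {A B C D Z : M} {a : A ⟶ B} {b : A ⟶ C} {i : B ⟶ D} {j : C ⟶ D}
    (sq : IsPushout a b i j) {P : Subobject Z} (h : D ⟶ Z) (hi : P.Factors (i ≫ h))
    (hj : P.Factors (j ≫ h)) : P.Factors h := by
  refine factors_of_comp_arrow_eq (sq.desc (P.factorThru _ hi) (P.factorThru _ hj) ?_)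
    (sq.hom_ext ?_ ?_)
  · rw [← cancel_mono P.arrow]
    simp [sq.w_assoc]
  · exact (sq.inl_desc_assoc _ _ _ _).trans (Subobject.factorThru_arrow _ _ _)
  · exact (sq.inr_desc_assoc _ _ _ _).trans (Subobject.factorThru_arrow _ _ _)

variable {α : Type w} {A B : α → M} {g : ∀ i, A i ⟶ B i}

lemma factors_of_attachCells {X₁ X₂ Z : M} {f : X₁ ⟶ X₂} (a : AttachCells.{v} g f)
    {P : Subobject Z} (h : X₂ ⟶ Z) (hf : P.Factors (f ≫ h)) (hc : ∀ k, P.Factors (a.cell k ≫ h)) :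
    P.Factors h :=
  factors_of_isPushout a.isPushout h hf <| factors_of_isColimit a.isColimit₂ _ fun ⟨k⟩ => by
    have := hc k
    rwa [AttachCells.cell, Category.assoc] at this

/-- If `Q` is obtained from `X₁` by attaching only a part of the cells needed to get `X₂`, then
the comparison morphism `Q ⟶ X₂` is a relative cofibration. -/
lemma llp_of_attachCells {X₁ X₂ Q : M} {f : X₁ ⟶ X₂} (a : AttachCells.{v} g f) (K : Set a.ι)
    (i : X₁ ⟶ Q) (b : ∀ k : K, B (a.π k) ⟶ Q) (r : Q ⟶ X₂) (hi : i ≫ r = f)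
    (hb : ∀ k, b k ≫ r = a.cell k) (hbi : ∀ k : K, g _ ≫ b k = a.cofan₁.inj k ≫ a.g₁ ≫ i)
    (hext : ∀ {E : M} (s t : Q ⟶ E), i ≫ s = i ≫ t → (∀ k, b k ≫ s = b k ≫ t) → s = t) :
    (MorphismProperty.ofHoms g).rlp.llp r := by
  intro E Y p hp
  refine ⟨fun {s t} sq => ?_⟩
  have hcell : ∀ k, a.cofan₁.inj k ≫ a.g₁ ≫ f = g _ ≫ a.cell k := fun k => by
    rw [a.isPushout.w, AttachCells.cell, ← a.hm_assoc]
  have : ∀ k : a.ι, ∃ l : B (a.π k) ⟶ E, g _ ≫ l = a.cofan₁.inj k ≫ a.g₁ ≫ i ≫ s ∧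
      l ≫ p = a.cell k ≫ t ∧ ∀ hk : k ∈ K, l = b ⟨k, hk⟩ ≫ s := by
    intro k
    by_cases hk : k ∈ K
    · refine ⟨b ⟨k, hk⟩ ≫ s, ?_, ?_, fun _ => rfl⟩
      · rw [reassoc_of% (hbi ⟨k, hk⟩)]
      · rw [Category.assoc, sq.w, reassoc_of% (hb ⟨k, hk⟩)]
    · have sq' : CommSq (a.cofan₁.inj k ≫ a.g₁ ≫ i ≫ s) (g (a.π k)) p (a.cell k ≫ t) :=
        ⟨by simp only [Category.assoc, sq.w]; rw [reassoc_of% hi, reassoc_of% (hcell k)]⟩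
      have := hp _ (MorphismProperty.ofHoms.mk (f := g) (a.π k))
      exact ⟨sq'.lift, sq'.fac_left, sq'.fac_right, fun h => (hk h).elim⟩
  choose l hl hl' hlK using this
  let L : X₂ ⟶ E := a.isPushout.desc (i ≫ s) (Cofan.IsColimit.desc a.isColimit₂ l)
    (Cofan.IsColimit.hom_ext a.isColimit₁ _ _ fun k => by
      rw [a.hm_assoc, Cofan.IsColimit.fac, hl])
  have hL₁ : f ≫ L = i ≫ s := a.isPushout.inl_desc _ _ _
  have hL₂ : ∀ k, a.cell k ≫ L = l k := fun k => by
    simp only [L, AttachCells.cell, Category.assoc, IsPushout.inr_desc, Cofan.IsColimit.fac]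
  refine ⟨⟨L, hext _ _ ?_ fun k => ?_, a.hom_ext ?_ fun k => ?_⟩⟩
  · rw [reassoc_of% hi, hL₁]
  · rw [reassoc_of% (hb k), hL₂, hlK k k.2]
  · rw [reassoc_of% hL₁, sq.w, reassoc_of% hi]
  · rw [reassoc_of% (hL₂ k), hl']

end

section

open HomotopicalAlgebra

lemma mk_factors_of_comp_eq {M : Type u} [Category.{v} M] {D N Z : M} {m : N ⟶ Z} [Mono m]
    {h : D ⟶ Z} (l : D ⟶ N) (hl : l ≫ m = h) : (Subobject.mk m).Factors h :=
  (Subobject.mk_factors_iff _ _).2 ⟨l, hl⟩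

variable {M : Type u} [Category.{v} M]
  {J : Type v} [LinearOrder J] [OrderBot J] [SuccOrder J] [WellFoundedLT J]
  {α : Type w} {A B : α → M} {g : ∀ i, A i ⟶ B i} {X Z : M} {f : X ⟶ Z}
  (c : RelativeCellComplex.{v} (fun _ : J => g) f)

/-- The cells of `S` attached before the step `j`. -/
def cellsBelow (S : Set c.Cells) (j : J) : Set c.Cells := {γ | γ ∈ S ∧ γ.j < j}

variable {c}

lemma cellsBelow_mono_right (S : Set c.Cells) : Monotone (cellsBelow c S) :=
  fun _ _ h _ hγ => ⟨hγ.1, hγ.2.trans_le h⟩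

lemma cellsBelow_mono_left {S T : Set c.Cells} (h : S ⊆ T) (j : J) :
    cellsBelow c S j ⊆ cellsBelow c T j :=
  fun _ hγ => ⟨h hγ.1, hγ.2⟩

lemma map_comp_incl_app {i j : J} (h : i ≤ j) :
    c.F.map (homOfLE h) ≫ c.incl.app j = c.incl.app i := by
  simp

lemma incl_app_factors {P : Subobject Z} (hf : P.Factors f) (j : J)
    (hP : ∀ γ : c.Cells, γ.j < j → P.Factors γ.ι) : P.Factors (c.incl.app j) := by
  induction j using SuccOrder.limitRecOn with
  | isMin j hj =>
    obtain rfl := hj.eq_bot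
    rw [show c.incl.app ⊥ = c.isoBot.hom ≫ f from (Iso.inv_comp_eq _).1 c.fac]
    exact Subobject.factors_of_factors_right _ hf
  | succ j hj ih =>
    refine factors_of_attachCells (c.attachCells j hj) _ ?_ fun k => ?_
    · rw [map_comp_incl_app]
      exact ih fun γ hγ => hP γ (hγ.trans_le (Order.le_succ j))
    · exact hP ⟨j, hj, k⟩ (Order.lt_succ_of_not_isMax hj)
  | isSuccLimit j hj ih =>
    refine factors_of_isColimit (c.F.isColimitOfIsWellOrderContinuous j hj) _ fun ⟨k, hk⟩ => ?_
    exact (map_comp_incl_app (c := c) hk.le).symm ▸ ih k hk fun γ hγ => hP γ (hγ.trans hk)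

lemma id_factors {P : Subobject Z} (hf : P.Factors f)
    (hP : ∀ γ : c.Cells, P.Factors γ.ι) : P.Factors (𝟙 Z) :=
  factors_of_isColimit c.isColimit _ fun j => by
    dsimp
    rw [Category.comp_id]
    exact incl_app_factors hf j fun γ _ => hP γ

lemma mk_incl_app_factors (j : J) [Mono (c.incl.app j)] :
    (Subobject.mk (c.incl.app j)).Factors f :=
  mk_factors_of_comp_eq (c.isoBot.inv ≫ c.F.map (homOfLE bot_le)) (by
    rw [Category.assoc, map_comp_incl_app, c.fac])

lemma mk_incl_app_factors_cell (j : J) [Mono (c.incl.app j)] (γ : c.Cells) (h : γ.j < j) :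
    (Subobject.mk (c.incl.app j)).Factors γ.ι :=
  mk_factors_of_comp_eq
    ((c.attachCells γ.j γ.hj).cell γ.k ≫ c.F.map (homOfLE (Order.succ_le_of_lt h)))
    ((Category.assoc _ _ _).trans (by rw [map_comp_incl_app]; rfl))

lemma llp_incl_app (j : J) : (MorphismProperty.ofHoms g).rlp.llp (c.incl.app j) := by
  have h := (c.transfiniteCompositionOfShape g).ici j
  exact MorphismProperty.transfiniteCompositionsOfShape_le _ _ _
    ⟨h.ofLE (W' := (MorphismProperty.ofHoms g).rlp.llp) (by
      simpa using fun i => MorphismProperty.le_llp_rlp _ _ (.mk i))⟩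

variable [HasLimits M] [WellPowered.{v} M] (c)

/-- The subobject of a relative cell complex generated by a set of cells. -/
noncomputable abbrev cellSpan (S : Set c.Cells) : Subobject Z :=
  generatedSubobject (B := fun γ : c.Cells => B γ.i) f (fun γ => γ.ι) S

/-- A set of cells is closed if each of its cells is attached to the subobject generated by the
cells of this set attached at earlier steps. -/
def IsClosedSetOfCells (S : Set c.Cells) : Prop :=
  ∀ γ ∈ S, (cellSpan c (cellsBelow c S γ.j)).Factors (g γ.i ≫ γ.ι)

end

section

open HomotopicalAlgebra

variable {M : Type u} [Category.{v} M] [HasColimits M]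
  {J : Type v} [LinearOrder J] [OrderBot J] [SuccOrder J] [WellFoundedLT J]
  {α : Type w} {A B : α → M} {g : ∀ i, A i ⟶ B i} {X Z : M} {f : X ⟶ Z}
  {c : RelativeCellComplex.{v} (fun _ : J => g) f}

lemma isCardinalPresentable_of_isPushout_sigma {κ : Cardinal.{v}} [Fact κ.IsRegular] {K : Type v}
    (hK : HasCardinalLT K κ) {C D : K → M} (h : ∀ k, C k ⟶ D k) {P P' : M} {a : ∐ C ⟶ P}
    {p : P ⟶ P'} {b : ∐ D ⟶ P'} (sq : IsPushout a (Limits.Sigma.map h) p b)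
    [∀ k, IsCardinalPresentable (C k) κ] [∀ k, IsCardinalPresentable (D k) κ]
    [IsCardinalPresentable P κ] : IsCardinalPresentable P' κ := by
  have h₁ : ∀ (E : K → M) [∀ k, IsCardinalPresentable (E k) κ], IsCardinalPresentable (∐ E) κ := by
    intro E _
    have : ∀ k, IsCardinalPresentable ((Discrete.functor E).obj k) κ := fun k => by
      dsimp; infer_instance
    exact isCardinalPresentable_of_isColimit _ (colimit.isColimit (Discrete.functor E)) κ (by
      rwa [hasCardinalLT_arrow_discrete_iff])
  have := h₁ C
  have := h₁ D
  have : ∀ k, IsCardinalPresentable ((span a (Limits.Sigma.map h)).obj k) κ := by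
    rintro (_ | _ | _) <;> dsimp <;> infer_instance
  exact isCardinalPresentable_of_isColimit _ sq.isColimit κ
    (hasCardinalLT_of_finite _ κ (Cardinal.IsRegular.aleph0_le Fact.out))

/-- Attaching some of the cells of `X₂` to a subobject of `X₁` gives a subobject of `X₂`. -/
lemma exists_attach_subset (hg : (MorphismProperty.ofHoms g).rlp.llp ≤ .monomorphisms M)
    [(MorphismProperty.monomorphisms M).IsStableUnderCobaseChange] {X₁ X₂ T : M} {φ : X₁ ⟶ X₂}
    (e : AttachCells.{v} g φ) (K : Set e.ι) (t : T ⟶ X₁) [Mono t] (att : ∀ k : K, A (e.π k) ⟶ T)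
    (hatt : ∀ k, att k ≫ t = e.cofan₁.inj k ≫ e.g₁) :
    ∃ (P : M) (p : T ⟶ P) (d : P ⟶ X₂) (_ : Mono d)
      (b : (∐ fun k : K => B (e.π k)) ⟶ P),
      p ≫ d = t ≫ φ ∧ (∀ k, Limits.Sigma.ι _ k ≫ b ≫ d = e.cell k) ∧
      IsPushout (Limits.Sigma.desc att) (Limits.Sigma.map fun _ => g _) p b := by
  have hcell : ∀ k, g _ ≫ e.cell k = e.cofan₁.inj k ≫ e.g₁ ≫ φ :=
    fun k => by rw [e.isPushout.w, AttachCells.cell, ← e.hm_assoc]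
  let a := Limits.Sigma.desc att
  let G := Limits.Sigma.map fun k : K => g (e.π k)
  let p : T ⟶ pushout a G := pushout.inl _ _
  have sq : IsPushout a G p (pushout.inr _ _) := .of_hasPushout _ _
  let b : ∀ k : K, B (e.π k) ⟶ pushout a G :=
    fun k => Limits.Sigma.ι (fun k : K => B (e.π k)) k ≫ pushout.inr _ _
  have hb : ∀ k, g _ ≫ b k = att k ≫ p := fun k => by
    have := Limits.Sigma.ι (fun k : K => A (e.π k)) k ≫= sq.w
    simpa [a, G, b] using this.symm
  let d : pushout a G ⟶ X₂ :=
    pushout.desc (t ≫ φ) (Limits.Sigma.desc fun k => e.cell k)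
      (Limits.Sigma.hom_ext _ _ fun k => by
        simp [a, G, reassoc_of% (hatt k), hcell])
  have hpd : p ≫ d = t ≫ φ := pushout.inl_desc _ _ _
  have hbd : ∀ k, b k ≫ d = e.cell k := fun k => by
    rw [Category.assoc, show pushout.inr a G ≫ d = _ from pushout.inr_desc _ _ _]
    exact Limits.Sigma.ι_desc _ _
  have sq' : IsPushout t p (pushout.inl t p) (pushout.inr t p) := .of_hasPushout _ _
  let r : pushout t p ⟶ X₂ := pushout.desc _ d hpd.symm
  have hr : (MorphismProperty.ofHoms g).rlp.llp r := by
    refine llp_of_attachCells e K (pushout.inl t p) (fun k => b k ≫ pushout.inr t p) r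
      (pushout.inl_desc _ _ _) (fun k => ?_) (fun k => ?_) fun {E} s s' h₁ h₂ => ?_
    · rw [Category.assoc, pushout.inr_desc, hbd]
    · rw [reassoc_of% (hb k), ← sq'.w, reassoc_of% (hatt k)]
    · refine pushout.hom_ext h₁ (pushout.hom_ext ?_ (Limits.Sigma.hom_ext _ _ fun k => ?_))
      · change p ≫ _ = p ≫ _
        rw [← sq'.w_assoc, ← sq'.w_assoc, h₁]
      · simpa [b] using h₂ k
  have : Mono (pushout.inr t p) :=
    (MorphismProperty.monomorphisms M).of_isPushout sq'.flip ‹Mono t›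
  have : Mono r := hg _ hr
  have hd : Mono d := by
    rw [show d = pushout.inr t p ≫ r from (pushout.inr_desc _ _ _).symm]
    infer_instance
  exact ⟨_, p, d, hd, _, hpd, fun k => (Category.assoc _ _ _).symm.trans (hbd k), sq⟩

lemma llp_of_isPushout_sigma {K : Type v} (i : K → α) {P P' : M}
    {a : (∐ fun k => A (i k)) ⟶ P} {p : P ⟶ P'} {b : (∐ fun k => B (i k)) ⟶ P'}
    (sq : IsPushout a (Limits.Sigma.map fun k => g (i k)) p b) :
    (MorphismProperty.ofHoms g).rlp.llp p :=
  MorphismProperty.of_isPushout sq (MorphismProperty.colimMap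
    (W := (MorphismProperty.ofHoms g).rlp.llp) _
    fun k => MorphismProperty.le_llp_rlp _ _ (.mk (i k.as)))

/-- The subobject generated by a subobject `T` and cells attached to it. -/
lemma exists_attach_subobject (hg : (MorphismProperty.ofHoms g).rlp.llp ≤ .monomorphisms M)
    [(MorphismProperty.monomorphisms M).IsStableUnderCobaseChange] {X₁ X₂ Z : M} {φ : X₁ ⟶ X₂}
    (e : AttachCells.{v} g φ) (K : Set e.ι) (m₁ : X₁ ⟶ Z) (m₂ : X₂ ⟶ Z) [Mono m₁] [Mono m₂]
    (hm : φ ≫ m₂ = m₁) (T : Subobject Z) (hT : T ≤ Subobject.mk m₁)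
    (hatt : ∀ k ∈ K, T.Factors (g _ ≫ e.cell k ≫ m₂)) :
    ∃ (T' : Subobject Z) (hT' : T ≤ T'), (∀ k ∈ K, T'.Factors (e.cell k ≫ m₂)) ∧
      (∀ P, T ≤ P → (∀ k ∈ K, P.Factors (e.cell k ≫ m₂)) → T' ≤ P) ∧
      (MorphismProperty.ofHoms g).rlp.llp (Subobject.ofLE T T' hT') ∧
      ∀ (κ : Cardinal.{v}) [Fact κ.IsRegular] [∀ i, IsCardinalPresentable (A i) κ]
        [∀ i, IsCardinalPresentable (B i) κ], HasCardinalLT K κ →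
        IsCardinalPresentable (T : M) κ → IsCardinalPresentable (T' : M) κ := by
  have hcell : ∀ k, g _ ≫ e.cell k = e.cofan₁.inj k ≫ e.g₁ ≫ φ :=
    fun k => by rw [e.isPushout.w, AttachCells.cell, ← e.hm_assoc]
  let att : ∀ k : K, A (e.π k) ⟶ (T : M) := fun k => T.factorThru _ (hatt k k.2)
  have hatt' : ∀ k : K, att k ≫ T.arrow = g _ ≫ e.cell k ≫ m₂ :=
    fun k => Subobject.factorThru_arrow _ _ (hatt k k.2)
  let t : (T : M) ⟶ X₁ := Subobject.ofLEMk _ _ hT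
  have ht : t ≫ m₁ = T.arrow := Subobject.ofLEMk_comp _
  have : Mono t := mono_of_mono_fac ht
  have hatt_t : ∀ k : K, att k ≫ t = e.cofan₁.inj k ≫ e.g₁ := fun k => by
    rw [← cancel_mono m₁, Category.assoc, ht, hatt', reassoc_of% (hcell k), hm, Category.assoc]
  obtain ⟨P, p, d, _, b, hpd, hbd, sq⟩ := exists_attach_subset hg e K t att hatt_t
  have hTq : p ≫ d ≫ m₂ = T.arrow := by
    rw [reassoc_of% hpd, hm, ht]
  have hTle : T ≤ Subobject.mk (d ≫ m₂) := Subobject.le_mk_of_comm p hTq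
  have hp : Subobject.ofLE _ _ hTle = p ≫ (Subobject.underlyingIso (d ≫ m₂)).inv := by
    rw [← cancel_mono (Subobject.arrow _), Subobject.ofLE_arrow, Category.assoc,
      Subobject.underlyingIso_arrow, hTq]
  refine ⟨_, hTle, fun k hk => ?_, fun Q hTQ hQ => ?_, ?_, fun κ _ _ _ hK _ => ?_⟩
  · exact mk_factors_of_comp_eq (Limits.Sigma.ι (fun k : K => B (e.π k)) ⟨k, hk⟩ ≫ b) (by
      rw [Category.assoc, reassoc_of% (hbd ⟨k, hk⟩)])
  · have hfac : Q.Factors (d ≫ m₂) := by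
      refine factors_of_isPushout sq _ ?_ (factors_of_isColimit (colimit.isColimit _) _ ?_)
      · rw [hTq]
        exact Subobject.factors_of_le _ hTQ (Subobject.factors_self _)
      · rintro ⟨k⟩
        exact (reassoc_of% (hbd k)) m₂ ▸ hQ k k.2
    exact Subobject.mk_le_of_comm _ (Subobject.factorThru_arrow _ _ hfac)
  · rw [hp]
    refine ((MorphismProperty.ofHoms g).rlp.llp.cancel_right_of_respectsIso _ _).2 ?_
    exact llp_of_isPushout_sigma (fun k : K => e.π k) sq
  · have := isCardinalPresentable_of_isPushout_sigma hK _ sq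
    exact isCardinalPresentable_of_iso (Subobject.underlyingIso (d ≫ m₂)).symm κ

variable [HasLimits M] [WellPowered.{v} M]

lemma exists_succ_cellSpan (hg : (MorphismProperty.ofHoms g).rlp.llp ≤ .monomorphisms M)
    [(MorphismProperty.monomorphisms M).IsStableUnderCobaseChange]
    {S : Set c.Cells} (hS : IsClosedSetOfCells c S) (j : J) (hj : ¬ IsMax j) :
    ∃ h : cellSpan c (cellsBelow c S j) ≤ cellSpan c (cellsBelow c S (Order.succ j)),
      (MorphismProperty.ofHoms g).rlp.llp (Subobject.ofLE _ _ h) ∧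
      ∀ (κ : Cardinal.{v}) [Fact κ.IsRegular] [∀ i, IsCardinalPresentable (A i) κ]
        [∀ i, IsCardinalPresentable (B i) κ], HasCardinalLT S κ →
        IsCardinalPresentable (cellSpan c (cellsBelow c S j) : M) κ →
        IsCardinalPresentable (cellSpan c (cellsBelow c S (Order.succ j)) : M) κ := by
  have hinc : ∀ i, Mono (c.incl.app i) := fun i => hg _ (llp_incl_app i)
  have hatt : ∀ k : (c.attachCells j hj).ι, RelativeCellComplex.Cells.mk j hj k ∈ S →
      (cellSpan c (cellsBelow c S j)).Factors
        (g _ ≫ (c.attachCells j hj).cell k ≫ c.incl.app (Order.succ j)) :=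
    fun k hk => hS ⟨j, hj, k⟩ hk
  obtain ⟨T', hT', h₁, h₂, h₃, h₄⟩ := exists_attach_subobject hg (c.attachCells j hj)
    {k | RelativeCellComplex.Cells.mk j hj k ∈ S} (c.incl.app j) (c.incl.app (Order.succ j))
    (map_comp_incl_app _) (cellSpan c (cellsBelow c S j))
    (generatedSubobject_le (mk_incl_app_factors j) fun γ hγ => mk_incl_app_factors_cell j γ hγ.2)
    hatt
  obtain rfl : T' = cellSpan c (cellsBelow c S (Order.succ j)) := by
    refine le_antisymm (h₂ _ (generatedSubobject_mono _ _
      (cellsBelow_mono_right S (Order.le_succ j))) fun k hk => ?_)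
      (generatedSubobject_le ?_ fun γ hγ => ?_)
    · exact generatedSubobject_factors_of_mem (B := fun γ : c.Cells => B γ.i) f
          (fun γ => γ.ι) (S := cellsBelow c S (Order.succ j)) (γ := ⟨j, hj, k⟩)
          ⟨hk, Order.lt_succ_of_not_isMax hj⟩
    · exact Subobject.factors_of_le _ hT' (generatedSubobject_factors _ _ _)
    · obtain ⟨i, hi, k⟩ := γ
      obtain hlt | rfl := (Order.le_of_lt_succ hγ.2).lt_or_eq
      · exact Subobject.factors_of_le _ hT' (generatedSubobject_factors_of_mem _ _ ⟨hγ.1, hlt⟩)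
      · exact h₁ k hγ.1
  refine ⟨hT', h₃, fun κ _ _ _ hκ => h₄ κ (hκ.of_injective (fun k => ⟨_, k.2⟩) ?_)⟩
  rintro ⟨k, hk⟩ ⟨k', hk'⟩ h
  simpa using h

end

section

open HomotopicalAlgebra

variable {M : Type u} [Category.{v} M]

lemma isFiltered_Iio_of_isSuccLimit {J : Type v} [LinearOrder J] [OrderBot J] {m : J}
    (hm : Order.IsSuccLimit m) : IsFiltered (Set.Iio m) := by
  have : Nonempty (Set.Iio m) := ⟨⟨⊥, hm.bot_lt⟩⟩
  infer_instance

variable {J : Type v} [LinearOrder J] [OrderBot J] [SuccOrder J] [WellFoundedLT J]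
  {α : Type w} {A B : α → M} {g : ∀ i, A i ⟶ B i} {X Z : M} {f : X ⟶ Z}
  (c : RelativeCellComplex.{v} (fun _ : J => g) f)

lemma iUnion_cellsBelow (S : Set c.Cells) : ⋃ j, cellsBelow c S j = S := by
  ext γ
  simpa [cellsBelow] using fun _ => ⟨_, Order.lt_succ_of_not_isMax γ.hj⟩

lemma iUnion_cellsBelow_of_isSuccLimit (S : Set c.Cells) {m : J} (hm : Order.IsSuccLimit m) :
    ⋃ j : Set.Iio m, cellsBelow c S j = cellsBelow c S m := by
  ext γ
  simp only [cellsBelow, Set.mem_iUnion, Set.mem_ofPred_eq, Subtype.exists, Set.mem_Iio]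
  constructor
  · rintro ⟨j, hj, h, h'⟩
    exact ⟨h, h'.trans hj⟩
  · rintro ⟨h, h'⟩
    exact ⟨_, hm.succ_lt h', h, Order.lt_succ_of_not_isMax γ.hj⟩

lemma mono_of_cellComplex (hg : (MorphismProperty.ofHoms g).rlp.llp ≤ .monomorphisms M)
    (c : RelativeCellComplex.{v} (fun _ : J => g) f) : Mono f := by
  have : Mono (c.incl.app ⊥) := hg _ (llp_incl_app _)
  rw [← c.fac]
  exact mono_comp _ _

lemma cellsBelow_bot (S : Set c.Cells) : cellsBelow c S ⊥ = ∅ := by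
  simp [cellsBelow]

variable [WellPowered.{v} M] [HasLimits M]

lemma cellSpan_empty [Mono f] : cellSpan c ∅ = Subobject.mk f := by
  refine le_antisymm (generatedSubobject_le (mk_factors_of_comp_eq (𝟙 _) (by simp)) (by simp)) ?_
  exact Subobject.mk_le_of_comm _
    (Subobject.factorThru_arrow _ _ (generatedSubobject_factors _ _ _))

/-- The filtration of the subobject generated by a set of cells. -/
noncomputable abbrev cellSpanFunctor (S : Set c.Cells) : J ⥤ Subobject Z :=
  Monotone.functor (f := fun j => cellSpan c (cellsBelow c S j)) fun _ _ h =>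
    generatedSubobject_mono _ _ (cellsBelow_mono_right S h)

variable {c}

/-- The subobject generated by no cells is the source of the cell complex. -/
noncomputable def cellSpanBotIso [Mono f] (S : Set c.Cells) :
    (cellSpan c (cellsBelow c S ⊥) : M) ≅ X :=
  Subobject.isoOfEq _ _ (by rw [cellsBelow_bot, cellSpan_empty]) ≪≫ Subobject.underlyingIso f

lemma cellSpanBotIso_inv_arrow [Mono f] (S : Set c.Cells) :
    (cellSpanBotIso S).inv ≫ (cellSpan c (cellsBelow c S ⊥)).arrow = f := by
  simp [cellSpanBotIso]

variable [HasColimits M]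

lemma IsGrothendieckTopos.nonempty_isColimit_underlying (htopos : IsGrothendieckTopos M)
    {X Z : M} {ι : Type w} {B : ι → M} {f : X ⟶ Z} {e : ∀ γ, B γ ⟶ Z}
    {K : Type v} [SmallCategory K] [IsFiltered K] {Φ : K ⥤ Subobject Z}
    (c : Cocone (Φ ⋙ Subobject.underlying)) (P : Subobject Z) (i : c.pt ≅ (P : M))
    (hi : ∀ k, c.ι.app k ≫ i.hom ≫ P.arrow = (Φ.obj k).arrow) (s : K → Set ι)
    (hP : P = generatedSubobject f e (⋃ k, s k))
    (hΦ : ∀ k, Φ.obj k = generatedSubobject f e (s k)) :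
    Nonempty (IsColimit c) := by
  have : ∀ k, Mono (c.ι.app k ≫ i.hom ≫ P.arrow) := fun k => by rw [hi]; infer_instance
  refine htopos.nonempty_isColimit_of_generatedSubobject f e c (i.hom ≫ P.arrow) s ?_ fun k => ?_
  · rw [← hP]
    conv_rhs => rw [← Subobject.mk_arrow P]
    exact Subobject.mk_eq_mk_of_comm _ _ i rfl
  · rw [← hΦ]
    conv_rhs => rw [← Subobject.mk_arrow (Φ.obj k)]
    exact Subobject.mk_eq_mk_of_comm _ _ (Iso.refl _) (by simp [hi])

lemma isWellOrderContinuous_cellSpanFunctor (htopos : IsGrothendieckTopos M) (S : Set c.Cells) :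
    (cellSpanFunctor c S ⋙ Subobject.underlying).IsWellOrderContinuous where
  nonempty_isColimit m hm := by
    have := isFiltered_Iio_of_isSuccLimit hm
    exact htopos.nonempty_isColimit_underlying (f := f) (e := fun γ : c.Cells => γ.ι)
      (Φ := (Set.principalSegIio m).monotone.functor ⋙ cellSpanFunctor c S)
      ((Set.principalSegIio m).cocone (cellSpanFunctor c S ⋙ Subobject.underlying))
      (cellSpan c (cellsBelow c S m)) (Iso.refl _)
      (fun k => (_ ≫= Category.id_comp (Subobject.arrow _)).trans
        (Subobject.ofLE_arrow _))
      (fun j => cellsBelow c S j) (by rw [iUnion_cellsBelow_of_isSuccLimit c S hm]) fun k => rfl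

lemma llp_cellSpan (htopos : IsGrothendieckTopos M)
    (hg : (MorphismProperty.ofHoms g).rlp.llp ≤ .monomorphisms M)
    [(MorphismProperty.monomorphisms M).IsStableUnderCobaseChange]
    {S : Set c.Cells} (hS : IsClosedSetOfCells c S) (i : X ⟶ (cellSpan c S : M))
    (hi : i ≫ (cellSpan c S).arrow = f) : (MorphismProperty.ofHoms g).rlp.llp i := by
  have := mono_of_cellComplex hg c
  have hle : ∀ j, cellSpan c (cellsBelow c S j) ≤ cellSpan c S := fun j =>
    generatedSubobject_mono _ _ fun _ h => h.1
  let t : Cocone (cellSpanFunctor c S ⋙ Subobject.underlying) :=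
    { pt := cellSpan c S
      ι := { app j := Subobject.ofLE _ _ (hle j)
             naturality _ _ _ :=
              (Subobject.ofLE_comp_ofLE _ _ _ _ _).trans (Category.comp_id _).symm } }
  obtain ⟨ht⟩ := htopos.nonempty_isColimit_underlying (f := f) (e := fun γ : c.Cells => γ.ι)
    t (cellSpan c S) (Iso.refl _) (fun k => (_ ≫= Category.id_comp (Subobject.arrow _)).trans
        (Subobject.ofLE_arrow _))
      (fun j => cellsBelow c S j) (by rw [iUnion_cellsBelow c S]) fun k => rfl
  exact MorphismProperty.transfiniteCompositionsOfShape_le _ J _ ⟨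
    { F := cellSpanFunctor c S ⋙ Subobject.underlying
      isoBot := cellSpanBotIso S
      isWellOrderContinuous := isWellOrderContinuous_cellSpanFunctor htopos S
      incl := t.ι
      isColimit := ht
      fac := by
        rw [← cancel_mono (cellSpan c S).arrow, hi, Category.assoc]
        exact (_ ≫= Subobject.ofLE_arrow _).trans (cellSpanBotIso_inv_arrow S)
      map_mem j hj := (exists_succ_cellSpan hg hS j hj).2.1 }⟩

lemma isCardinalPresentable_cellSpan_cellsBelow (htopos : IsGrothendieckTopos M)
    (hg : (MorphismProperty.ofHoms g).rlp.llp ≤ .monomorphisms M)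
    [(MorphismProperty.monomorphisms M).IsStableUnderCobaseChange]
    {κ : Cardinal.{v}} [Fact κ.IsRegular] [∀ i, IsCardinalPresentable (A i) κ]
    [∀ i, IsCardinalPresentable (B i) κ] [IsCardinalPresentable X κ]
    (hJ : ∀ j : J, HasCardinalLT (Set.Iio j) κ)
    {S : Set c.Cells} (hS : IsClosedSetOfCells c S) (hSκ : HasCardinalLT S κ) (j : J) :
    IsCardinalPresentable (cellSpan c (cellsBelow c S j) : M) κ := by
  have := mono_of_cellComplex hg c
  induction j using SuccOrder.limitRecOn with
  | isMin j hj =>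
    obtain rfl := hj.eq_bot
    exact isCardinalPresentable_of_iso (cellSpanBotIso S).symm κ
  | succ j hj ih => exact (exists_succ_cellSpan hg hS j hj).2.2 κ hSκ ih
  | isSuccLimit j hj ih =>
    have := isWellOrderContinuous_cellSpanFunctor htopos S
    have (k : Set.Iio j) : IsCardinalPresentable (((Set.principalSegIio j).monotone.functor ⋙
      cellSpanFunctor c S ⋙ Subobject.underlying).obj k) κ := ih k.1 k.2
    refine isCardinalPresentable_of_isColimit _ ((cellSpanFunctor c S ⋙
      Subobject.underlying).isColimitOfIsWellOrderContinuous j hj) κ ?_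
    refine (hasCardinalLT_prod (Cardinal.IsRegular.aleph0_le Fact.out) (hJ j) (hJ j)).of_injective
      (fun a => (a.left, a.right)) ?_
    rintro ⟨a, b, h⟩ ⟨a', b', h'⟩ hab
    obtain ⟨rfl, rfl⟩ := Prod.mk_inj.1 hab
    congr 1
    exact Subsingleton.elim (α := a ⟶ b) h h'

end

section

open HomotopicalAlgebra

variable {M : Type u} [Category.{v} M] [WellPowered.{v} M] [HasLimits M]
  {J : Type v} [LinearOrder J] [OrderBot J] [SuccOrder J] [WellFoundedLT J]
  {α : Type w} {A B : α → M} {g : ∀ i, A i ⟶ B i} {X Z : M} {f : X ⟶ Z}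
  {c : RelativeCellComplex.{v} (fun _ : J => g) f} {κ : Cardinal.{v}} [Fact κ.IsRegular]

lemma cellSpan_mono : Monotone (cellSpan c) := generatedSubobject_mono _ _

lemma IsClosedSetOfCells.iUnion {ι : Type*} {S : ι → Set c.Cells}
    (hS : ∀ i, IsClosedSetOfCells c (S i)) : IsClosedSetOfCells c (⋃ i, S i) := by
  intro γ hγ
  obtain ⟨i, hi⟩ := Set.mem_iUnion.1 hγ
  exact Subobject.factors_of_le _
    (cellSpan_mono (cellsBelow_mono_left (Set.subset_iUnion S i) _)) (hS i γ hi)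

lemma IsClosedSetOfCells.insert {S : Set c.Cells} (hS : IsClosedSetOfCells c S) (γ : c.Cells)
    (hj : ∀ δ ∈ S, δ.j < γ.j) (hγ : (cellSpan c S).Factors (g γ.i ≫ γ.ι)) :
    IsClosedSetOfCells c (insert γ S) := by
  rintro δ (rfl | hδ)
  · exact Subobject.factors_of_le _
      (cellSpan_mono fun ε hε => ⟨Set.mem_insert_of_mem _ hε, hj ε hε⟩) hγ
  · exact Subobject.factors_of_le _
      (cellSpan_mono (cellsBelow_mono_left (Set.subset_insert _ _) _)) (hS δ hδ)

variable [HasColimits M]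

lemma isCardinalPresentable_cellSpan (htopos : IsGrothendieckTopos M)
    (hg : (MorphismProperty.ofHoms g).rlp.llp ≤ .monomorphisms M)
    [(MorphismProperty.monomorphisms M).IsStableUnderCobaseChange]
    [∀ i, IsCardinalPresentable (A i) κ]
    [∀ i, IsCardinalPresentable (B i) κ] [IsCardinalPresentable X κ]
    [CategoryTheory.IsCardinalFiltered J κ] (hJ : ∀ j : J, HasCardinalLT (Set.Iio j) κ)
    {S : Set c.Cells} (hS : IsClosedSetOfCells c S) (hSκ : HasCardinalLT S κ) :
    IsCardinalPresentable (cellSpan c S : M) κ := by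
  let m : J := IsCardinalFiltered.max (fun γ : S => Order.succ γ.1.j) hSκ
  have hm : cellsBelow c S m = S := Set.Subset.antisymm (fun _ h => h.1) fun γ hγ =>
    ⟨hγ, (Order.lt_succ_of_not_isMax γ.hj).trans_le
      (leOfHom (IsCardinalFiltered.toMax (fun γ : S => Order.succ γ.1.j) hSκ ⟨γ, hγ⟩))⟩
  have := isCardinalPresentable_cellSpan_cellsBelow htopos hg hJ hS hSκ m
  rwa [hm] at this

lemma exists_small_cellSpan_factors (htopos : IsGrothendieckTopos M) {U : Set c.Cells}
    (hU : ∀ γ ∈ U, ∃ S ⊆ U, γ ∈ S ∧ IsClosedSetOfCells c S ∧ HasCardinalLT S κ)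
    {D : M} [IsCardinalPresentable D κ] (h : D ⟶ Z) (hh : (cellSpan c U).Factors h) :
    ∃ S ⊆ U, IsClosedSetOfCells c S ∧ HasCardinalLT S κ ∧ (cellSpan c S).Factors h := by
  let K := {S : Set c.Cells // S ⊆ U ∧ IsClosedSetOfCells c S ∧ HasCardinalLT S κ}
  have : CategoryTheory.IsCardinalFiltered K κ := isCardinalFiltered_preorder _ _ fun I s hI =>
    ⟨⟨⋃ i, (s i).1, Set.iUnion_subset fun i => (s i).2.1,
      .iUnion fun i => (s i).2.2.1, hasCardinalLT_iUnion _
        ((hasCardinalLT_iff_cardinal_mk_lt _ _).2 hI) fun i => (s i).2.2.2⟩,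
      fun i => Set.subset_iUnion (fun i => (s i).1) i⟩
  have := isFiltered_of_isCardinalFiltered K κ
  let Φ : K ⥤ Subobject Z :=
    Monotone.functor (f := fun S => cellSpan c S.1) fun _ _ h => cellSpan_mono h
  let t : Cocone (Φ ⋙ Subobject.underlying) :=
    { pt := cellSpan c U
      ι := { app S := Subobject.ofLE _ _ (cellSpan_mono S.2.1)
             naturality _ _ _ :=
              (Subobject.ofLE_comp_ofLE _ _ _ _ _).trans (Category.comp_id _).symm } }
  have hUS : ⋃ S : K, S.1 = U := by
    refine Set.Subset.antisymm (Set.iUnion_subset fun S => S.2.1) fun γ hγ => ?_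
    obtain ⟨S, h₁, h₂, h₃⟩ := hU γ hγ
    exact Set.mem_iUnion.2 ⟨⟨S, h₁, h₃⟩, h₂⟩
  obtain ⟨ht⟩ := htopos.nonempty_isColimit_underlying (f := f) (e := fun γ : c.Cells => γ.ι)
    t (cellSpan c U) (Iso.refl _) (fun k => (_ ≫= Category.id_comp (Subobject.arrow _)).trans
        (Subobject.ofLE_arrow _)) (fun S => S.1) (by rw [hUS]) fun k => rfl
  obtain ⟨S, l, hl⟩ := IsCardinalPresentable.exists_hom_of_isColimit κ ht
    ((cellSpan c U).factorThru h hh)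
  refine ⟨S.1, S.2.1, S.2.2.1, S.2.2.2, factors_of_comp_arrow_eq l ?_⟩
  rw [← Subobject.factorThru_arrow _ _ hh, ← hl, Category.assoc]
  exact l ≫= (Subobject.ofLE_arrow _).symm

lemma exists_small_closed_mem (htopos : IsGrothendieckTopos M)
    [∀ i, IsCardinalPresentable (A i) κ] (γ : c.Cells) :
    ∃ S : Set c.Cells, γ ∈ S ∧ IsClosedSetOfCells c S ∧ HasCardinalLT S κ ∧
      ∀ δ ∈ S, δ.j ≤ γ.j := by
  induction hj : γ.j using WellFoundedLT.induction generalizing γ with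
  | _ j ih =>
  subst hj
  let U : Set c.Cells := {δ | δ.j < γ.j}
  have hU : ∀ δ ∈ U, ∃ S ⊆ U, δ ∈ S ∧ IsClosedSetOfCells c S ∧ HasCardinalLT S κ := by
    intro δ hδ
    obtain ⟨S, h₁, h₂, h₃, h₄⟩ := ih _ hδ δ rfl
    exact ⟨S, fun ε hε => (h₄ ε hε).trans_lt hδ, h₁, h₂, h₃⟩
  let e := c.attachCells γ.j γ.hj
  have hγ : g γ.i ≫ γ.ι = e.cofan₁.inj γ.k ≫ e.g₁ ≫ c.incl.app γ.j := by
    have hcell : g (e.π γ.k) ≫ e.cell γ.k =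
        e.cofan₁.inj γ.k ≫ e.g₁ ≫ c.F.map (homOfLE (Order.le_succ γ.j)) := by
      rw [e.isPushout.w, AttachCells.cell, ← e.hm_assoc]
    change g (e.π γ.k) ≫ e.cell γ.k ≫ c.incl.app (Order.succ γ.j) = _
    rw [reassoc_of% hcell, map_comp_incl_app]
  have hfac : (cellSpan c U).Factors (g γ.i ≫ γ.ι) := by
    rw [hγ]
    refine Subobject.factors_of_factors_right _ (Subobject.factors_of_factors_right _ ?_)
    exact incl_app_factors (generatedSubobject_factors _ _ _) _
      fun δ hδ => generatedSubobject_factors_of_mem (B := fun γ : c.Cells => B γ.i) f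
          (fun γ => γ.ι) hδ
  obtain ⟨S, h₁, h₂, h₃, h₄⟩ := exists_small_cellSpan_factors htopos hU _ hfac
  refine ⟨insert γ S, Set.mem_insert _ _, h₂.insert γ h₁ h₄, ?_, ?_⟩
  · have hκ : Cardinal.aleph0 ≤ κ := Cardinal.IsRegular.aleph0_le Fact.out
    exact hasCardinalLT_union hκ (hasCardinalLT_of_finite ({γ} : Set c.Cells) κ hκ) h₃
  · rintro δ (rfl | hδ)
    · exact le_rfl
    · exact (h₁ hδ).le

lemma exists_small_closed_factors (htopos : IsGrothendieckTopos M)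
    [∀ i, IsCardinalPresentable (A i) κ] {D : M} [IsCardinalPresentable D κ] (h : D ⟶ Z) :
    ∃ S : Set c.Cells, IsClosedSetOfCells c S ∧ HasCardinalLT S κ ∧ (cellSpan c S).Factors h := by
  have hid : (cellSpan c Set.univ).Factors (h ≫ 𝟙 Z) := Subobject.factors_of_factors_right _ <|
    id_factors (c := c) (generatedSubobject_factors _ _ _) fun γ =>
      generatedSubobject_factors_of_mem (B := fun γ : c.Cells => B γ.i) f
        (fun γ => γ.ι) (Set.mem_univ γ)
  rw [Category.comp_id] at hid
  obtain ⟨S, -, hS⟩ := exists_small_cellSpan_factors (κ := κ) htopos (fun γ _ => by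
    obtain ⟨S, h₁, h₂, h₃, -⟩ := exists_small_closed_mem (κ := κ) htopos γ
    exact ⟨S, Set.subset_univ _, h₁, h₂, h₃⟩) h hid
  exact ⟨S, hS⟩

lemma exists_presentable_factorization (htopos : IsGrothendieckTopos M) {ι : Type v}
    {A B : ι → M} (g : ∀ i, A i ⟶ B i)
    (hg : (MorphismProperty.ofHoms g).rlp.llp ≤ .monomorphisms M)
    [(MorphismProperty.monomorphisms M).IsStableUnderCobaseChange]
    [∀ i, IsCardinalPresentable (A i) κ] [∀ i, IsCardinalPresentable (B i) κ]
    {X D Z : M} [IsCardinalPresentable X κ] [IsCardinalPresentable D κ] (u : X ⟶ D) (q : D ⟶ Z)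
    (h : (MorphismProperty.ofHoms g).rlp.llp (u ≫ q)) :
    ∃ (C : M) (a : D ⟶ C) (b : C ⟶ Z), IsCardinalPresentable C κ ∧ a ≫ b = q ∧
      (MorphismProperty.ofHoms g).rlp.llp (u ≫ a) := by
  have : Nonempty κ.ord.ToType := nonempty_ord_toType κ
  have := WellFoundedLT.toOrderBot κ.ord.ToType
  have := isCardinalForSmallObjectArgument_ofHoms (κ := κ) g
  let I := MorphismProperty.ofHoms g
  have hpres : ∀ {C E : M} (φ : C ⟶ E), I φ →
      IsCardinalPresentable C κ ∧ IsCardinalPresentable E κ := by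
    rintro _ _ _ ⟨i⟩
    exact ⟨inferInstance, inferInstance⟩
  have hsrc : ∀ i : I.toSet, IsCardinalPresentable i.1.left κ := fun i => (hpres _ i.2).1
  have htgt : ∀ i : I.toSet, IsCardinalPresentable i.1.right κ := fun i => (hpres _ i.2).2
  have hI : MorphismProperty.ofHoms I.homFamily = I := I.ofHoms_homFamily
  let c := SmallObject.relativeCellComplexιObj I κ (u ≫ q)
  have := h _ (SmallObject.rlp_πObj I κ (u ≫ q))
  have sq : CommSq (SmallObject.ιObj I κ (u ≫ q)) (u ≫ q) (SmallObject.πObj I κ (u ≫ q)) (𝟙 _) :=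
    ⟨by simp⟩
  obtain ⟨S, hS, hSκ, hfac⟩ := exists_small_closed_factors (c := c) (κ := κ) htopos (q ≫ sq.lift)
  let a := (cellSpan c S).factorThru _ hfac
  have ha : a ≫ (cellSpan c S).arrow = q ≫ sq.lift := Subobject.factorThru_arrow _ _ hfac
  refine ⟨(cellSpan c S : M), a, (cellSpan c S).arrow ≫ SmallObject.πObj I κ (u ≫ q), ?_, ?_, ?_⟩
  · refine isCardinalPresentable_cellSpan htopos (hI.symm ▸ hg) (fun j => ?_) hS hSκ
    rw [hasCardinalLT_iff_cardinal_mk_lt]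
    simpa using Cardinal.mk_Iio_lt j
  · rw [reassoc_of% ha, sq.fac_right, Category.comp_id]
  · have := llp_cellSpan htopos (hI.symm ▸ hg) hS (u ≫ a) (by
      rw [Category.assoc, ha, ← Category.assoc, sq.fac_left])
    rwa [hI] at this

end

section

variable {M : Type u} [Category.{v} M] {κ : Cardinal.{v}} [Fact κ.IsRegular] [HasColimits M]

lemma isCardinalPresentable_pushout {X Y Z : M} (f : X ⟶ Y) (g : X ⟶ Z)
    [IsCardinalPresentable X κ] [IsCardinalPresentable Y κ] [IsCardinalPresentable Z κ] :
    IsCardinalPresentable (pushout f g) κ := by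
  have : ∀ k, IsCardinalPresentable ((span f g).obj k) κ := by
    rintro (_ | _ | _) <;> dsimp <;> infer_instance
  exact isCardinalPresentable_of_isColimit _ (colimit.isColimit (span f g)) κ
    (hasCardinalLT_of_finite _ κ (Cardinal.IsRegular.aleph0_le Fact.out))

/-- An arrow between `κ`-presentable objects is `κ`-presentable in the arrow category. -/
lemma isCardinalPresentable_arrow (a : Arrow M) [IsCardinalPresentable a.left κ]
    [IsCardinalPresentable a.right κ] : IsCardinalPresentable a κ where
  preservesColimitOfShape J _ _ := ⟨fun {F} => ⟨fun {c} hc => ⟨by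
    have := isFiltered_of_isCardinalFiltered J κ
    have hl := isColimitOfPreserves Arrow.leftFunc hc
    have hr := isColimitOfPreserves Arrow.rightFunc hc
    refine Types.FilteredColimit.isColimitOf' _ _ (fun (φ : a ⟶ c.pt) => ?_)
      fun j (x y : a ⟶ F.obj j) (hxy : x ≫ c.ι.app j = y ≫ c.ι.app j) => ?_
    · obtain ⟨i, l, hi⟩ := IsCardinalPresentable.exists_hom_of_isColimit κ hl φ.left
      obtain ⟨i', r, hi'⟩ := IsCardinalPresentable.exists_hom_of_isColimit κ hr φ.right
      change a.left ⟶ (F.obj i).left at l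
      change a.right ⟶ (F.obj i').right at r
      change l ≫ (c.ι.app i).left = _ at hi
      change r ≫ (c.ι.app i').right = _ at hi'
      let m := IsFiltered.max i i'
      let s : i ⟶ m := IsFiltered.leftToMax i i'
      let s' : i' ⟶ m := IsFiltered.rightToMax i i'
      obtain ⟨k, u, hu⟩ := IsCardinalPresentable.exists_eq_of_isColimit' κ hr (i := m)
        (l ≫ (F.map s).left ≫ (F.obj m).hom) (a.hom ≫ r ≫ (F.map s').right) (by
          have e₁ : (F.map s).left ≫ (c.ι.app m).left = (c.ι.app i).left :=
            congr($(c.w s).left)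
          have e₂ : (F.map s').right ≫ (c.ι.app m).right = (c.ι.app i').right :=
            congr($(c.w s').right)
          change (l ≫ (F.map s).left ≫ (F.obj m).hom) ≫ (c.ι.app m).right =
            (a.hom ≫ r ≫ (F.map s').right) ≫ (c.ι.app m).right
          have e₃ : (F.obj m).hom ≫ (c.ι.app m).right = (c.ι.app m).left ≫ c.pt.hom :=
            (c.ι.app m).w.symm
          rw [Category.assoc, Category.assoc, e₃, reassoc_of% e₁, reassoc_of% hi,
            Category.assoc, Category.assoc, e₂, hi']
          exact φ.w)
      change (l ≫ (F.map s).left ≫ (F.obj m).hom) ≫ (F.map u).right =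
        (a.hom ≫ r ≫ (F.map s').right) ≫ (F.map u).right at hu
      have e₄ : (F.obj m).hom ≫ (F.map u).right = (F.map u).left ≫ (F.obj k).hom :=
        (F.map u).w.symm
      refine ⟨k, Arrow.homMk (l ≫ (F.map s).left ≫ (F.map u).left)
        (r ≫ (F.map s').right ≫ (F.map u).right) ?_, ?_⟩
      · simpa only [Category.assoc, e₄] using hu
      · have e₅ : (F.map s).left ≫ (F.map u).left ≫ (c.ι.app k).left = (c.ι.app i).left := by
          have := congr($(c.w (s ≫ u)).left)
          rw [F.map_comp, Arrow.comp_left, Arrow.comp_left] at this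
          exact (Category.assoc _ _ _).symm.trans this
        have e₆ : (F.map s').right ≫ (F.map u).right ≫ (c.ι.app k).right =
            (c.ι.app i').right := by
          have := congr($(c.w (s' ≫ u)).right)
          rw [F.map_comp, Arrow.comp_right, Arrow.comp_right] at this
          exact (Category.assoc _ _ _).symm.trans this
        change φ = _
        ext
        · change φ.left = (l ≫ (F.map s).left ≫ (F.map u).left) ≫ (c.ι.app k).left
          rw [Category.assoc, Category.assoc, e₅, hi]
        · change φ.right = (r ≫ (F.map s').right ≫ (F.map u).right) ≫ (c.ι.app k).right
          rw [Category.assoc, Category.assoc, e₆, hi']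
    · obtain ⟨k, u, hu⟩ := IsCardinalPresentable.exists_eq_of_isColimit' κ hl (i := j)
        x.left y.left congr($(hxy).left)
      obtain ⟨k', u', hu'⟩ := IsCardinalPresentable.exists_eq_of_isColimit' κ hr (i := j)
        x.right y.right congr($(hxy).right)
      change x.left ≫ (F.map u).left = y.left ≫ (F.map u).left at hu
      change x.right ≫ (F.map u').right = y.right ≫ (F.map u').right at hu'
      obtain ⟨m, s, s', hs⟩ := IsFiltered.span u u'
      refine ⟨m, u ≫ s, ?_⟩
      change x ≫ F.map (u ≫ s) = y ≫ F.map (u ≫ s)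
      ext
      · simp [reassoc_of% hu]
      · rw [hs]
        simp [reassoc_of% hu']⟩⟩⟩

variable [WellPowered.{v} M] [HasLimits M]

/-- A square from `f : A ⟶ B` to `x : X ⟶ Y`, together with a map to the middle object of a
factorization of `x` from the mapping cylinder of `f`, factors through a weak equivalence between
`κ`-presentable objects. -/
lemma exists_presentable_W_of_factorization (htopos : IsGrothendieckTopos M)
    {S : ModelStructure M} (hcof : S.Cof = .monomorphisms M) (hS : IsCombinatorial S κ)
    [(MorphismProperty.monomorphisms M).IsStableUnderCobaseChange]
    {A B X Y Z : M} (K : CylinderObject S A) (f : A ⟶ B)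
    [IsCardinalPresentable A κ] [IsCardinalPresentable B κ]
    [IsCardinalPresentable X κ] [IsCardinalPresentable K.C κ]
    (α : X ⟶ Z) (β : Z ⟶ Y) (hα : (S.Cof ⊓ S.W) α) (l : A ⟶ X) (r : B ⟶ Y)
    (t : pushout K.i₁ f ⟶ Z)
    (ht : K.i₀ ≫ pushout.inl _ _ ≫ t = l ≫ α)
    (ht' : pushout.inl _ _ ≫ t ≫ β = K.p ≫ l ≫ α ≫ β)
    (ht'' : pushout.inr _ _ ≫ t ≫ β = r) :
    ∃ (P C : M) (w : P ⟶ C) (s₁ : A ⟶ P) (s₂ : B ⟶ C) (q₁ : P ⟶ X) (q₂ : C ⟶ Y),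
      S.W w ∧ IsCardinalPresentable P κ ∧ IsCardinalPresentable C κ ∧
      s₁ ≫ w = f ≫ s₂ ∧ q₁ ≫ α ≫ β = w ≫ q₂ ∧ s₁ ≫ q₁ = l ∧ s₂ ≫ q₂ = r := by
  obtain ⟨ι', A', B', g, hA', hB', hJ⟩ := hS.trivCofGenerated
  rw [llp_rlpOf_eq] at hJ
  simp only [isPresentable_iff] at hA' hB'
  have hi₀ : (S.Cof ⊓ S.W) K.i₀ := by
    refine ⟨?_, S.W_of_comp_right K.i₀ K.p K.hp (K.hi₀ ▸ S.W_id _)⟩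
    rw [hcof]
    have : Mono (K.i₀ ≫ K.p) := by rw [K.hi₀]; infer_instance
    exact mono_of_mono K.i₀ K.p
  have : IsCardinalPresentable (pushout K.i₁ f) κ := isCardinalPresentable_pushout _ _
  have : IsCardinalPresentable (pushout l (K.i₀ ≫ pushout.inl K.i₁ f)) κ :=
    isCardinalPresentable_pushout _ _
  have hJle : (MorphismProperty.ofHoms g).rlp.llp ≤ .monomorphisms M := by
    rw [← hJ, ← hcof]
    exact inf_le_left
  obtain ⟨C, d, b, hC, hdb, hd⟩ := exists_presentable_factorization htopos (κ := κ) g hJle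
    (pushout.inl l (K.i₀ ≫ pushout.inl K.i₁ f))
    (pushout.desc α t (by rw [Category.assoc, ht])) (by
      rw [← hJ, pushout.inl_desc]
      exact hα)
  rw [← hJ] at hd
  have hd₁ : pushout.inl l (K.i₀ ≫ pushout.inl K.i₁ f) ≫ d ≫ b = α := by
    rw [hdb, pushout.inl_desc]
  have hd₂ : pushout.inr l (K.i₀ ≫ pushout.inl K.i₁ f) ≫ d ≫ b = t := by
    rw [hdb, pushout.inr_desc]
  have hcond := pushout.condition (f := l) (g := K.i₀ ≫ pushout.inl K.i₁ f)
  have hcond' := pushout.condition (f := K.i₁) (g := f)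
  simp only [Category.assoc] at hcond
  let w : pushout l K.i₀ ⟶ C := pushout.desc (pushout.inl _ _ ≫ d)
    (pushout.inl K.i₁ f ≫ pushout.inr l (K.i₀ ≫ pushout.inl K.i₁ f) ≫ d)
    (by rw [reassoc_of% hcond])
  refine ⟨_, C, w, K.i₁ ≫ pushout.inr l K.i₀,
    pushout.inr K.i₁ f ≫ pushout.inr l (K.i₀ ≫ pushout.inl K.i₁ f) ≫ d,
    pushout.desc (𝟙 _) (K.p ≫ l) (by simp [reassoc_of% K.hi₀]), b ≫ β,
    ?_, isCardinalPresentable_pushout _ _, hC, by simp [w, pushout.inr_desc, reassoc_of% hcond'],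
    ?_, ?_, ?_⟩
  · refine S.W_of_comp_left (pushout.inl l K.i₀) w ?_ (by simpa [w, pushout.inl_desc] using hd.2)
    have h : (MorphismProperty.ofHoms g).rlp.llp K.i₀ := hJ ▸ hi₀
    have h' : (S.Cof ⊓ S.W) (pushout.inl l K.i₀) := by
      rw [hJ]
      exact MorphismProperty.of_isPushout (IsPushout.of_hasPushout _ _) h
    exact h'.2
  · apply pushout.hom_ext
    · simp [w, pushout.inl_desc_assoc, reassoc_of% hd₁]
    · simp [w, pushout.inr_desc_assoc, reassoc_of% hd₂, ht']
  · simp [pushout.inr_desc, reassoc_of% K.hi₁]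
  · simp [reassoc_of% hd₂, ht'']

end

section

variable {M : Type u} [Category.{v} M] {κ : Cardinal.{v}} [Fact κ.IsRegular] [HasColimits M]

/-- The cylinder object provided by a cylinder functor. -/
@[simps]
def CylinderFunctor.cylinderObject {S : ModelStructure M} (Cyl : CylinderFunctor S) (X : M) :
    CylinderObject S X where
  C := Cyl.Cyl.obj X
  i₀ := Cyl.i₀.app X
  i₁ := Cyl.i₁.app X
  p := Cyl.p.app X
  hi₀ := Cyl.hi₀ X
  hi₁ := Cyl.hi₁ X
  hp := Cyl.hp X
  hcof := Cyl.hcof X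

lemma exists_mappingCylinder_lift (htopos : IsGrothendieckTopos M)
    {S : ModelStructure M} (hcof : S.Cof = .monomorphisms M)
    {A B X Y Z : M} (K : CylinderObject S A) (f : A ⟶ B) (l : A ⟶ X) (r : B ⟶ Y)
    (α : X ⟶ Z) (β : Z ⟶ Y) (hβ : S.Fib β) (hβ' : S.W β) (h : l ≫ α ≫ β = f ≫ r) :
    ∃ t : pushout K.i₁ f ⟶ Z, K.i₀ ≫ pushout.inl _ _ ≫ t = l ≫ α ∧
      t ≫ β = pushout.desc (K.p ≫ f) (𝟙 B) (by simp [reassoc_of% K.hi₁]) ≫ r := by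
  have := S.lift_cof_trivFib (initial.to B) β
    (by rw [hcof]; exact htopos.mono_of_isInitial initialIsInitial _) hβ hβ'
  have sq : CommSq (initial.to Z) (initial.to B) β r := ⟨initialIsInitial.hom_ext _ _⟩
  obtain ⟨d, hd, d₀, d₁⟩ : ∃ d : A ⨿ A ⟶ K.C, S.Cof d ∧ coprod.inl ≫ d = K.i₀ ∧
      coprod.inr ≫ d = K.i₁ :=
    ⟨_, K.hcof _ (coprodIsCoprod A A), (coprodIsCoprod A A).fac _ ⟨.left⟩,
      (coprodIsCoprod A A).fac _ ⟨.right⟩⟩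
  have := S.lift_cof_trivFib d β hd hβ hβ'
  have sq' : CommSq (coprod.desc (l ≫ α) (f ≫ sq.lift)) d β (K.p ≫ f ≫ r) := ⟨by
    refine coprod.hom_ext ?_ ?_
    · rw [coprod.inl_desc_assoc, reassoc_of% d₀, reassoc_of% K.hi₀, Category.assoc, h]
    · rw [coprod.inr_desc_assoc, reassoc_of% d₁, reassoc_of% K.hi₁, Category.assoc, sq.fac_right]⟩
  have e₀ : K.i₀ ≫ sq'.lift = l ≫ α := by
    rw [← d₀, Category.assoc, sq'.fac_left, coprod.inl_desc]
  have e₁ : K.i₁ ≫ sq'.lift = f ≫ sq.lift := by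
    rw [← d₁, Category.assoc, sq'.fac_left, coprod.inr_desc]
  refine ⟨pushout.desc sq'.lift sq.lift e₁, by rw [pushout.inl_desc, e₀], ?_⟩
  apply pushout.hom_ext
  · simp [pushout.inl_desc_assoc]
  · simp [pushout.inr_desc_assoc]

variable [HasLimits M]

/-- The colimit of a `κ`-filtered diagram of arrows is factored, compatibly with the diagram, into
a trivial cofibration followed by a fibration. -/
lemma exists_trivCof_fib_factorization_of_isColimit {S : ModelStructure M}
    (hS : IsCombinatorial S κ) {J : Type v} [SmallCategory J]
    [CategoryTheory.IsCardinalFiltered J κ] {F : J ⥤ Arrow M} {c : Cocone F} (hc : IsColimit c) :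
    ∃ (H : J ⥤ M) (e : Cocone H) (_ : IsColimit e) (α : ∀ k, (F.obj k).left ⟶ H.obj k)
      (β : ∀ k, H.obj k ⟶ (F.obj k).right) (a : c.pt.left ⟶ e.pt) (b : e.pt ⟶ c.pt.right),
      (∀ ⦃k l⦄ (u : k ⟶ l), (F.map u).left ≫ α l = α k ≫ H.map u) ∧
      (∀ ⦃k l⦄ (u : k ⟶ l), H.map u ≫ β l = β k ≫ (F.map u).right) ∧
      (∀ k, α k ≫ β k = (F.obj k).hom) ∧ a ≫ b = c.pt.hom ∧
      (∀ k, (c.ι.app k).left ≫ a = α k ≫ e.ι.app k) ∧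
      (∀ k, e.ι.app k ≫ b = β k ≫ (c.ι.app k).right) ∧
      (∀ k, (S.Cof ⊓ S.W) (α k)) ∧ (S.Cof ⊓ S.W) a ∧ S.Fib b := by
  obtain ⟨ι', A', B', g, hA', hB', hJ⟩ := hS.trivCofGenerated
  rw [llp_rlpOf_eq] at hJ
  simp only [isPresentable_iff] at hA' hB'
  have hcl := isColimitOfPreserves Arrow.leftFunc hc
  have hcr := isColimitOfPreserves Arrow.rightFunc hc
  obtain ⟨H, α, β, e, he, a', b, fac, fac', ha, hb, hβ, hα, ha'⟩ :=
    exists_colimit_factorization (κ := κ) g (Functor.whiskerLeft F Arrow.leftToRight) hcl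
      (d := Arrow.rightFunc.mapCocone c) c.pt.hom (fun k => (c.ι.app k).w)
  rw [← hJ] at hα ha'
  exact ⟨H, e, he, α.app, β.app, a', b, fun _ _ u => α.naturality u, fun _ _ u => β.naturality u,
    fun k => congr($(fac).app k), fac', ha, hb, hα, ha',
    S.fib_of_rlp hJ (rlp_of_isColimit (κ := κ) g β hβ he hcr b hb)⟩

variable [WellPowered.{v} M]

/-- In a `κ`-filtered diagram of arrows with `κ`-presentable sources whose colimit is a weak
equivalence, any map to the colimit from an arrow between `κ`-presentable objects factors through
some stage via a weak equivalence between `κ`-presentable objects. -/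
lemma exists_presentable_W_of_isColimit (htopos : IsGrothendieckTopos M)
    {S : ModelStructure M} (hcof : S.Cof = .monomorphisms M) (hS : IsCombinatorial S κ)
    [(MorphismProperty.monomorphisms M).IsStableUnderCobaseChange]
    {J : Type v} [SmallCategory J] [CategoryTheory.IsCardinalFiltered J κ] {F : J ⥤ Arrow M}
    {c : Cocone F} (hc : IsColimit c) (hF : ∀ j, IsCardinalPresentable (F.obj j).left κ)
    (hW : S.W c.pt.hom)
    {a : Arrow M} (K : CylinderObject S a.left) [IsCardinalPresentable K.C κ]
    [IsCardinalPresentable a.left κ] [IsCardinalPresentable a.right κ] (φ : a ⟶ c.pt) :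
    ∃ (w : Arrow M) (s : a ⟶ w) (q : w ⟶ c.pt), S.W w.hom ∧ IsCardinalPresentable w.left κ ∧
      IsCardinalPresentable w.right κ ∧ s ≫ q = φ := by
  have := isFiltered_of_isCardinalFiltered J κ
  have hcr := isColimitOfPreserves Arrow.rightFunc hc
  obtain ⟨H, e, he, α, β, a', b, hα', hβ', fac, fac', ha, hb, hα, ha', hbF⟩ :=
    exists_trivCof_fib_factorization_of_isColimit (κ := κ) hS hc
  have hbW : S.W b := S.W_of_comp_left a' b ha'.2 (by rw [fac']; exact hW)
  obtain ⟨t, ht, ht'⟩ := exists_mappingCylinder_lift htopos hcof K a.hom φ.left φ.right a' b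
    hbF hbW (congr(φ.left ≫ $fac').trans φ.w)
  have := isCardinalPresentable_arrow (κ := κ) a
  have : IsCardinalPresentable (pushout K.i₁ a.hom) κ := isCardinalPresentable_pushout _ _
  obtain ⟨j₁, φ₁, hφ₁⟩ := IsCardinalPresentable.exists_hom_of_isColimit κ hc φ
  obtain ⟨j₂, t₂, ht₂⟩ := IsCardinalPresentable.exists_hom_of_isColimit κ he t
  obtain ⟨m, φ₂, t₃, hφ₂, ht₃⟩ : ∃ (m : J) (φ₂ : a ⟶ F.obj m) (t₃ : pushout K.i₁ a.hom ⟶ H.obj m),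
      φ₂ ≫ c.ι.app m = φ ∧ t₃ ≫ e.ι.app m = t :=
    ⟨IsFiltered.max j₁ j₂, φ₁ ≫ F.map (IsFiltered.leftToMax _ _),
      t₂ ≫ H.map (IsFiltered.rightToMax _ _), by simp [hφ₁], by simp [ht₂]⟩
  have hl : φ₂.left ≫ (c.ι.app m).left = φ.left := congr($(hφ₂).left)
  have hr : φ₂.right ≫ (c.ι.app m).right = φ.right := congr($(hφ₂).right)
  let ρ : pushout K.i₁ a.hom ⟶ a.right :=
    pushout.desc (K.p ≫ a.hom) (𝟙 _) (by simp [reassoc_of% K.hi₁])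
  obtain ⟨k₁, u₁, hu₁⟩ := IsCardinalPresentable.exists_eq_of_isColimit' κ he (i := m)
    (K.i₀ ≫ pushout.inl _ _ ≫ t₃) (φ₂.left ≫ α m) (by
      have : (c.ι.app m).left ≫ a' = α m ≫ e.ι.app m := ha m
      rw [Category.assoc, Category.assoc, Category.assoc, ht₃, ht, ← this, reassoc_of% hl])
  obtain ⟨k₂, u₂, hu₂⟩ := IsCardinalPresentable.exists_eq_of_isColimit' κ hcr (i := m)
    (t₃ ≫ β m) (ρ ≫ φ₂.right) (by
      have : e.ι.app m ≫ b = β m ≫ (c.ι.app m).right := hb m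
      change (t₃ ≫ β m) ≫ (c.ι.app m).right = (ρ ≫ φ₂.right) ≫ (c.ι.app m).right
      simp only [Category.assoc, ← this, reassoc_of% ht₃, hr, ht', ρ])
  change (t₃ ≫ β m) ≫ (F.map u₂).right = (ρ ≫ φ₂.right) ≫ (F.map u₂).right at hu₂
  obtain ⟨k, v₁, v₂, hv⟩ := IsFiltered.span u₁ u₂
  have eq₁ : K.i₀ ≫ pushout.inl _ _ ≫ t₃ ≫ H.map (u₁ ≫ v₁) =
      φ₂.left ≫ α m ≫ H.map (u₁ ≫ v₁) := by
    rw [H.map_comp]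
    simpa only [Category.assoc] using congr($hu₁ ≫ H.map v₁)
  have eq₂ : t₃ ≫ β m ≫ (F.map (u₁ ≫ v₁)).right =
      ρ ≫ φ₂.right ≫ (F.map (u₁ ≫ v₁)).right := by
    rw [hv, F.map_comp, Arrow.comp_right]
    simpa only [Category.assoc] using congr($hu₂ ≫ (F.map v₂).right)
  have hw : φ₂.left ≫ (F.map (u₁ ≫ v₁)).left ≫ (F.obj k).hom =
      a.hom ≫ φ₂.right ≫ (F.map (u₁ ≫ v₁)).right := by
    simpa only [Arrow.comp_left, Arrow.comp_right, Category.assoc] using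
      (φ₂ ≫ F.map (u₁ ≫ v₁)).w
  have := hF k
  obtain ⟨P, C, w, s₁, s₂, q₁, q₂, hw₁, hP, hC, h₁, h₂, h₃, h₄⟩ :=
    exists_presentable_W_of_factorization (X := (F.obj k).left) (Y := (F.obj k).right)
      htopos hcof hS K a.hom (α k) (β k) (hα k)
      (φ₂.left ≫ (F.map (u₁ ≫ v₁)).left) (φ₂.right ≫ (F.map (u₁ ≫ v₁)).right)
      (t₃ ≫ H.map (u₁ ≫ v₁)) (by rw [eq₁, Category.assoc, hα'])
      (by
        rw [Category.assoc, hβ', eq₂, fac, Category.assoc, hw]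
        simp [ρ, pushout.inl_desc_assoc])
      (by
        rw [Category.assoc, hβ', eq₂]
        simp [ρ, pushout.inr_desc_assoc])
  rw [fac] at h₂
  refine ⟨Arrow.mk w, Arrow.homMk s₁ s₂ h₁,
    (Arrow.homMk q₁ q₂ h₂ : Arrow.mk w ⟶ F.obj k) ≫ c.ι.app k, hw₁, hP, hC, ?_⟩
  have h₅ : (Arrow.homMk s₁ s₂ h₁ : a ⟶ Arrow.mk w) ≫
      (Arrow.homMk q₁ q₂ h₂ : Arrow.mk w ⟶ F.obj k) = φ₂ ≫ F.map (u₁ ≫ v₁) := by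
    ext
    · exact h₃
    · exact h₄
  rw [reassoc_of% h₅, c.w, hφ₂]

end

section

variable {C : Type u} [Category.{v} C] {κ : Cardinal.{v}} [Fact κ.IsRegular]

lemma isCardinalFiltered_of_exists_of_fullyFaithful {D : Type*} [Category* D] {E : Type*}
    [Category* E] [CategoryTheory.IsCardinalFiltered E κ] (G : D ⥤ E) [G.Full] [G.Faithful]
    (h : ∀ e, ∃ d, Nonempty (e ⟶ G.obj d)) : CategoryTheory.IsCardinalFiltered D κ where
  nonempty_cocone F hA := by
    let c := CategoryTheory.IsCardinalFiltered.cocone (F ⋙ G) hA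
    obtain ⟨d, ⟨f⟩⟩ := h c.pt
    refine ⟨{ pt := d, ι := { app a := G.preimage (c.ι.app a ≫ f), naturality a b u := ?_ } }⟩
    apply G.map_injective
    have := c.w u
    dsimp at this
    simp [reassoc_of% this]

/-- In a `κ`-accessible category, `X` is a `κ`-filtered colimit of `κ`-presentable objects
satisfying `N` as soon as any map to `X` from a `κ`-presentable object factors through such an
object. -/
lemma exists_colimitOfShape_of_factorization [IsCardinalAccessibleCategory C κ]
    (N : ObjectProperty C) (X : C)
    (hN : ∀ ⦃A : C⦄ [IsCardinalPresentable A κ] (φ : A ⟶ X), ∃ (Z : C) (s : A ⟶ Z) (q : Z ⟶ X),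
      N Z ∧ IsCardinalPresentable Z κ ∧ s ≫ q = φ) :
    ∃ (J : Type v) (_ : SmallCategory J) (_ : CategoryTheory.IsCardinalFiltered J κ),
      Nonempty ((N ⊓ isCardinalPresentable C κ).ColimitOfShape J X) := by
  let N' : ObjectProperty (CostructuredArrow (isCardinalPresentable C κ).ι X) :=
    fun e => N e.left.obj
  have hN' (e : CostructuredArrow (isCardinalPresentable C κ).ι X) :
      ∃ d : N'.FullSubcategory, Nonempty (e ⟶ N'.ι.obj d) := by
    have : IsCardinalPresentable ((isCardinalPresentable C κ).ι.obj e.left) κ := e.left.property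
    obtain ⟨Z, s, q, hZ, hZ', fac⟩ := hN e.hom
    let Z' : (isCardinalPresentable C κ).FullSubcategory := ⟨Z, hZ'⟩
    exact ⟨⟨CostructuredArrow.mk (S := (isCardinalPresentable C κ).ι) (Y := Z') q, hZ⟩,
      ⟨CostructuredArrow.homMk (ObjectProperty.homMk s) fac⟩⟩
  have := isFiltered_of_isCardinalFiltered (CostructuredArrow (isCardinalPresentable C κ).ι X) κ
  have : N'.ι.Final := Functor.final_of_exists_of_isFiltered_of_fullyFaithful _ hN'
  have : CategoryTheory.IsCardinalFiltered N'.FullSubcategory κ :=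
    isCardinalFiltered_of_exists_of_fullyFaithful N'.ι hN'
  have : EssentiallySmall.{v} N'.FullSubcategory :=
    essentiallySmall_of_fully_faithful N'.ι
  let e := equivSmallModel.{v} N'.FullSubcategory
  refine ⟨_, inferInstance, CategoryTheory.IsCardinalFiltered.of_equivalence κ e, ⟨?_⟩⟩
  have hc := (isCardinalPresentable C κ).ι.denseAt X
  have hc' := (Functor.Final.isColimitWhiskerEquiv (F := e.inverse ⋙ N'.ι) _).symm hc
  exact
    { diag := _
      ι := _
      isColimit := hc'
      prop_diag_obj j := ⟨(e.inverse.obj j).property, (e.inverse.obj j).obj.left.property⟩ }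

end

section

variable {M : Type u} [Category.{v} M]

/-- The arrows `⊥ ⟶ G` and `𝟙 G` for `G` satisfying `P`. -/
def arrowGenerators [HasInitial M] (P : ObjectProperty M) : ObjectProperty (Arrow M) :=
  .ofObj (fun G : Subtype P => Arrow.mk (initial.to G.1)) ⊔
    .ofObj (fun G : Subtype P => Arrow.mk (𝟙 G.1))

instance [HasInitial M] (P : ObjectProperty M) [ObjectProperty.Small.{v} P] :
    ObjectProperty.Small.{v} (arrowGenerators P) := by
  unfold arrowGenerators
  infer_instance

lemma arrowGenerators_isStrongGenerator [HasInitial M] {P : ObjectProperty M}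
    (hP : P.IsStrongGenerator) : (arrowGenerators P).IsStrongGenerator := by
  have h₀ {G : M} (hG : P G) : arrowGenerators P (Arrow.mk (initial.to G)) :=
    Or.inl (ObjectProperty.ofObj_apply _ (⟨G, hG⟩ : Subtype P))
  have h₁ {G : M} (hG : P G) : arrowGenerators P (Arrow.mk (𝟙 G)) :=
    Or.inr (ObjectProperty.ofObj_apply _ (⟨G, hG⟩ : Subtype P))
  rw [ObjectProperty.isStrongGenerator_iff] at hP ⊢
  refine ⟨fun x y f g hfg => ?_, fun x y i _ hi => ?_⟩
  · ext
    · refine hP.1 _ _ fun G hG h => ?_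
      exact congr($(hfg _ (h₁ hG) (Arrow.homMk h (h ≫ x.hom) (by simp))).left)
    · refine hP.1 _ _ fun G hG h => ?_
      exact congr($(hfg _ (h₀ hG)
        (Arrow.homMk (initial.to _) h (initialIsInitial.hom_ext _ _))).right)
  · have : Mono i.right := ⟨fun {Z} s t hst => by
      let s' : Arrow.mk (initial.to Z) ⟶ x :=
        Arrow.homMk (initial.to _) s (initialIsInitial.hom_ext _ _)
      let t' : Arrow.mk (initial.to Z) ⟶ x :=
        Arrow.homMk (initial.to _) t (initialIsInitial.hom_ext _ _)
      have : s' = t' := by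
        rw [← cancel_mono i]
        ext
        · exact initialIsInitial.hom_ext _ _
        · exact hst
      exact congr($(this).right)⟩
    have : IsIso i.left := by
      refine hP.2 _ fun G hG h => ?_
      obtain ⟨k, hk⟩ := hi _ (h₁ hG) (Arrow.homMk h (h ≫ y.hom) (by simp))
      exact ⟨k.left, congr($(hk).left)⟩
    have : IsIso i.right := by
      refine hP.2 _ fun G hG h => ?_
      obtain ⟨k, hk⟩ := hi _ (h₀ hG)
        (Arrow.homMk (initial.to _) h (initialIsInitial.hom_ext _ _))
      exact ⟨k.right, congr($(hk).right)⟩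
    exact Arrow.isIso_of_isIso_left_of_isIso_right i

variable {κ : Cardinal.{v}} [Fact κ.IsRegular]

lemma isCardinalPresentable_initial [HasInitial M] : IsCardinalPresentable (⊥_ M) κ := by
  have : ∀ j, IsCardinalPresentable ((Functor.empty.{0} M).obj j) κ := by rintro ⟨⟨⟩⟩
  exact isCardinalPresentable_of_isColimit' _ (colimit.isColimit (Functor.empty.{0} M)) κ
    (hasCardinalLT_of_finite _ κ (Cardinal.IsRegular.aleph0_le Fact.out))

lemma arrowGenerators_le [HasColimits M] {P : ObjectProperty M}
    (hP : P ≤ isCardinalPresentable M κ) :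
    arrowGenerators P ≤ isCardinalPresentable (Arrow M) κ ∧
    arrowGenerators P ≤ (isCardinalPresentable M κ).inverseImage Arrow.leftFunc ∧
    arrowGenerators P ≤ (isCardinalPresentable M κ).inverseImage Arrow.rightFunc := by
  have h : ∀ a : Arrow M, arrowGenerators P a →
      IsCardinalPresentable a.left κ ∧ IsCardinalPresentable a.right κ := by
    rintro _ (⟨⟨G⟩⟩ | ⟨⟨G⟩⟩)
    · exact ⟨isCardinalPresentable_initial, hP _ G.2⟩
    · exact ⟨hP _ G.2, hP _ G.2⟩
  refine ⟨fun a ha => ?_, fun a ha => (h a ha).1, fun a ha => (h a ha).2⟩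
  have := (h a ha).1
  have := (h a ha).2
  exact isCardinalPresentable_arrow a

instance [IsCardinalLocallyPresentable M κ] : IsCardinalLocallyPresentable (Arrow M) κ := by
  obtain ⟨P, _, hP, hP'⟩ :=
    (IsCardinalLocallyPresentable.iff_exists_isStrongGenerator M κ).1 inferInstance
  exact (IsCardinalLocallyPresentable.iff_exists_isStrongGenerator _ κ).2
    ⟨arrowGenerators P, inferInstance, arrowGenerators_isStrongGenerator hP,
      (arrowGenerators_le hP').1⟩

lemma isCardinalPresentable_inverseImage_isClosedUnderColimitsOfShape {D : Type w} [Category.{v} D]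
    (G : D ⥤ M) (J : Type v) [SmallCategory J] [PreservesColimitsOfShape J G]
    (hJ : HasCardinalLT (Arrow J) κ) :
    ((isCardinalPresentable M κ).inverseImage G).IsClosedUnderColimitsOfShape J where
  colimitsOfShape_le := by
    rintro X ⟨p⟩
    have := isClosedUnderColimitsOfShape_isCardinalPresentable.{v} M hJ
    exact (isCardinalPresentable M κ).prop_of_isColimit (isColimitOfPreserves G p.isColimit)
      p.prop_diag_obj

lemma isCardinalPresentable_left_right_of_arrow [IsCardinalLocallyPresentable M κ] (a : Arrow M)
    [ha : IsCardinalPresentable a κ] :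
    IsCardinalPresentable a.left κ ∧ IsCardinalPresentable a.right κ := by
  obtain ⟨P, _, hP, hP'⟩ :=
    (IsCardinalLocallyPresentable.iff_exists_isStrongGenerator M κ).1 inferInstance
  have h : (arrowGenerators P).colimitsCardinalClosure κ a := by
    rw [← IsStrongGenerator.colimitsCardinalClosure_eq_isCardinalPresentable
      (arrowGenerators_isStrongGenerator hP) (arrowGenerators_le hP').1]
    exact ha
  exact ⟨(arrowGenerators P).colimitsCardinalClosure_le κ
      (fun J _ => isCardinalPresentable_inverseImage_isClosedUnderColimitsOfShape Arrow.leftFunc J)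
      (arrowGenerators_le hP').2.1 _ h,
    (arrowGenerators P).colimitsCardinalClosure_le κ
      (fun J _ => isCardinalPresentable_inverseImage_isClosedUnderColimitsOfShape Arrow.rightFunc J)
      (arrowGenerators_le hP').2.2 _ h⟩

end

lemma IsCombinatorial.isStableUnderCobaseChange_cof {M : Type u} [Category.{v} M]
    {S : ModelStructure M} {κ : Cardinal.{v}} (hS : IsCombinatorial S κ) :
    S.Cof.IsStableUnderCobaseChange := by
  obtain ⟨ι, A, B, f, -, -, h⟩ := hS.cofGenerated
  rw [h, llp_rlpOf_eq]
  infer_instance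

/-- Corollary 5.2. Let `M` be a Cisinski model category (a combinatorial
model category whose underlying category is a Grothendieck topos and whose cofibrations are
the monomorphisms). Suppose `M` is `κ`-combinatorial and there is a cylinder functor
`Cyl : M ⥤ M` which preserves `κ`-presentable objects. Then the full subcategory `W` of `M^→`
spanned by the weak equivalences is `κ`-accessible: it is closed under `κ`-filtered colimits
in `M^→` and every weak equivalence is a `κ`-filtered colimit in `M^→` of weak equivalences
between `κ`-presentable objects. -/
theorem statement9 {M : Type u} [Category.{v} M] (κ : Cardinal.{v})
    (htopos : IsGrothendieckTopos M)
    (S : ModelStructure M) (hcof : S.Cof = MorphismProperty.monomorphisms M)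
    (hcomb : IsCombinatorial S κ)
    (Cyl : CylinderFunctor S)
    (hCyl : ∀ X : M, IsPresentable κ X → IsPresentable κ (Cyl.Cyl.obj X)) :
    ClosedUnderFilteredColimits κ {a : Arrow M | S.W a.hom} ∧
    ∀ {X Y : M} (f : X ⟶ Y), S.W f →
      Nonempty (FilteredColimitPresentation (M := Arrow M) κ
        (PresentableArrowsIn κ {a : Arrow M | S.W a.hom}) (Arrow.mk f)) := by
  have : Fact κ.IsRegular := ⟨hcomb.isRegular⟩
  have := hcomb.locallyPresentable.isCardinalLocallyPresentable
  have : HasColimits M := hcomb.locallyPresentable.1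
  have : HasLimits M := htopos.hasLimits
  have : WellPowered.{v} M := wellPowered_of_isCardinalLocallyPresentable M κ
  have : (MorphismProperty.monomorphisms M).IsStableUnderCobaseChange :=
    hcof ▸ hcomb.isStableUnderCobaseChange_cof
  refine ⟨hcomb.closedUnderFilteredColimits, fun {X Y} f hf => ?_⟩
  obtain ⟨J₀, _, _, ⟨p₀⟩⟩ := (isCardinalFilteredGenerator_isCardinalPresentable
    (Arrow M) κ).exists_colimitsOfShape (Arrow.mk f)
  obtain ⟨J, _, _, ⟨p⟩⟩ := exists_colimitOfShape_of_factorization (κ := κ)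
    (fun a : Arrow M => S.W a.hom) (Arrow.mk f) fun A hA φ => by
      have ⟨_, _⟩ := isCardinalPresentable_left_right_of_arrow (κ := κ) A
      have : IsCardinalPresentable (Cyl.cylinderObject A.left).C κ :=
        isPresentable_iff.1 (hCyl _ (isPresentable_iff.2 inferInstance))
      have hF (j) : IsCardinalPresentable (p₀.diag.obj j).left κ :=
        have : IsCardinalPresentable (p₀.diag.obj j) κ := p₀.prop_diag_obj j
        (isCardinalPresentable_left_right_of_arrow _).1
      obtain ⟨w, s, q, hw, _, _, fac⟩ := exists_presentable_W_of_isColimit htopos hcof hcomb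
        p₀.isColimit hF hf (Cyl.cylinderObject A.left) φ
      exact ⟨w, s, q, hw, isCardinalPresentable_arrow w, fac⟩
  refine ⟨⟨J, isCardinalFiltered_iff.2 inferInstance, p.diag, fun j => ?_, _, p.isColimit,
    Iso.refl _⟩⟩
  obtain ⟨hW, h⟩ := p.prop_diag_obj j
  have : IsCardinalPresentable (p.diag.obj j) κ := h
  have ⟨_, _⟩ := isCardinalPresentable_left_right_of_arrow (κ := κ) (p.diag.obj j)
  exact ⟨hW, isPresentable_iff.2 inferInstance, isPresentable_iff.2 inferInstance⟩

end PaperAcc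
end

section
/- Let R be a semi-simple ring and Ch(R) the projective model category of unbounded chain complexes of left R-modules (weak equivalences the quasi-isomorphisms, fibrations the degreewise surjections). Then the full subcategory W_qis of the arrow category Ch(R)^→ spanned by the quasi-isomorphisms is finitely accessible: it is closed under filtered colimits in Ch(R)^→ and every quasi-isomorphism is a filtered colimit in Ch(R)^→ of quasi-isomorphisms between finitely presentable chain complexes. -/
open CategoryTheory CategoryTheory.Limits

universe w v u

namespace CategoryTheory.Arrow

attribute [local instance] Cardinal.fact_isRegular_aleph0

variable {C : Type u} [Category.{v} C]

/-- The functor sending `X` to the arrow `X ⟶ ⊤_ C`. -/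
@[simps]
noncomputable def toTerminal (C : Type u) [Category.{v} C] [HasTerminal C] : C ⥤ Arrow C where
  obj X := Arrow.mk (terminal.from X)
  map f := Arrow.homMk f (𝟙 _) (by simp)

/-- The functor sending `X` to the arrow `⊥_ C ⟶ X`. -/
@[simps]
noncomputable def fromInitial (C : Type u) [Category.{v} C] [HasInitial C] : C ⥤ Arrow C where
  obj X := Arrow.mk (initial.to X)
  map f := Arrow.homMk (𝟙 _) f (by simp)

/-- The functor sending `X` to the arrow `𝟙 X`. -/
@[simps]
def idArrow (C : Type u) [Category.{v} C] : C ⥤ Arrow C where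
  obj X := Arrow.mk (𝟙 X)
  map f := Arrow.homMk f f (by simp)

/-- The domain functor is left adjoint to `toTerminal`. -/
noncomputable def leftFuncAdjunction [HasTerminal C] :
    (leftFunc : Arrow C ⥤ C) ⊣ toTerminal C :=
  Adjunction.mkOfHomEquiv
    { homEquiv := fun a _ ↦
        { toFun := fun f ↦ Arrow.homMk f (terminal.from _)
            (Subsingleton.elim (α := a.left ⟶ ⊤_ C) _ _)
          invFun := fun f ↦ f.left
          left_inv := fun _ ↦ rfl
          right_inv := fun _ ↦ Arrow.hom_ext _ _ rfl
            (Subsingleton.elim (α := a.right ⟶ ⊤_ C) _ _) }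
      homEquiv_naturality_left_symm := fun _ _ ↦ rfl
      homEquiv_naturality_right := fun _ _ ↦ Arrow.hom_ext _ _ rfl
        (Subsingleton.elim (α := _ ⟶ ⊤_ C) _ _) }

/-- The codomain functor is left adjoint to `idArrow`. -/
def rightFuncAdjunction : (rightFunc : Arrow C ⥤ C) ⊣ idArrow C :=
  Adjunction.mkOfHomEquiv
    { homEquiv := fun a X ↦
        { toFun := fun f ↦ Arrow.homMk (a.hom ≫ f) f (Category.comp_id (a.hom ≫ f))
          invFun := fun f ↦ f.right
          left_inv := fun _ ↦ rfl
          right_inv := fun f ↦ Arrow.hom_ext _ _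
            ((Arrow.w f).symm.trans (Category.comp_id (Y := X) f.left)) rfl }
      homEquiv_naturality_left_symm := fun _ _ ↦ rfl
      homEquiv_naturality_right := fun {a _ _} f g ↦ Arrow.hom_ext _ _
        (Category.assoc a.hom f g).symm rfl }

/-- The morphism of arrows from `𝟙 X` determined by its component on the domain. -/
def homOfLeft {X : C} {a : Arrow C} (f : X ⟶ a.left) : (idArrow C).obj X ⟶ a :=
  Arrow.homMk f (f ≫ a.hom) (Category.id_comp (f ≫ a.hom)).symm

/-- The morphism of arrows from `⊥_ C ⟶ X` determined by its component on the codomain. -/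
noncomputable def homOfRight [HasInitial C] {X : C} {a : Arrow C} (f : X ⟶ a.right) :
    (fromInitial C).obj X ⟶ a :=
  Arrow.homMk (initial.to _) f (Subsingleton.elim (α := ⊥_ C ⟶ a.right) _ _)

/-- The functor `idArrow` is left adjoint to the domain functor. -/
def idArrowAdjunction : idArrow C ⊣ (leftFunc : Arrow C ⥤ C) :=
  Adjunction.mkOfHomEquiv
    { homEquiv := fun X _ ↦
        { toFun := fun f ↦ f.left
          invFun := homOfLeft
          left_inv := fun f ↦ Arrow.hom_ext _ _ rfl
            ((Arrow.w f).trans (Category.id_comp (X := X) f.right))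
          right_inv := fun _ ↦ rfl }
      homEquiv_naturality_left_symm := fun {_ _ a} f g ↦ Arrow.hom_ext _ _ rfl
        (Category.assoc f g a.hom)
      homEquiv_naturality_right := fun _ _ ↦ rfl }

/-- The functor `fromInitial` is left adjoint to the codomain functor. -/
noncomputable def fromInitialAdjunction [HasInitial C] :
    fromInitial C ⊣ (rightFunc : Arrow C ⥤ C) :=
  Adjunction.mkOfHomEquiv
    { homEquiv := fun _ a ↦
        { toFun := fun f ↦ f.right
          invFun := homOfRight
          left_inv := fun _ ↦ Arrow.hom_ext _ _
            (Subsingleton.elim (α := ⊥_ C ⟶ a.left) _ _) rfl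
          right_inv := fun _ ↦ rfl }
      homEquiv_naturality_left_symm := fun _ _ ↦ Arrow.hom_ext _ _
        (Subsingleton.elim (α := ⊥_ C ⟶ _) _ _) rfl
      homEquiv_naturality_right := fun _ _ ↦ rfl }

/-- A cocone of arrows is colimiting as soon as both its domain and codomain cocones are. -/
def isColimitOfLeftRight {J : Type*} [Category* J] {F : J ⥤ Arrow C} {c : Cocone F}
    (h₁ : IsColimit (leftFunc.mapCocone c)) (h₂ : IsColimit (rightFunc.mapCocone c)) :
    IsColimit c :=
  Comma.fstSndJointlyReflectColimit h₁ h₂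

lemma preservesColimitsOfShape_idArrow (J : Type*) [Category* J] :
    PreservesColimitsOfShape J (idArrow C) where
  preservesColimit := ⟨fun hc ↦ ⟨isColimitOfLeftRight hc hc⟩⟩

lemma preservesColimitsOfShape_toTerminal [HasTerminal C] (J : Type*) [Category* J]
    [IsConnected J] : PreservesColimitsOfShape J (toTerminal C) where
  preservesColimit {F} := ⟨fun {c} hc ↦ ⟨isColimitOfLeftRight hc
    ((isColimitConstCocone J (⊤_ C)).ofIsoColimit (Cocone.ext (Iso.refl _) (by
      intro j
      exact Subsingleton.elim (α := _ ⟶ ⊤_ C) _ _)))⟩⟩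

section

lemma isFinitelyPresentable_right (a : Arrow C) [IsFinitelyPresentable.{w} a] :
    IsFinitelyPresentable.{w} a.right := by
  have : (idArrow C).IsCardinalAccessible Cardinal.aleph0.{w} :=
    ⟨fun J _ _ ↦ preservesColimitsOfShape_idArrow J⟩
  exact rightFuncAdjunction.isCardinalPresentable_leftAdjoint_obj Cardinal.aleph0.{w} a

lemma isFinitelyPresentable_left [HasTerminal C] (a : Arrow C) [IsFinitelyPresentable.{w} a] :
    IsFinitelyPresentable.{w} a.left := by
  have : (toTerminal C).IsCardinalAccessible Cardinal.aleph0.{w} :=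
    ⟨fun J _ _ ↦ by
      have : IsFiltered J := isFiltered_of_isCardinalFiltered J Cardinal.aleph0.{w}
      have : IsConnected J := IsFiltered.isConnected J
      exact preservesColimitsOfShape_toTerminal J⟩
  exact leftFuncAdjunction.isCardinalPresentable_leftAdjoint_obj Cardinal.aleph0.{w} a

variable [HasColimitsOfSize.{w, w} C]

lemma isFinitelyPresentable_idArrow (X : C) [IsFinitelyPresentable.{w} X] :
    IsFinitelyPresentable.{w} ((idArrow C).obj X) := by
  have : (leftFunc : Arrow C ⥤ C).IsCardinalAccessible Cardinal.aleph0.{w} := ⟨inferInstance⟩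
  exact idArrowAdjunction.isCardinalPresentable_leftAdjoint_obj Cardinal.aleph0.{w} X

lemma isFinitelyPresentable_fromInitial [HasInitial C] (X : C) [IsFinitelyPresentable.{w} X] :
    IsFinitelyPresentable.{w} ((fromInitial C).obj X) := by
  have : (rightFunc : Arrow C ⥤ C).IsCardinalAccessible Cardinal.aleph0.{w} := ⟨inferInstance⟩
  exact fromInitialAdjunction.isCardinalPresentable_leftAdjoint_obj Cardinal.aleph0.{w} X

end

/-- Every arrow `f : X ⟶ Y` is the pushout of `𝟙 X` and `⊥_ C ⟶ Y` along `⊥_ C ⟶ X`. -/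
lemma isPushout_fromInitial [HasInitial C] {X Y : C} (f : X ⟶ Y) :
    IsPushout (C := Arrow C)
      (Arrow.homMk (u := initial.to X) (v := 𝟙 X) (f := Arrow.mk (initial.to X))
        (g := Arrow.mk (𝟙 X)))
      (Arrow.homMk (f := Arrow.mk (initial.to X)) (g := Arrow.mk (initial.to Y)) (𝟙 _) f)
      (Arrow.homMk (f := Arrow.mk (𝟙 X)) (g := Arrow.mk f) (𝟙 X) f)
      (Arrow.homMk (f := Arrow.mk (initial.to Y)) (g := Arrow.mk f) (initial.to X) (𝟙 Y)) := by
  refine ⟨⟨Arrow.hom_ext _ _ (Subsingleton.elim (α := ⊥_ C ⟶ _) _ _)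
    ((Category.id_comp f).trans (Category.comp_id f).symm)⟩,
    ⟨PushoutCocone.IsColimit.mk _
      (fun s ↦ Arrow.homMk (f := Arrow.mk f) s.inl.left s.inr.right ?_) ?_ ?_ ?_⟩⟩
  · have h₁ : 𝟙 X ≫ s.inl.right = f ≫ s.inr.right :=
      congr_arg CommaMorphism.right s.condition
    have h₂ : s.inl.left ≫ s.pt.hom = 𝟙 X ≫ s.inl.right := Arrow.w s.inl
    exact h₂.trans h₁
  · intro s
    have h₁ : 𝟙 X ≫ s.inl.right = f ≫ s.inr.right :=
      congr_arg CommaMorphism.right s.condition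
    exact Arrow.hom_ext _ _ (Category.id_comp _) (h₁.symm.trans (Category.id_comp _))
  · intro s
    exact Arrow.hom_ext _ _ (Subsingleton.elim (α := ⊥_ C ⟶ _) _ _) (Category.id_comp _)
  · intro s m h₁ h₂
    have e₁ : 𝟙 X ≫ m.left = s.inl.left := congr_arg CommaMorphism.left h₁
    have e₂ : 𝟙 Y ≫ m.right = s.inr.right := congr_arg CommaMorphism.right h₂
    exact Arrow.hom_ext _ _ ((Category.id_comp _).symm.trans e₁)
      ((Category.id_comp _).symm.trans e₂)

end CategoryTheory.Arrow

namespace CategoryTheory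

attribute [local instance] Cardinal.fact_isRegular_aleph0

variable {C : Type u} [Category.{v} C]

lemma IsPushout.isFinitelyPresentable {X₁ X₂ X₃ X₄ : C}
    {t : X₁ ⟶ X₂} {l : X₁ ⟶ X₃} {r : X₂ ⟶ X₄} {b : X₃ ⟶ X₄} (sq : IsPushout t l r b)
    [IsFinitelyPresentable.{w} X₁] [IsFinitelyPresentable.{w} X₂] [IsFinitelyPresentable.{w} X₃] :
    IsFinitelyPresentable.{w} X₄ := by
  have (j : WalkingSpan) : IsFinitelyPresentable.{w} ((span t l).obj j) := by
    obtain _ | _ | _ := j <;> dsimp <;> infer_instance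
  exact isCardinalPresentable_of_isColimit' _ sq.isColimit _
    (hasCardinalLT_of_finite _ _ le_rfl)

lemma isFinitelyPresentable_biprod [HasZeroMorphisms C] (X Y : C) [HasBinaryBiproduct X Y]
    [IsFinitelyPresentable.{w} X] [IsFinitelyPresentable.{w} Y] :
    IsFinitelyPresentable.{w} (X ⊞ Y) := by
  have (j : Discrete WalkingPair) : IsFinitelyPresentable.{w} ((pair X Y).obj j) := by
    obtain ⟨_ | _⟩ := j <;> dsimp <;> infer_instance
  exact isCardinalPresentable_of_isColimit' _ (BinaryBiproduct.isColimit X Y) _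
    (hasCardinalLT_of_finite _ _ le_rfl)

lemma Arrow.isFinitelyPresentable_mk [HasColimitsOfSize.{w, w} C] [HasInitial C]
    {X Y : C} (f : X ⟶ Y) [IsFinitelyPresentable.{w} X] [IsFinitelyPresentable.{w} Y] :
    IsFinitelyPresentable.{w} (Arrow.mk f) := by
  have : IsFinitelyPresentable.{w} (Arrow.mk (initial.to X)) := isFinitelyPresentable_fromInitial X
  have : IsFinitelyPresentable.{w} (Arrow.mk (initial.to Y)) := isFinitelyPresentable_fromInitial Y
  have : IsFinitelyPresentable.{w} (Arrow.mk (𝟙 X)) := isFinitelyPresentable_idArrow X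
  exact (isPushout_fromInitial f).isFinitelyPresentable

lemma Arrow.isStrongGenerator_ofObj [HasInitial C] {ι : Type*} {G : ι → C}
    (hG : (ObjectProperty.ofObj G).IsStrongGenerator) :
    (ObjectProperty.ofObj (Sum.elim (fun i ↦ (idArrow C).obj (G i))
      (fun i ↦ (fromInitial C).obj (G i)))).IsStrongGenerator := by
  rw [ObjectProperty.isStrongGenerator_iff] at hG ⊢
  obtain ⟨h₁, h₂⟩ := hG
  constructor
  · intro a b f g hfg
    refine Arrow.hom_ext _ _ (h₁ _ _ ?_) (h₁ _ _ ?_)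
    · rintro _ ⟨i⟩ h
      exact congr_arg CommaMorphism.left (hfg _ (ObjectProperty.ofObj_apply _ (Sum.inl i))
        (homOfLeft h))
    · rintro _ ⟨i⟩ h
      exact congr_arg CommaMorphism.right (hfg _ (ObjectProperty.ofObj_apply _ (Sum.inr i))
        (homOfRight h))
  · intro a b f _ hf
    have : (leftFunc : Arrow C ⥤ C).PreservesMonomorphisms :=
      Functor.preservesMonomorphisms_of_adjunction idArrowAdjunction
    have : (rightFunc : Arrow C ⥤ C).PreservesMonomorphisms :=
      Functor.preservesMonomorphisms_of_adjunction fromInitialAdjunction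
    have : Mono f.left := inferInstanceAs (Mono (leftFunc.map f))
    have : Mono f.right := inferInstanceAs (Mono (rightFunc.map f))
    have : IsIso f.left := h₂ _ (by
      rintro _ ⟨i⟩ h
      obtain ⟨g, hg⟩ := hf _ (ObjectProperty.ofObj_apply _ (Sum.inl i))
        (homOfLeft h)
      exact ⟨g.left, congr_arg CommaMorphism.left hg⟩)
    have : IsIso f.right := h₂ _ (by
      rintro _ ⟨i⟩ h
      obtain ⟨g, hg⟩ := hf _ (ObjectProperty.ofObj_apply _ (Sum.inr i))
        (homOfRight h)
      exact ⟨g.right, congr_arg CommaMorphism.right hg⟩)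
    exact Arrow.isIso_of_isIso_left_of_isIso_right f

lemma Arrow.isFinitelyAccessibleCategory [HasColimitsOfSize.{w, w} C] [LocallySmall.{w} C]
    [HasInitial C] {ι : Type*} [Small.{w} ι] {G : ι → C}
    (hG : (ObjectProperty.ofObj G).IsStrongGenerator)
    [∀ i, IsFinitelyPresentable.{w} (G i)] :
    IsFinitelyAccessibleCategory.{w} (Arrow C) := by
  have : HasColimitsOfSize.{w, w} (Arrow C) := ⟨fun _ _ ↦ inferInstance⟩
  have : LocallySmall.{w} (Arrow C) := ⟨fun a b ↦ small_of_injective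
    (f := fun (f : a ⟶ b) ↦ (⟨f.left, f.right⟩ : (a.left ⟶ b.left) × (a.right ⟶ b.right)))
    (fun f g h ↦ Arrow.hom_ext _ _ (Prod.ext_iff.1 h).1 (Prod.ext_iff.1 h).2)⟩
  have : IsCardinalLocallyPresentable (Arrow C) Cardinal.aleph0.{w} := by
    rw [IsCardinalLocallyPresentable.iff_exists_isStrongGenerator]
    refine ⟨_, inferInstance, Arrow.isStrongGenerator_ofObj hG, ?_⟩
    rintro _ ⟨i | i⟩
    · exact isFinitelyPresentable_idArrow (G i)
    · exact isFinitelyPresentable_fromInitial (G i)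
  infer_instance

end CategoryTheory

namespace ModuleCat

attribute [local instance] Cardinal.fact_isRegular_aleph0

variable (R : Type u) [Ring R]

/-- The forgetful functor on modules is corepresented by the ring. -/
def coyonedaIsoForget : coyoneda.obj (Opposite.op (ModuleCat.of R R)) ≅ forget (ModuleCat.{u} R) :=
  NatIso.ofComponents (fun M ↦ Equiv.toIso
    { toFun := fun f ↦ f.hom (1 : R)
      invFun := fun x ↦ ModuleCat.ofHom (LinearMap.toSpanSingleton R M x)
      left_inv := fun f ↦ by
        apply ModuleCat.hom_ext
        apply LinearMap.ext_ring
        exact LinearMap.toSpanSingleton_apply_one _ _ _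
      right_inv := fun x ↦ LinearMap.toSpanSingleton_apply_one _ _ _ })
    (fun f ↦ rfl)

instance isFinitelyPresentable_self : IsFinitelyPresentable.{u} (ModuleCat.of R R) := by
  rw [isFinitelyPresentable_iff_preservesFilteredColimits]
  exact ⟨fun J _ _ ↦ preservesColimitsOfShape_of_natIso (coyonedaIsoForget R).symm⟩

end ModuleCat

namespace HomologicalComplex

attribute [local instance] Cardinal.fact_isRegular_aleph0

variable (R : Type u) [Ring R]

lemma isFinitelyPresentable_evalCompCoyonedaCorepresentative
    {C : Type u} [Category.{v} C] [HasZeroMorphisms C] [HasZeroObject C]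
    [HasColimitsOfSize.{w, w} C] {ι : Type} (c : ComplexShape ι) [c.HasNoLoop]
    (X : C) [IsFinitelyPresentable.{w} X] (j : ι) :
    IsFinitelyPresentable.{w} (evalCompCoyonedaCorepresentative c X j) := by
  have : (coyoneda.obj (Opposite.op X)).IsCardinalAccessible Cardinal.aleph0.{w} :=
    inferInstanceAs (IsFinitelyPresentable.{w} X)
  have : (eval C c j).IsCardinalAccessible Cardinal.aleph0.{w} := ⟨inferInstance⟩
  exact Functor.isCardinalAccessible_of_natIso
    (evalCompCoyonedaCorepresentable c X j).toIso.symm _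

lemma isStrongGenerator_evalCompCoyonedaCorepresentative {ι : Type} (c : ComplexShape ι)
    [c.HasNoLoop] :
    (ObjectProperty.ofObj (fun n : ι ↦
      evalCompCoyonedaCorepresentative c (ModuleCat.of R R) n)).IsStrongGenerator := by
  have key (n : ι) : ∃ e : ∀ K : HomologicalComplex (ModuleCat.{u} R) c,
      (evalCompCoyonedaCorepresentative c (ModuleCat.of R R) n ⟶ K) → K.X n,
      (∀ K, Function.Surjective (e K)) ∧ ∀ K L h (f : K ⟶ L), e L (h ≫ f) = f.f n (e K h) := by
    let r := evalCompCoyonedaCorepresentable c (ModuleCat.of R R) n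
    refine ⟨fun K h ↦
      ModuleCat.Hom.hom (show ModuleCat.of R R ⟶ K.X n from r.homEquiv h) (1 : R), fun K x ↦ ?_,
      fun K L h f ↦ ?_⟩
    · let φ : ModuleCat.of R R ⟶ K.X n := ModuleCat.ofHom (LinearMap.toSpanSingleton R _ x)
      refine ⟨r.homEquiv.symm φ, ?_⟩
      have h₁ : r.homEquiv (r.homEquiv.symm φ) = φ := r.homEquiv.apply_symm_apply φ
      exact (congr_arg (fun (ψ : ModuleCat.of R R ⟶ K.X n) ↦ ψ.hom (1 : R)) h₁).trans
        (LinearMap.toSpanSingleton_apply_one _ _ _)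
    · exact congr_arg (fun (ψ : ModuleCat.of R R ⟶ L.X n) ↦ ψ.hom (1 : R)) (r.homEquiv_comp f h)
  rw [ObjectProperty.isStrongGenerator_iff]
  refine ⟨fun K L f g h ↦ ?_, fun K L f _ h ↦ ?_⟩
  · ext n x
    obtain ⟨e, he, he'⟩ := key n
    obtain ⟨p, rfl⟩ := he K x
    exact (he' _ _ p f).symm.trans ((congr_arg (e L)
      (h _ (ObjectProperty.ofObj_apply _ n) p)).trans (he' _ _ p g))
  · have (n : ι) : IsIso (f.f n) := by
      have : Mono (f.f n) := inferInstanceAs (Mono ((eval _ _ n).map f))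
      have : Epi (f.f n) := by
        rw [ModuleCat.epi_iff_surjective]
        intro y
        obtain ⟨e, he, he'⟩ := key n
        obtain ⟨p, rfl⟩ := he L y
        obtain ⟨q, rfl⟩ := h _ (ObjectProperty.ofObj_apply _ n) p
        exact ⟨e K q, (he' _ _ q f).symm⟩
      exact isIso_of_mono_of_epi _
    exact Hom.isIso_of_components f

lemma isFinitelyAccessibleCategory_arrow {ι : Type} (c : ComplexShape ι) [c.HasNoLoop] :
    IsFinitelyAccessibleCategory.{u} (Arrow (HomologicalComplex (ModuleCat.{u} R) c)) := by
  have (i : ι) := isFinitelyPresentable_evalCompCoyonedaCorepresentative.{u} c (ModuleCat.of R R) i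
  exact Arrow.isFinitelyAccessibleCategory (isStrongGenerator_evalCompCoyonedaCorepresentative R c)

end HomologicalComplex

namespace ModuleCat

variable {R : Type u} [Ring R]

/-- The morphism from the ring determined by an element. -/
def homOfElement {M : ModuleCat.{u} R} (x : M) : ModuleCat.of R R ⟶ M :=
  ModuleCat.ofHom (LinearMap.toSpanSingleton R M x)

@[simp]
lemma homOfElement_one {M : ModuleCat.{u} R} (x : M) : homOfElement x (1 : R) = x :=
  LinearMap.toSpanSingleton_apply_one R M x

lemma homOfElement_comp {M N : ModuleCat.{u} R} (x : M) (f : M ⟶ N) :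
    homOfElement x ≫ f = homOfElement (f x) := by
  apply ModuleCat.hom_ext
  apply LinearMap.ext_ring
  exact (congr_arg f (homOfElement_one x)).trans (homOfElement_one (f x)).symm

lemma homOfElement_zero (M : ModuleCat.{u} R) : homOfElement (0 : M) = 0 := by
  apply ModuleCat.hom_ext
  apply LinearMap.ext_ring
  exact homOfElement_one 0

/-- The canonical cover of a module by a free module. -/
noncomputable def finsuppCover (M : ModuleCat.{u} R) : ModuleCat.of R (M →₀ R) ⟶ M :=
  ModuleCat.ofHom (Finsupp.linearCombination R id)

instance (M : ModuleCat.{u} R) : Epi (finsuppCover M) := by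
  rw [ModuleCat.epi_iff_surjective]
  exact Finsupp.linearCombination_id_surjective R M

/-- The morphism from a free module determined by the images of the basis vectors. -/
noncomputable def finsuppDesc {ι : Type u} {M : ModuleCat.{u} R} (s : ι → M) :
    ModuleCat.of R (ι →₀ R) ⟶ M :=
  ModuleCat.ofHom (Finsupp.linearCombination R s)

lemma finsuppDesc_single {ι : Type u} {M : ModuleCat.{u} R} (s : ι → M) (i : ι) :
    finsuppDesc s (Finsupp.single i (1 : R)) = s i := by
  simp [finsuppDesc]

lemma finsupp_hom_ext {ι : Type u} {M : ModuleCat.{u} R} {f g : ModuleCat.of R (ι →₀ R) ⟶ M}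
    (h : ∀ i, f (Finsupp.single i (1 : R)) = g (Finsupp.single i (1 : R))) : f = g := by
  apply ModuleCat.hom_ext
  apply Finsupp.lhom_ext'
  intro i
  apply LinearMap.ext_ring
  exact h i

lemma finsuppCover_single {M : ModuleCat.{u} R} (m : M) :
    finsuppCover M (Finsupp.single m (1 : R)) = m := by
  simp [finsuppCover]

end ModuleCat

namespace ChainComplex

variable {R : Type u} [Ring R] {K L : ChainComplex (ModuleCat.{u} R) ℤ}

open HomologicalComplex ModuleCat

lemma mono_homologyMap_iff_elements (f : K ⟶ L) (n : ℤ) :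
    Mono (homologyMap f n) ↔ ∀ x : K.X n, K.d n (n - 1) x = 0 →
      ∀ y : L.X (n + 1), f.f n x = L.d (n + 1) n y → ∃ z, x = K.d (n + 1) n z := by
  rw [mono_homologyMap_iff_up_to_refinements f (n + 1) n (n - 1) (by simp) (by simp)]
  constructor
  · intro h x hx y hy
    obtain ⟨A', π, _, x₁, hx₁⟩ := h (homOfElement x)
      (by rw [homOfElement_comp, hx, homOfElement_zero])
      (homOfElement y) (by rw [homOfElement_comp, homOfElement_comp, hy])
    obtain ⟨a, ha⟩ := (ModuleCat.epi_iff_surjective π).1 inferInstance (1 : R)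
    refine ⟨x₁ a, ?_⟩
    have := ConcreteCategory.congr_hom hx₁ a
    rw [ConcreteCategory.comp_apply, ConcreteCategory.comp_apply, ha, homOfElement_one] at this
    exact this
  · intro h A x hx y hy
    have (a : A) : ∃ z, x a = K.d (n + 1) n z :=
      h (x a) (ConcreteCategory.congr_hom hx a) (y a) (ConcreteCategory.congr_hom hy a)
    choose s hs using this
    refine ⟨_, finsuppCover A, inferInstance, finsuppDesc s, finsupp_hom_ext fun a ↦ ?_⟩
    rw [ConcreteCategory.comp_apply, ConcreteCategory.comp_apply, finsuppCover_single,
      finsuppDesc_single, hs]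

lemma epi_homologyMap_iff_elements (f : K ⟶ L) (n : ℤ) :
    Epi (homologyMap f n) ↔ ∀ y : L.X n, L.d n (n - 1) y = 0 →
      ∃ x, K.d n (n - 1) x = 0 ∧ ∃ z, y = f.f n x + L.d (n + 1) n z := by
  rw [epi_homologyMap_iff_up_to_refinements f (n + 1) n (n - 1) (by simp) (by simp)]
  constructor
  · intro h y hy
    obtain ⟨A', π, _, x, hx, z, hz⟩ := h (homOfElement y)
      (by rw [homOfElement_comp, hy, homOfElement_zero])
    obtain ⟨a, ha⟩ := (ModuleCat.epi_iff_surjective π).1 inferInstance (1 : R)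
    refine ⟨x a, ConcreteCategory.congr_hom hx a, z a, ?_⟩
    have := ConcreteCategory.congr_hom hz a
    rw [ConcreteCategory.comp_apply, ha, homOfElement_one] at this
    exact this
  · intro h A y hy
    have (a : A) := h (y a) (ConcreteCategory.congr_hom hy a)
    choose s hs t ht using this
    refine ⟨_, finsuppCover A, inferInstance, finsuppDesc s, finsupp_hom_ext fun a ↦ ?_,
      finsuppDesc t,
      finsupp_hom_ext fun a ↦ ?_⟩
    · rw [ConcreteCategory.comp_apply, finsuppDesc_single, hs]
      rfl
    · rw [ConcreteCategory.comp_apply, finsuppCover_single, ht]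
      exact (congr_arg₂ (fun p q ↦ f.f n p + L.d (n + 1) n q) (finsuppDesc_single s a)
        (finsuppDesc_single t a)).symm

lemma quasiIso_iff_elements (f : K ⟶ L) :
    QuasiIso f ↔ ∀ n : ℤ,
      (∀ x : K.X n, K.d n (n - 1) x = 0 →
        ∀ y : L.X (n + 1), f.f n x = L.d (n + 1) n y → ∃ z, x = K.d (n + 1) n z) ∧
      (∀ y : L.X n, L.d n (n - 1) y = 0 →
        ∃ x, K.d n (n - 1) x = 0 ∧ ∃ z, y = f.f n x + L.d (n + 1) n z) := by
  simp_rw [← mono_homologyMap_iff_elements, ← epi_homologyMap_iff_elements]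
  rw [quasiIso_iff]
  refine forall_congr' fun n ↦ ?_
  rw [quasiIsoAt_iff_isIso_homologyMap]
  exact ⟨fun _ ↦ ⟨inferInstance, inferInstance⟩, fun ⟨_, _⟩ ↦ isIso_of_mono_of_epi _⟩

end ChainComplex

namespace ChainComplex

variable {R : Type u} [Ring R]

open HomologicalComplex ModuleCat

lemma hom_d_apply {K L : ChainComplex (ModuleCat.{u} R) ℤ} (f : K ⟶ L) (i j : ℤ) (x : K.X i) :
    L.d i j (f.f i x) = f.f j (K.d i j x) :=
  ConcreteCategory.congr_hom (f.comm i j) x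

lemma hom_comp_apply {K L M : ChainComplex (ModuleCat.{u} R) ℤ} (f : K ⟶ L) (g : L ⟶ M) (i : ℤ)
    (x : K.X i) : (f ≫ g).f i x = g.f i (f.f i x) :=
  rfl

section

variable {J : Type u} [SmallCategory J] [IsFiltered J]

lemma exists_rep_of_isColimit {F : J ⥤ ChainComplex (ModuleCat.{u} R) ℤ} {c : Cocone F}
    (hc : IsColimit c) (n : ℤ) (j₀ : J) (x : c.pt.X n) :
    ∃ (j : J) (_ : j₀ ⟶ j) (y : (F.obj j).X n), (c.ι.app j).f n y = x := by
  obtain ⟨j, y, hy⟩ : ∃ (j : J) (y : (F.obj j).X n), (c.ι.app j).f n y = x :=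
    Concrete.isColimit_exists_rep (F ⋙ eval _ _ n) (isColimitOfPreserves (eval _ _ n) hc) x
  refine ⟨IsFiltered.max j₀ j, IsFiltered.leftToMax _ _,
    (F.map (IsFiltered.rightToMax j₀ j)).f n y, ?_⟩
  rw [← hom_comp_apply, c.w, hy]

lemma exists_of_rep_eq_of_isColimit {F : J ⥤ ChainComplex (ModuleCat.{u} R) ℤ} {c : Cocone F}
    (hc : IsColimit c) (n : ℤ) {j : J} (x y : (F.obj j).X n)
    (h : (c.ι.app j).f n x = (c.ι.app j).f n y) :
    ∃ (k : J) (g : j ⟶ k), (F.map g).f n x = (F.map g).f n y := by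
  obtain ⟨k, f, g, h⟩ : ∃ (k : J) (f g : j ⟶ k), (F.map f).f n x = (F.map g).f n y :=
    Concrete.isColimit_exists_of_rep_eq (F ⋙ eval _ _ n)
      (isColimitOfPreserves (eval _ _ n) hc) x y h
  refine ⟨IsFiltered.coeq f g, f ≫ IsFiltered.coeqHom f g, ?_⟩
  have h' := congr_arg ((F.map (IsFiltered.coeqHom f g)).f n) h
  rw [← hom_comp_apply, ← hom_comp_apply, ← F.map_comp, ← F.map_comp,
    ← IsFiltered.coeq_condition f g] at h'
  exact h'

end

lemma quasiIso_of_isColimit {J : Type u} [SmallCategory J] [IsFiltered J]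
    {F : J ⥤ Arrow (ChainComplex (ModuleCat.{u} R) ℤ)} {c : Cocone F} (hc : IsColimit c)
    (hF : ∀ j, QuasiIso (F.obj j).hom) : QuasiIso c.pt.hom := by
  have repl (n : ℤ) (j₀ : J) (x : c.pt.left.X n) : ∃ (j : J) (_ : j₀ ⟶ j)
      (y : (F.obj j).left.X n), (c.ι.app j).left.f n y = x :=
    exists_rep_of_isColimit (isColimitOfPreserves Arrow.leftFunc hc) n j₀ x
  have repr (n : ℤ) (j₀ : J) (x : c.pt.right.X n) : ∃ (j : J) (_ : j₀ ⟶ j)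
      (y : (F.obj j).right.X n), (c.ι.app j).right.f n y = x :=
    exists_rep_of_isColimit (isColimitOfPreserves Arrow.rightFunc hc) n j₀ x
  have eql (n : ℤ) {j : J} (x y : (F.obj j).left.X n)
      (h : (c.ι.app j).left.f n x = (c.ι.app j).left.f n y) :
      ∃ (k : J) (g : j ⟶ k), (F.map g).left.f n x = (F.map g).left.f n y :=
    exists_of_rep_eq_of_isColimit (isColimitOfPreserves Arrow.leftFunc hc) n x y h
  have eqr (n : ℤ) {j : J} (x y : (F.obj j).right.X n)
      (h : (c.ι.app j).right.f n x = (c.ι.app j).right.f n y) :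
      ∃ (k : J) (g : j ⟶ k), (F.map g).right.f n x = (F.map g).right.f n y :=
    exists_of_rep_eq_of_isColimit (isColimitOfPreserves Arrow.rightFunc hc) n x y h
  have wl {j k : J} (g : j ⟶ k) (n : ℤ) (x : (F.obj j).left.X n) :
      (c.ι.app k).left.f n ((F.map g).left.f n x) = (c.ι.app j).left.f n x :=
    congr_arg (fun (a : F.obj j ⟶ c.pt) ↦ a.left.f n x) (c.w g)
  have wr {j k : J} (g : j ⟶ k) (n : ℤ) (x : (F.obj j).right.X n) :
      (c.ι.app k).right.f n ((F.map g).right.f n x) = (c.ι.app j).right.f n x :=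
    congr_arg (fun (a : F.obj j ⟶ c.pt) ↦ a.right.f n x) (c.w g)
  have sq {a b : Arrow (ChainComplex (ModuleCat.{u} R) ℤ)} (g : a ⟶ b) (n : ℤ) (x : a.left.X n) :
      b.hom.f n (g.left.f n x) = g.right.f n (a.hom.f n x) :=
    congr_arg (fun (p : a.left ⟶ b.right) ↦ p.f n x) (Arrow.w g)
  rw [quasiIso_iff_elements]
  refine fun n ↦ ⟨fun x hx y hy ↦ ?_, fun y hy ↦ ?_⟩
  · obtain ⟨j₀, _, x, rfl⟩ := repl n IsFiltered.nonempty.some x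
    obtain ⟨j, p, y, rfl⟩ := repr (n + 1) j₀ y
    rw [← wl p] at hx hy ⊢
    generalize (F.map p).left.f n x = x at hx hy ⊢
    rw [hom_d_apply, ← map_zero ((c.ι.app j).left.f (n - 1)).hom] at hx
    obtain ⟨k, p, hx⟩ := eql _ _ _ hx
    rw [sq, hom_d_apply] at hy
    rw [← wr p, ← wr p] at hy
    obtain ⟨l, q, hy⟩ := eqr _ _ _ hy
    rw [← hom_d_apply, map_zero] at hx
    obtain ⟨z, hz⟩ := (((quasiIso_iff_elements _).1 (hF l)) n).1
      ((F.map q).left.f n ((F.map p).left.f n x)) (by rw [hom_d_apply, hx, map_zero])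
      ((F.map q).right.f _ ((F.map p).right.f _ y)) (by
        rw [sq, sq, hom_d_apply, hom_d_apply, hy])
    exact ⟨(c.ι.app l).left.f _ z, by rw [hom_d_apply, ← hz, wl, wl]⟩
  · obtain ⟨j, _, y, rfl⟩ := repr n IsFiltered.nonempty.some y
    rw [hom_d_apply, ← map_zero ((c.ι.app j).right.f (n - 1)).hom] at hy
    obtain ⟨k, p, hy⟩ := eqr _ _ _ hy
    rw [← hom_d_apply, map_zero] at hy
    obtain ⟨x, hx, z, hz⟩ := (((quasiIso_iff_elements _).1 (hF k)) n).2 _ hy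
    refine ⟨(c.ι.app k).left.f _ x, by rw [hom_d_apply, hx, map_zero],
      (c.ι.app k).right.f _ z, ?_⟩
    rw [hom_d_apply, sq, ← map_add, ← hz, wr]

end ChainComplex

namespace ModuleCat

variable {R : Type u} [Ring R] [IsSemisimpleRing R]

lemma exists_comp_comp_eq {M N : ModuleCat.{u} R} (φ : M ⟶ N) :
    ∃ ψ : N ⟶ M, φ ≫ ψ ≫ φ = φ := by
  obtain ⟨s, hs⟩ := IsSemisimpleModule.lifting_property φ.hom.rangeRestrict
    φ.hom.surjective_rangeRestrict LinearMap.id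
  obtain ⟨e, he⟩ := IsSemisimpleModule.extension_property φ.hom.range.subtype
    φ.hom.range.injective_subtype LinearMap.id
  refine ⟨ModuleCat.ofHom (s ∘ₗ e), ?_⟩
  ext x
  have h₁ : e (φ x) = φ.hom.rangeRestrict x :=
    LinearMap.congr_fun he (φ.hom.rangeRestrict x)
  have h₂ := congr_arg Subtype.val (LinearMap.congr_fun hs (φ.hom.rangeRestrict x))
  change φ (s (e (φ x))) = φ x
  rw [h₁]
  exact h₂

lemma exists_comp_comp_eq_and {M N : ModuleCat.{u} R} (φ : M ⟶ N) :
    ∃ ψ : N ⟶ M, φ ≫ ψ ≫ φ = φ ∧ ψ ≫ φ ≫ ψ = ψ := by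
  obtain ⟨ψ, h⟩ := exists_comp_comp_eq φ
  have h' {Z} (k : N ⟶ Z) : φ ≫ ψ ≫ φ ≫ k = φ ≫ k := by
    simpa using h =≫ k
  exact ⟨ψ ≫ φ ≫ ψ, by simp [h], by simp [h']⟩

end ModuleCat

namespace ChainComplex

open HomologicalComplex

variable {R : Type u} [Ring R]

/-- A morphism of complexes is null-homotopic if it is of the form `d ≫ h + h ≫ d`. -/
def IsNullHomotopic {C : Type u} [Category.{v} C] [Preadditive C] {X Y : ChainComplex C ℤ}
    (p : X ⟶ Y) : Prop :=
  ∃ h : ∀ i j, X.X i ⟶ Y.X j, ∀ i,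
    p.f i = X.d i (i - 1) ≫ h (i - 1) i + h i (i + 1) ≫ Y.d (i + 1) i

/-- A morphism of complexes sends cycles to boundaries if it vanishes in homology. -/
def CyclesToBoundaries {X Y : ChainComplex (ModuleCat.{u} R) ℤ} (p : X ⟶ Y) : Prop :=
  ∀ (i : ℤ) (x : X.X i), X.d i (i - 1) x = 0 → ∃ y, p.f i x = Y.d (i + 1) i y

variable [IsSemisimpleRing R]

/-- A generalized inverse of a differential. -/
noncomputable def dInv (X : ChainComplex (ModuleCat.{u} R) ℤ) (i j : ℤ) : X.X j ⟶ X.X i :=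
  (ModuleCat.exists_comp_comp_eq (X.d i j)).choose

lemma d_dInv_d (X : ChainComplex (ModuleCat.{u} R) ℤ) (i j : ℤ) :
    X.d i j ≫ X.dInv i j ≫ X.d i j = X.d i j :=
  (ModuleCat.exists_comp_comp_eq (X.d i j)).choose_spec

/-- The endomorphism `𝟙 - d ≫ h - h ≫ d` of the components of a complex, where `h` is a
generalized inverse of the differential. -/
noncomputable def harmonic (X : ChainComplex (ModuleCat.{u} R) ℤ) (i : ℤ) : X.X i ⟶ X.X i :=
  𝟙 _ - X.d i (i - 1) ≫ X.dInv i (i - 1) - X.dInv (i + 1) i ≫ X.d (i + 1) i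

lemma d_harmonic (X : ChainComplex (ModuleCat.{u} R) ℤ) (i j : ℤ) :
    X.d i j ≫ X.harmonic j = 0 := by
  by_cases h : j + 1 = i
  · subst h
    simp [harmonic, d_dInv_d]
  · rw [X.shape _ _ h, zero_comp]

lemma harmonic_d (X : ChainComplex (ModuleCat.{u} R) ℤ) (i j : ℤ) :
    X.harmonic i ≫ X.d i j = 0 := by
  by_cases h : j + 1 = i
  · obtain rfl : j = i - 1 := by lia
    simp [harmonic, d_dInv_d]
  · rw [X.shape _ _ h, comp_zero]

lemma id_eq_harmonic_add (X : ChainComplex (ModuleCat.{u} R) ℤ) (i : ℤ) :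
    𝟙 (X.X i) = X.harmonic i + X.d i (i - 1) ≫ X.dInv i (i - 1) +
      X.dInv (i + 1) i ≫ X.d (i + 1) i := by
  rw [harmonic]
  abel

lemma exists_sub_harmonic_eq_d (X : ChainComplex (ModuleCat.{u} R) ℤ) (i : ℤ) (x : X.X i)
    (hx : X.d i (i - 1) x = 0) : ∃ y, x = X.harmonic i x + X.d (i + 1) i y := by
  refine ⟨X.dInv (i + 1) i x, ?_⟩
  have h : x = X.harmonic i x + X.dInv i (i - 1) (X.d i (i - 1) x) +
      X.d (i + 1) i (X.dInv (i + 1) i x) :=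
    ConcreteCategory.congr_hom (X.id_eq_harmonic_add i) x
  rw [hx, map_zero, add_zero] at h
  exact h

lemma CyclesToBoundaries.isNullHomotopic {X Y : ChainComplex (ModuleCat.{u} R) ℤ} {p : X ⟶ Y}
    (hp : CyclesToBoundaries p) : IsNullHomotopic p := by
  have h₀ (i : ℤ) : X.harmonic i ≫ p.f i ≫ Y.harmonic i = 0 := by
    ext x
    obtain ⟨y, hy⟩ := hp i (X.harmonic i x) (ConcreteCategory.congr_hom (X.harmonic_d i (i - 1)) x)
    exact (congr_arg (Y.harmonic i) hy).trans
      (ConcreteCategory.congr_hom (Y.d_harmonic (i + 1) i) y)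
  have h₁ (i : ℤ) : X.harmonic i ≫ p.f i =
      X.harmonic i ≫ p.f i ≫ Y.dInv (i + 1) i ≫ Y.d (i + 1) i := by
    conv_lhs => rw [← Category.comp_id (p.f i), Y.id_eq_harmonic_add i]
    simp only [Preadditive.comp_add, h₀, zero_add]
    rw [p.comm_assoc, reassoc_of% (X.harmonic_d i (i - 1)), zero_comp, zero_add]
  refine ⟨fun i j ↦ X.dInv j i ≫ p.f j + X.harmonic i ≫ p.f i ≫ Y.dInv j i, fun i ↦ ?_⟩
  conv_lhs => rw [← Category.id_comp (p.f i), X.id_eq_harmonic_add i]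
  simp only [Preadditive.comp_add, Preadditive.add_comp, Category.assoc,
    reassoc_of% (X.d_harmonic i (i - 1)), zero_comp, add_zero, p.comm]
  rw [h₁]
  abel

lemma exists_quasiInverse {X Y : ChainComplex (ModuleCat.{u} R) ℤ} (f : X ⟶ Y) [QuasiIso f] :
    ∃ g : Y ⟶ X, g ≫ f ≫ g = g ∧ CyclesToBoundaries (𝟙 X - f ≫ g) ∧
      CyclesToBoundaries (𝟙 Y - g ≫ f) := by
  have hf := (quasiIso_iff_elements f).1 inferInstance
  choose ψ hψ hψ' using fun i ↦
    ModuleCat.exists_comp_comp_eq_and (X.harmonic i ≫ f.f i ≫ Y.harmonic i)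
  let g : Y ⟶ X :=
    { f := fun i ↦ Y.harmonic i ≫ ψ i ≫ X.harmonic i
      comm' := fun i j _ ↦ by
        simp [harmonic_d, reassoc_of% (Y.d_harmonic i j)] }
  have hg (i : ℤ) : g.f i = Y.harmonic i ≫ ψ i ≫ X.harmonic i := rfl
  have hk : CyclesToBoundaries (𝟙 X - f ≫ g) := by
    intro i x hx
    have hk' : X.d i (i - 1) ((𝟙 X - f ≫ g).f i x) = 0 := by
      rw [hom_d_apply, hx, map_zero]
    have e₁ : Y.harmonic i (f.f i x) = Y.harmonic i (f.f i (X.harmonic i x)) := by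
      obtain ⟨b, hb⟩ := X.exists_sub_harmonic_eq_d i x hx
      conv_lhs => rw [hb]
      rw [map_add, map_add, ← hom_d_apply]
      exact (congr_arg _ (ConcreteCategory.congr_hom (Y.d_harmonic (i + 1) i) _)).trans
        (add_zero _)
    have e₂ : Y.harmonic i (f.f i (g.f i (f.f i x))) = Y.harmonic i (f.f i x) := by
      have := ConcreteCategory.congr_hom (hψ i) x
      change Y.harmonic i (f.f i (X.harmonic i (ψ i (Y.harmonic i (f.f i (X.harmonic i x)))))) = _
        at this
      rw [← e₁] at this
      exact this.trans e₁.symm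
    obtain ⟨b₁, hb₁⟩ := Y.exists_sub_harmonic_eq_d i (f.f i x)
      (by rw [hom_d_apply, hx, map_zero])
    obtain ⟨b₂, hb₂⟩ := Y.exists_sub_harmonic_eq_d i (f.f i (g.f i (f.f i x)))
      (by rw [hom_d_apply, hom_d_apply, hom_d_apply, hx, map_zero, map_zero, map_zero])
    refine (hf i).1 _ hk' (b₁ - b₂) ?_
    have : (𝟙 X - f ≫ g).f i x = x - g.f i (f.f i x) := rfl
    rw [e₂] at hb₂
    rw [this, map_sub, map_sub]
    exact (congr_arg₂ (· - ·) hb₁ hb₂).trans (add_sub_add_left_eq_sub _ _ _)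
  refine ⟨g, ?_, hk, ?_⟩
  · ext1 i
    have := Y.harmonic i ≫= hψ' i =≫ X.harmonic i
    simpa [hg] using this
  · intro i y hy
    obtain ⟨x, hx, z, rfl⟩ := (hf i).2 y hy
    obtain ⟨b, hb⟩ := hk i x hx
    refine ⟨f.f _ b + (𝟙 Y - g ≫ f).f _ z, ?_⟩
    rw [map_add, map_add, hom_d_apply, ← hb, hom_d_apply, ← hom_comp_apply, ← hom_comp_apply]
    have : f ≫ (𝟙 Y - g ≫ f) = (𝟙 X - f ≫ g) ≫ f := by simp
    rw [this]

end ChainComplex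

namespace ChainComplex

open HomologicalComplex

attribute [local instance] Cardinal.fact_isRegular_aleph0

variable {C : Type u} [Category.{v} C] [Preadditive C]

lemma preservesColimitsOfShape_of_add_eq_id {D : Type*} [Category* D] {F₁ F₂ G : D ⥤ C}
    (p₁ : G ⟶ F₁) (p₂ : G ⟶ F₂) (i₁ : F₁ ⟶ G) (i₂ : F₂ ⟶ G) (h : p₁ ≫ i₁ + p₂ ≫ i₂ = 𝟙 G)
    (J : Type*) [Category* J] [PreservesColimitsOfShape J F₁] [PreservesColimitsOfShape J F₂] :
    PreservesColimitsOfShape J G := by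
  have h' (X : D) : p₁.app X ≫ i₁.app X + p₂.app X ≫ i₂.app X = 𝟙 _ := by
    simpa using NatTrans.congr_app h X
  refine ⟨fun {F} ↦ ⟨fun {c} hc ↦ ⟨?_⟩⟩⟩
  have h₁ := isColimitOfPreserves F₁ hc
  have h₂ := isColimitOfPreserves F₂ hc
  let d₁ (s : Cocone (F ⋙ G)) : F₁.obj c.pt ⟶ s.pt :=
    h₁.desc ((Cocone.precompose (Functor.whiskerLeft F i₁)).obj s)
  let d₂ (s : Cocone (F ⋙ G)) : F₂.obj c.pt ⟶ s.pt :=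
    h₂.desc ((Cocone.precompose (Functor.whiskerLeft F i₂)).obj s)
  have fac₁ (s : Cocone (F ⋙ G)) (j : J) :
      F₁.map (c.ι.app j) ≫ d₁ s = i₁.app (F.obj j) ≫ s.ι.app j := h₁.fac _ j
  have fac₂ (s : Cocone (F ⋙ G)) (j : J) :
      F₂.map (c.ι.app j) ≫ d₂ s = i₂.app (F.obj j) ≫ s.ι.app j := h₂.fac _ j
  refine
    { desc := fun s ↦ p₁.app c.pt ≫ d₁ s + p₂.app c.pt ≫ d₂ s
      fac := fun s j ↦ ?_
      uniq := fun s m hm ↦ ?_ }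
  · refine (Preadditive.comp_add _ _ _ _ _ _).trans ?_
    have e₁ : G.map (c.ι.app j) ≫ p₁.app c.pt ≫ d₁ s =
        (p₁.app (F.obj j) ≫ i₁.app (F.obj j)) ≫ s.ι.app j :=
      (p₁.naturality_assoc (c.ι.app j) (d₁ s)).trans
        ((p₁.app (F.obj j) ≫= fac₁ s j).trans (Category.assoc _ _ _).symm)
    have e₂ : G.map (c.ι.app j) ≫ p₂.app c.pt ≫ d₂ s =
        (p₂.app (F.obj j) ≫ i₂.app (F.obj j)) ≫ s.ι.app j :=
      (p₂.naturality_assoc (c.ι.app j) (d₂ s)).trans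
        ((p₂.app (F.obj j) ≫= fac₂ s j).trans (Category.assoc _ _ _).symm)
    refine (congr_arg₂ (· + ·) e₁ e₂).trans ((Preadditive.add_comp _ _ _ _ _ _).symm.trans ?_)
    exact ((h' (F.obj j)) =≫ s.ι.app j).trans (Category.id_comp _)
  · have hm' (j : J) : G.map (c.ι.app j) ≫ m = s.ι.app j := hm j
    have e₁ : d₁ s = i₁.app c.pt ≫ m := h₁.hom_ext fun j ↦
      (fac₁ s j).trans (by rw [← hm', ← i₁.naturality_assoc]; rfl)
    have e₂ : d₂ s = i₂.app c.pt ≫ m := h₂.hom_ext fun j ↦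
      (fac₂ s j).trans (by rw [← hm', ← i₂.naturality_assoc]; rfl)
    rw [e₁, e₂, ← Category.assoc, ← Category.assoc, ← Preadditive.add_comp]
    exact (((h' c.pt) =≫ m).trans (Category.id_comp _)).symm

lemma IsNullHomotopic.precomp {A X Y : ChainComplex C ℤ} {p : X ⟶ Y}
    (hp : IsNullHomotopic p) (u : A ⟶ X) : IsNullHomotopic (u ≫ p) := by
  obtain ⟨h, hh⟩ := hp
  exact ⟨fun i j ↦ u.f i ≫ h i j, fun i ↦ by simp [hh]⟩

variable [HasBinaryBiproducts C]

section

variable (A : ChainComplex C ℤ)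

/-- The cone of a complex `A`, with components `A.X i ⊞ A.X (i - 1)`. -/
noncomputable def cone : ChainComplex C ℤ where
  X i := A.X i ⊞ A.X (i - 1)
  d i j := if h : j + 1 = i then
    biprod.snd ≫ (A.XIsoOfEq (show i - 1 = j by lia)).hom ≫ biprod.inl else 0
  shape i j h := dif_neg h
  d_comp_d' i j k _ _ := by
    split_ifs <;> simp

/-- The first inclusion in the components of the cone. -/
noncomputable def coneInl (i : ℤ) : A.X i ⟶ (cone A).X i :=
  (biprod.inl : A.X i ⟶ A.X i ⊞ A.X (i - 1))

/-- The second inclusion in the components of the cone. -/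
noncomputable def coneInr (i j : ℤ) (h : i + 1 = j) : A.X i ⟶ (cone A).X j :=
  (A.XIsoOfEq (show i = j - 1 by lia)).hom ≫ (biprod.inr : _ ⟶ A.X j ⊞ A.X (j - 1))

/-- Morphisms from the components of the cone. -/
noncomputable def coneDesc {i j : ℤ} (h : i + 1 = j) {Z : C} (a : A.X j ⟶ Z) (b : A.X i ⟶ Z) :
    (cone A).X j ⟶ Z :=
  (biprod.desc a ((A.XIsoOfEq (show j - 1 = i by lia)).hom ≫ b) : A.X j ⊞ A.X (j - 1) ⟶ Z)

@[simp]
lemma coneInl_coneDesc {i j : ℤ} (h : i + 1 = j) {Z : C} (a : A.X j ⟶ Z) (b : A.X i ⟶ Z) :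
    coneInl A j ≫ coneDesc A h a b = a :=
  biprod.inl_desc _ _

@[simp]
lemma coneInr_coneDesc {i j : ℤ} (h : i + 1 = j) {Z : C} (a : A.X j ⟶ Z) (b : A.X i ⟶ Z) :
    coneInr A i j h ≫ coneDesc A h a b = b := by
  obtain rfl : i = j - 1 := by lia
  refine (Category.assoc _ _ _).trans ((Category.id_comp _).trans ?_)
  exact (biprod.inr_desc _ _).trans (Category.id_comp _)

lemma coneInr_d (i j : ℤ) (h : i + 1 = j) :
    coneInr A i j h ≫ (cone A).d j i = coneInl A i := by
  have : (cone A).d j i = biprod.snd ≫ (A.XIsoOfEq (show j - 1 = i by lia)).hom ≫ biprod.inl :=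
    dif_pos h
  rw [this]
  obtain rfl : i = j - 1 := by lia
  refine (Category.assoc _ _ _).trans ((Category.id_comp _).trans ?_)
  exact (biprod.inr_snd_assoc _).trans (Category.id_comp _)

lemma coneInl_d (i j : ℤ) : coneInl A i ≫ (cone A).d i j = 0 := by
  rw [← coneInr_d A i (i + 1) rfl, Category.assoc, d_comp_d, comp_zero]

variable {A} in
lemma cone_X_hom_ext {i j : ℤ} (h : i + 1 = j) {Z : C} {f g : (cone A).X j ⟶ Z}
    (h₁ : coneInl A j ≫ f = coneInl A j ≫ g) (h₂ : coneInr A i j h ≫ f = coneInr A i j h ≫ g) :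
    f = g := by
  obtain rfl : i = j - 1 := by lia
  have (f : (cone A).X j ⟶ Z) : coneInr A (j - 1) j h ≫ f =
      (biprod.inr : _ ⟶ A.X j ⊞ A.X (j - 1)) ≫ f :=
    (Category.assoc _ _ _).trans (Category.id_comp _)
  rw [this, this] at h₂
  exact biprod.hom_ext' _ _ h₁ h₂

/-- The path complex of a complex `A`, with components `A.X i ⊞ A.X (i + 1)`. -/
noncomputable def path : ChainComplex C ℤ where
  X i := A.X i ⊞ A.X (i + 1)
  d i j := if h : j + 1 = i then
    biprod.fst ≫ (A.XIsoOfEq h.symm).hom ≫ biprod.inr else 0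
  shape i j h := dif_neg h
  d_comp_d' i j k _ _ := by
    split_ifs <;> simp

/-- The first projection from the components of the path complex. -/
noncomputable def pathFst (i : ℤ) : (path A).X i ⟶ A.X i :=
  (biprod.fst : A.X i ⊞ A.X (i + 1) ⟶ A.X i)

/-- The second projection from the components of the path complex. -/
noncomputable def pathSnd (i j : ℤ) (h : i + 1 = j) : (path A).X i ⟶ A.X j :=
  (biprod.snd : A.X i ⊞ A.X (i + 1) ⟶ A.X (i + 1)) ≫ (A.XIsoOfEq h).hom

/-- Morphisms to the components of the path complex. -/
noncomputable def pathLift {i j : ℤ} (h : i + 1 = j) {Z : C} (a : Z ⟶ A.X i) (b : Z ⟶ A.X j) :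
    Z ⟶ (path A).X i :=
  (biprod.lift a (b ≫ (A.XIsoOfEq h.symm).hom) : Z ⟶ A.X i ⊞ A.X (i + 1))

@[simp]
lemma pathLift_pathFst {i j : ℤ} (h : i + 1 = j) {Z : C} (a : Z ⟶ A.X i) (b : Z ⟶ A.X j) :
    pathLift A h a b ≫ pathFst A i = a :=
  biprod.lift_fst _ _

@[simp]
lemma pathLift_pathSnd {i j : ℤ} (h : i + 1 = j) {Z : C} (a : Z ⟶ A.X i) (b : Z ⟶ A.X j) :
    pathLift A h a b ≫ pathSnd A i j h = b := by
  subst h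
  exact (biprod.lift_snd_assoc _ _ _).trans (by simp)

lemma d_pathSnd (i j : ℤ) (h : i + 1 = j) :
    (path A).d j i ≫ pathSnd A i j h = pathFst A j := by
  have : (path A).d j i = biprod.fst ≫ (A.XIsoOfEq h.symm).hom ≫ biprod.inr :=
    dif_pos h
  rw [this]
  subst h
  refine (Category.assoc _ _ _).trans ?_
  refine (biprod.fst ≫= (Category.assoc _ _ _).trans ((Category.id_comp _).trans ?_)).trans
    (Category.comp_id _)
  exact biprod.inr_snd_assoc _

lemma d_pathFst (i j : ℤ) : (path A).d i j ≫ pathFst A j = 0 := by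
  rw [← d_pathSnd A (j - 1) j (by lia), d_comp_d_assoc, zero_comp]

variable {A} in
lemma path_X_hom_ext {i j : ℤ} (h : i + 1 = j) {Z : C} {f g : Z ⟶ (path A).X i}
    (h₁ : f ≫ pathFst A i = g ≫ pathFst A i)
    (h₂ : f ≫ pathSnd A i j h = g ≫ pathSnd A i j h) : f = g := by
  subst h
  have : pathSnd A i (i + 1) rfl = (biprod.snd : A.X i ⊞ A.X (i + 1) ⟶ A.X (i + 1)) :=
    Category.comp_id _
  rw [this] at h₂
  exact biprod.hom_ext _ _ h₁ h₂

end

/-- The functoriality of the path complex. -/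
noncomputable def pathMap {X Y : ChainComplex C ℤ} (f : X ⟶ Y) : path X ⟶ path Y where
  f i := pathLift Y rfl (pathFst X i ≫ f.f i) (pathSnd X i (i + 1) rfl ≫ f.f (i + 1))
  comm' i j h := by
    obtain rfl : j + 1 = i := h
    apply path_X_hom_ext rfl
    · simp [d_pathFst, reassoc_of% d_pathFst]
    · simp [d_pathSnd, reassoc_of% d_pathSnd]

@[simp]
lemma pathMap_f_pathFst {X Y : ChainComplex C ℤ} (f : X ⟶ Y) (i : ℤ) :
    (pathMap f).f i ≫ pathFst Y i = pathFst X i ≫ f.f i :=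
  pathLift_pathFst _ rfl _ _

@[simp]
lemma pathMap_f_pathSnd {X Y : ChainComplex C ℤ} (f : X ⟶ Y) (i j : ℤ) (h : i + 1 = j) :
    (pathMap f).f i ≫ pathSnd Y i j h = pathSnd X i j h ≫ f.f j := by
  subst h
  exact pathLift_pathSnd _ rfl _ _

/-- The path complex, as a functor. -/
@[simps]
noncomputable def pathFunctor (C : Type u) [Category.{v} C] [Preadditive C]
    [HasBinaryBiproducts C] : ChainComplex C ℤ ⥤ ChainComplex C ℤ where
  obj := path
  map := pathMap
  map_id X := by
    ext i
    apply path_X_hom_ext rfl <;> simp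
  map_comp f g := by
    ext i
    apply path_X_hom_ext rfl <;> simp [reassoc_of% pathMap_f_pathFst, reassoc_of% pathMap_f_pathSnd]

/-- Families of morphisms raising the degree by one. -/
abbrev DegreeOneHom (A X : ChainComplex C ℤ) : Type v :=
  ∀ i j : ℤ, i + 1 = j → (A.X i ⟶ X.X j)

/-- Morphisms from the cone are families of morphisms raising the degree by one. -/
noncomputable def coneHomEquiv (A X : ChainComplex C ℤ) :
    (cone A ⟶ X) ≃ DegreeOneHom A X where
  toFun q i j h := coneInr A i j h ≫ q.f j
  invFun γ :=
    { f := fun i ↦ coneDesc A (sub_add_cancel i 1) (γ i (i + 1) rfl ≫ X.d (i + 1) i)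
        (γ (i - 1) i (by lia))
      comm' := fun i j h ↦ by
        obtain rfl : j = i - 1 := by have : j + 1 = i := h; lia
        apply cone_X_hom_ext (sub_add_cancel i 1)
        · simp [reassoc_of% coneInl_d, reassoc_of% coneInl_coneDesc]
        · have key (k : ℤ) (hk : i - 1 + 1 = k) :
              γ (i - 1) k (by lia) ≫ X.d k (i - 1) = γ (i - 1) i (by lia) ≫ X.d i (i - 1) := by
            obtain rfl : k = i := by lia
            rfl
          simp [reassoc_of% coneInr_d, reassoc_of% coneInr_coneDesc, key] }
  left_inv q := by
    ext i
    apply cone_X_hom_ext (sub_add_cancel i 1)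
    · simp [reassoc_of% coneInr_d]
    · simp
  right_inv γ := by
    ext i j h
    obtain rfl : i = j - 1 := by lia
    simp

/-- Morphisms to the path complex are families of morphisms raising the degree by one. -/
noncomputable def pathHomEquiv (A X : ChainComplex C ℤ) :
    (A ⟶ path X) ≃ DegreeOneHom A X where
  toFun q i j h := q.f i ≫ pathSnd X i j h
  invFun γ :=
    { f := fun i ↦ pathLift X rfl (A.d i (i - 1) ≫ γ (i - 1) i (by lia)) (γ i (i + 1) rfl)
      comm' := fun i j h ↦ by
        obtain rfl : j + 1 = i := h
        apply path_X_hom_ext rfl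
        · simp [d_pathFst]
        · have key (k : ℤ) (hk : j = k) :
              A.d (j + 1) k ≫ γ k (j + 1) (by lia) = A.d (j + 1) j ≫ γ j (j + 1) rfl := by
            subst hk
            rfl
          simp [d_pathSnd, key] }
  left_inv q := by
    ext i
    apply path_X_hom_ext rfl
    · simp [← d_pathSnd X (i - 1) i (by lia)]
      rw [d_pathSnd, pathLift_pathFst]
    · simp
  right_inv γ := by
    ext i j h
    subst h
    simp

/-- The functor of morphisms from the cone of `A` is the functor of morphisms from `A` to
the path complex. -/
noncomputable def coyonedaConeIso (A : ChainComplex C ℤ) :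
    pathFunctor C ⋙ coyoneda.obj (Opposite.op A) ≅ coyoneda.obj (Opposite.op (cone A)) :=
  NatIso.ofComponents
    (fun X ↦ ((pathHomEquiv A X).trans (coneHomEquiv A X).symm).toIso) (fun {X Y} f ↦ by
      ext q
      apply (coneHomEquiv A Y).injective
      have h₁ : coneHomEquiv A Y ((coneHomEquiv A X).symm (pathHomEquiv A X q) ≫ f) =
          fun i j h ↦ pathHomEquiv A X q i j h ≫ f.f j := by
        refine Eq.trans ?_ (congr_arg (fun γ i j h ↦ γ i j h ≫ f.f j)
          ((coneHomEquiv A X).apply_symm_apply (pathHomEquiv A X q)))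
        ext i j h
        exact (Category.assoc _ _ _).symm
      have h₂ : pathHomEquiv A Y (q ≫ pathMap f) =
          fun i j h ↦ pathHomEquiv A X q i j h ≫ f.f j := by
        ext i j h
        exact (Category.assoc _ _ _).trans
          ((q.f i ≫= pathMap_f_pathSnd f i j h).trans (Category.assoc _ _ _).symm)
      exact ((coneHomEquiv A Y).apply_symm_apply _).trans (h₂.trans h₁.symm))

lemma preservesColimitsOfShape_pathFunctor (J : Type*) [Category* J] [HasColimitsOfShape J C] :
    PreservesColimitsOfShape J (pathFunctor C) := by
  apply preservesColimitsOfShape_of_eval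
  intro i
  refine preservesColimitsOfShape_of_add_eq_id
    (G := pathFunctor C ⋙ eval C (ComplexShape.down ℤ) i)
    (F₁ := eval C (ComplexShape.down ℤ) i) (F₂ := eval C (ComplexShape.down ℤ) (i + 1))
    { app := fun X ↦ pathFst X i
      naturality := fun X Y f ↦ pathMap_f_pathFst f i }
    { app := fun X ↦ pathSnd X i (i + 1) rfl
      naturality := fun X Y f ↦ pathMap_f_pathSnd f i (i + 1) rfl }
    { app := fun X ↦ pathLift X (i := i) rfl (𝟙 _) 0
      naturality := fun X Y f ↦ ?_ }
    { app := fun X ↦ pathLift X (i := i) rfl 0 (𝟙 _)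
      naturality := fun X Y f ↦ ?_ } ?_ J
  · have : f.f i ≫ pathLift Y rfl (𝟙 _) 0 = pathLift X rfl (𝟙 _) 0 ≫ (pathMap f).f i := by
      apply path_X_hom_ext rfl <;>
        simp [reassoc_of% pathLift_pathFst, reassoc_of% pathLift_pathSnd]
    exact this
  · have : f.f (i + 1) ≫ pathLift Y rfl 0 (𝟙 _) = pathLift X rfl 0 (𝟙 _) ≫ (pathMap f).f i := by
      apply path_X_hom_ext rfl <;>
        simp [reassoc_of% pathLift_pathFst, reassoc_of% pathLift_pathSnd]
    exact this
  · ext X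
    have : pathFst X i ≫ pathLift X rfl (𝟙 _) 0 + pathSnd X i (i + 1) rfl ≫ pathLift X rfl 0 (𝟙 _) =
        𝟙 _ := by
      apply path_X_hom_ext rfl <;> simp
    exact this

lemma isFinitelyPresentable_cone [HasColimitsOfSize.{w, w} C] (A : ChainComplex C ℤ)
    [IsFinitelyPresentable.{w} A] : IsFinitelyPresentable.{w} (cone A) := by
  have : (pathFunctor C).IsCardinalAccessible Cardinal.aleph0.{w} :=
    ⟨fun J _ _ ↦ preservesColimitsOfShape_pathFunctor J⟩
  have : (coyoneda.obj (Opposite.op A)).IsCardinalAccessible Cardinal.aleph0.{w} :=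
    inferInstanceAs (IsFinitelyPresentable.{w} A)
  exact Functor.isCardinalAccessible_of_natIso (coyonedaConeIso A) _

/-- The inclusion of a complex in its cone. -/
@[simps]
noncomputable def coneι (A : ChainComplex C ℤ) : A ⟶ cone A where
  f i := coneInl A i + A.d i (i - 1) ≫ coneInr A (i - 1) i (by lia)
  comm' i j h := by
    obtain rfl : j = i - 1 := by have : j + 1 = i := h; lia
    simp [coneInl_d, coneInr_d]

lemma IsNullHomotopic.exists_coneι_comp_eq {A X : ChainComplex C ℤ} {p : A ⟶ X}
    (hp : IsNullHomotopic p) : ∃ q : cone A ⟶ X, coneι A ≫ q = p := by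
  obtain ⟨h, hh⟩ := hp
  refine ⟨(coneHomEquiv A X).symm (fun i j _ ↦ h i j), ?_⟩
  ext i
  rw [hh]
  simp [coneHomEquiv, add_comm]

section

variable {R : Type u} [Ring R]

lemma cyclesToBoundaries_id_cone (A : ChainComplex (ModuleCat.{u} R) ℤ) :
    CyclesToBoundaries (𝟙 (cone A)) := by
  intro i x hx
  have h : 𝟙 ((cone A).X i) =
      coneDesc A (sub_add_cancel i 1) (coneInr A i (i + 1) rfl) 0 ≫ (cone A).d (i + 1) i +
        (cone A).d i (i - 1) ≫ coneDesc A (sub_add_cancel (i - 1) 1)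
          (coneInr A (i - 1) i (sub_add_cancel i 1)) 0 := by
    apply cone_X_hom_ext (sub_add_cancel i 1)
    · simp [reassoc_of% coneInl_coneDesc, coneInr_d, reassoc_of% coneInl_d]
    · simp [reassoc_of% coneInr_coneDesc, reassoc_of% coneInr_d]
  refine ⟨coneDesc A (sub_add_cancel i 1) (coneInr A i (i + 1) rfl) 0 x,
    (ConcreteCategory.congr_hom h x).trans ?_⟩
  refine (congr_arg (_ + ·) (congr_arg (coneDesc A (sub_add_cancel (i - 1) 1)
    (coneInr A (i - 1) i (sub_add_cancel i 1)) 0) hx)).trans ?_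
  rw [map_zero]
  exact add_zero _

lemma quasiIso_biprod_inl (B K : ChainComplex (ModuleCat.{u} R) ℤ)
    (hK : CyclesToBoundaries (𝟙 K)) : QuasiIso (biprod.inl : B ⟶ B ⊞ K) := by
  rw [quasiIso_iff_elements]
  refine fun n ↦ ⟨fun x hx y hy ↦ ⟨(biprod.fst : B ⊞ K ⟶ B).f (n + 1) y, ?_⟩, fun y hy ↦ ?_⟩
  · rw [hom_d_apply, ← hy, ← hom_comp_apply, biprod.inl_fst]
    rfl
  · obtain ⟨z, hz⟩ := hK n ((biprod.snd : B ⊞ K ⟶ K).f n y) (by rw [hom_d_apply, hy, map_zero])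
    refine ⟨(biprod.fst : B ⊞ K ⟶ B).f n y, by rw [hom_d_apply, hy, map_zero],
      (biprod.inr : K ⟶ B ⊞ K).f (n + 1) z, ?_⟩
    rw [hom_d_apply, ← hz]
    exact (congr_arg (fun p : B ⊞ K ⟶ B ⊞ K ↦ p.f n y) (biprod.total (X := B) (Y := K))).symm

end

end ChainComplex

namespace ChainComplex

open HomologicalComplex

attribute [local instance] Cardinal.fact_isRegular_aleph0

variable {R : Type u} [Ring R]

lemma quasiIso_biprod_map_id {B K L : ChainComplex (ModuleCat.{u} R) ℤ} (φ : K ⟶ L)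
    (hK : CyclesToBoundaries (𝟙 K)) (hL : CyclesToBoundaries (𝟙 L)) :
    QuasiIso (biprod.map (𝟙 B) φ) := by
  have := quasiIso_biprod_inl B K hK
  have : QuasiIso ((biprod.inl : B ⟶ B ⊞ K) ≫ biprod.map (𝟙 B) φ) := by
    have := quasiIso_biprod_inl B L hL
    rwa [biprod.inl_map, Category.id_comp]
  exact quasiIso_of_comp_left biprod.inl _

variable (R) in
/-- The quasi-isomorphisms between finitely presentable complexes. -/
def quasiIsoFinitelyPresentable :
    ObjectProperty (Arrow (ChainComplex (ModuleCat.{u} R) ℤ)) :=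
  fun a ↦ QuasiIso a.hom ∧ IsFinitelyPresentable.{u} a.left ∧ IsFinitelyPresentable.{u} a.right

lemma exists_factorization_quasiIsoFinitelyPresentable [IsSemisimpleRing R]
    {A B X Y : ChainComplex (ModuleCat.{u} R) ℤ}
    [IsFinitelyPresentable.{u} A] [IsFinitelyPresentable.{u} B]
    (f : X ⟶ Y) [QuasiIso f] (a : A ⟶ B) (s : Arrow.mk a ⟶ Arrow.mk f) :
    ∃ (W : Arrow (ChainComplex (ModuleCat.{u} R) ℤ)) (p : Arrow.mk a ⟶ W)
      (q : W ⟶ Arrow.mk f), p ≫ q = s ∧ quasiIsoFinitelyPresentable R W := by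
  obtain ⟨u, v, huv, rfl⟩ : ∃ (u : A ⟶ X) (v : B ⟶ Y) (huv : u ≫ f = a ≫ v),
      s = Arrow.homMk u v huv := ⟨s.left, s.right, s.w, rfl⟩
  obtain ⟨g, hg, hk, hl⟩ := exists_quasiInverse f
  have hg' {Z} (t : X ⟶ Z) : g ≫ f ≫ g ≫ t = g ≫ t := by simpa using hg =≫ t
  obtain ⟨q₀, hq₀⟩ := (hk.isNullHomotopic.precomp u).exists_coneι_comp_eq
  let u' : cone A ⟶ X := q₀ ≫ (𝟙 X - f ≫ g)
  have hu' : coneι A ≫ u' = u ≫ (𝟙 X - f ≫ g) := by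
    rw [← Category.assoc, hq₀]
    simp [hg]
  let w : pushout (coneι A) a ⟶ Y :=
    pushout.desc (u' ≫ f) (v ≫ (𝟙 Y - g ≫ f)) (by
      rw [reassoc_of% hu']
      simp [huv, reassoc_of% huv])
  have hw : w ≫ (𝟙 Y - g ≫ f) = w := by
    apply pushout.hom_ext
    · rw [pushout.inl_desc_assoc, pushout.inl_desc]
      simp [u', hg']
    · rw [pushout.inr_desc_assoc, pushout.inr_desc]
      simp [hg']
  obtain ⟨q₁, hq₁⟩ := (hl.isNullHomotopic.precomp w).exists_coneι_comp_eq
  rw [hw] at hq₁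
  have : IsFinitelyPresentable.{u} (cone A) := isFinitelyPresentable_cone A
  have : IsFinitelyPresentable.{u} (pushout (coneι A) a) :=
    (IsPushout.of_hasPushout (coneι A) a).isFinitelyPresentable
  have : IsFinitelyPresentable.{u} (cone (pushout (coneι A) a)) := isFinitelyPresentable_cone _
  refine ⟨Arrow.mk (biprod.map (𝟙 B) (pushout.inl (coneι A) a ≫ coneι _)),
    Arrow.homMk (biprod.lift a (coneι A))
      (biprod.lift (𝟙 B) (pushout.inr (coneι A) a ≫ coneι _)) ?_,
    Arrow.homMk (biprod.desc (v ≫ g) u') (biprod.desc (v ≫ g ≫ f) q₁) ?_, ?_,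
    quasiIso_biprod_map_id _ (cyclesToBoundaries_id_cone _) (cyclesToBoundaries_id_cone _),
    isFinitelyPresentable_biprod _ _, isFinitelyPresentable_biprod _ _⟩
  · apply biprod.hom_ext
    · simp
    · simp [pushout.condition_assoc]
  · apply biprod.hom_ext'
    · simp
    · simpa [hq₁] using (pushout.inl_desc _ _ _).symm
  · have h₁ : biprod.lift a (coneι A) ≫ biprod.desc (v ≫ g) u' = u := by
      rw [biprod.lift_desc, hu', ← reassoc_of% huv]
      simp
    have h₂ : biprod.lift (𝟙 B) (pushout.inr (coneι A) a ≫ coneι _) ≫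
        biprod.desc (v ≫ g ≫ f) q₁ = v := by
      rw [biprod.lift_desc, Category.assoc, hq₁, pushout.inr_desc]
      simp
    exact Arrow.hom_ext _ _ h₁ h₂

lemma ind_quasiIsoFinitelyPresentable [IsSemisimpleRing R]
    {X Y : ChainComplex (ModuleCat.{u} R) ℤ} (f : X ⟶ Y) [QuasiIso f] :
    ObjectProperty.ind.{u} (quasiIsoFinitelyPresentable R) (Arrow.mk f) := by
  have : IsFinitelyAccessibleCategory.{u} (Arrow (ChainComplex (ModuleCat.{u} R) ℤ)) :=
    HomologicalComplex.isFinitelyAccessibleCategory_arrow R _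
  rw [ObjectProperty.ind_iff_exists]
  · intro Z s _
    have := Arrow.isFinitelyPresentable_left Z
    have := Arrow.isFinitelyPresentable_right Z
    exact exists_factorization_quasiIsoFinitelyPresentable f Z.hom s
  · rintro a ⟨_, _, _⟩
    exact Arrow.isFinitelyPresentable_mk a.hom

end ChainComplex

namespace PaperAcc

attribute [local instance] Cardinal.fact_isRegular_aleph0

lemma isCardinalFiltered_aleph0_iff_isFiltered (J : Type v) [SmallCategory J] :
    IsCardinalFiltered J Cardinal.aleph0 ↔ IsFiltered J := by
  rw [← CategoryTheory.isCardinalFiltered_aleph0_iff.{v}]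
  refine ⟨fun h ↦ ⟨fun {A} _ F hA ↦ ?_⟩, fun h A _ hA F ↦ ?_⟩
  · rw [hasCardinalLT_iff_cardinal_mk_lt] at hA
    exact h A hA F
  · rw [← hasCardinalLT_iff_cardinal_mk_lt] at hA
    exact h.nonempty_cocone F hA

lemma isPresentable_of_isFinitelyPresentable {M : Type u} [Category.{v} M] (X : M)
    [IsFinitelyPresentable.{v} X] : IsPresentable Cardinal.aleph0 X := by
  intro J _ hJ
  have := (isCardinalFiltered_aleph0_iff_isFiltered J).1 hJ
  have := isFinitelyPresentable_iff_preservesFilteredColimits.1 ‹IsFinitelyPresentable.{v} X›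
  exact ⟨this.preserves_filtered_colimits J⟩

/-- Corollary 5.3. Let `R` be a semi-simple ring and `Ch(R)` the category
of unbounded chain complexes of left `R`-modules (underlying the projective model structure,
whose weak equivalences are the quasi-isomorphisms). Then the full subcategory `W_qis` of the
arrow category `Ch(R)^→` spanned by the quasi-isomorphisms is finitely accessible: it is
closed under filtered colimits in `Ch(R)^→` and every quasi-isomorphism is a filtered colimit
in `Ch(R)^→` of quasi-isomorphisms between finitely presentable chain complexes. -/
theorem statement10 (R : Type u) [Ring R] [IsSemisimpleRing R] :
    ClosedUnderFilteredColimits Cardinal.aleph0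
      {a : Arrow (ChainComplex (ModuleCat.{u} R) ℤ) | QuasiIso a.hom} ∧
    ∀ {X Y : ChainComplex (ModuleCat.{u} R) ℤ} (f : X ⟶ Y), QuasiIso f →
      Nonempty (FilteredColimitPresentation (M := Arrow (ChainComplex (ModuleCat.{u} R) ℤ))
        Cardinal.aleph0
        (PresentableArrowsIn Cardinal.aleph0
          {a : Arrow (ChainComplex (ModuleCat.{u} R) ℤ) | QuasiIso a.hom})
        (Arrow.mk f)) := by
  refine ⟨fun J _ hJ F c hc hF ↦ ?_, fun {X Y} f _ ↦ ?_⟩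
  · have := (isCardinalFiltered_aleph0_iff_isFiltered J).1 hJ
    exact ChainComplex.quasiIso_of_isColimit hc hF
  · obtain ⟨J, _, hJ, pres, hpres⟩ := ChainComplex.ind_quasiIsoFinitelyPresentable f
    exact ⟨{
      J := J
      filtered := (isCardinalFiltered_aleph0_iff_isFiltered J).2 hJ
      F := pres.diag
      mem := fun j ↦ by
        obtain ⟨h, _, _⟩ := hpres j
        exact ⟨h, isPresentable_of_isFinitelyPresentable _,
          isPresentable_of_isFinitelyPresentable _⟩
      c := pres.cocone
      isColimit := pres.isColimit
      iso := Iso.refl _ }⟩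

end PaperAcc
end
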